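/- Let d ≥ 1 be an integer and q > 0 with α(d + 2q) < 1 + N, and let T be a compact interval in (0, ∞) × ℝ^N. Then there exist a constant C < ∞ and r₀ > 0 such that the following holds for all integers n ≥ 2: for every family of nonnegative reals (q_{j,k})_{1≤j≤n, 1≤k≤d} with Σ_{k=1}^d q_{j,k} = q for each j, every 0 < r ≤ r₀, and every compact subinterval I ⊆ T all of whose side lengths are ≤ r, ∫_{Iⁿ} ∏_{k=1}^d ( ∫_{ℝⁿ} ( ∏_{j=1}^n |c_j|^{q_{j,k}} ) exp( −(1/2) Q(c; z¹, …, zⁿ) ) dc ) dz¹ ⋯ dzⁿ ≤ Cⁿ (n!)^{αd + (1/2 + α)q} r^{n(1 + N − α(d + q))}. -/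

import Mathlib

open MeasureTheory Set
open scoped ENNReal

/-- The time–space Fourier transform `𝒢_{t,x}(τ, ξ)` of the wave kernel
`g_{t,x}(s, y) = G(t − s, x − y) 1_{[0,t]}(s)`. -/
noncomputable def Gker (N : ℕ) (t : ℝ) (x : EuclideanSpace ℝ (Fin N)) (τ : ℝ)
    (ξ : EuclideanSpace ℝ (Fin N)) : ℂ :=
  (Complex.exp (-Complex.I * ((inner ℝ x ξ : ℝ) : ℂ)) / (2 * (‖ξ‖ : ℂ))) *
    ((Complex.exp (-Complex.I * (t : ℂ) * (τ : ℂ)) -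
        Complex.exp (Complex.I * (t : ℂ) * (‖ξ‖ : ℂ))) / ((τ : ℂ) + (‖ξ‖ : ℂ)) -
      (Complex.exp (-Complex.I * (t : ℂ) * (τ : ℂ)) -
        Complex.exp (-Complex.I * (t : ℂ) * (‖ξ‖ : ℂ))) / ((τ : ℂ) - (‖ξ‖ : ℂ)))

/-- The quadratic form
`Q(c; z¹, …, zⁿ) = ∫_ℝ ∫_{ℝ^N} |Σ_j c_j 𝒢_{z^j}(τ,ξ)|² |τ|^{1−2H} h_β(ξ) dξ dτ`, which (up
to a positive constant) is the variance `Var(Σ_j c_j u₁(z^j))`. -/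
noncomputable def Qvar (N : ℕ) (H : ℝ) (hfun : EuclideanSpace ℝ (Fin N) → ℝ) {n : ℕ}
    (z : Fin n → ℝ × EuclideanSpace ℝ (Fin N)) (c : Fin n → ℝ) : ℝ :=
  ∫ τ : ℝ, ∫ ξ : EuclideanSpace ℝ (Fin N),
    ‖∑ j, (c j : ℂ) * Gker N (z j).1 (z j).2 τ ξ‖ ^ 2 *
      |τ| ^ (1 - 2 * H) * hfun ξ

/-- `α = (2H + 1 − N + β)/2`. -/
noncomputable def alphaExp (N : ℕ) (H β : ℝ) : ℝ := (2 * H + 1 - N + β) / 2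

/-- one-dimensional spectral weight -/
noncomputable def w1 (N : ℕ) (a : ℝ) (ρ : ℝ) : ℝ := min (|ρ| ^ N) (|ρ| ^ (-2 * a - 1))

/-- one-dimensional quadratic form -/
noncomputable def Q1 (N : ℕ) (a : ℝ) {n : ℕ} (s c : Fin n → ℝ) : ℝ :=
  ∫ ρ : ℝ, w1 N a ρ * ‖∑ j, (c j : ℂ) * Complex.exp (-Complex.I * ρ * s j)‖ ^ 2

/-- Cauchy-Schwarz for lower integrals -/
lemma lintegral_cs {α : Type*} [MeasurableSpace α] (μ : Measure α) (f g : α → ℝ≥0∞)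
    (hf : AEMeasurable f μ) (hg : AEMeasurable g μ) :
    (∫⁻ x, f x * g x ∂μ) ^ 2 ≤ (∫⁻ x, f x ^ 2 ∂μ) * (∫⁻ x, g x ^ 2 ∂μ) := by
  have h := ENNReal.lintegral_mul_le_Lp_mul_Lq μ (p := 2) (q := 2)
    (Real.HolderConjugate.two_two) hf hg
  simp only [Pi.mul_apply] at h
  calc _ ≤ ((∫⁻ x, f x ^ (2:ℝ) ∂μ) ^ (1 / (2:ℝ)) * (∫⁻ x, g x ^ (2:ℝ) ∂μ) ^ (1 / (2:ℝ))) ^ 2 := by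
        gcongr
    _ = _ := by
        rw [mul_pow, ← ENNReal.rpow_natCast, ← ENNReal.rpow_natCast, ← ENNReal.rpow_mul,
          ← ENNReal.rpow_mul]
        norm_num

lemma w1_nonneg (N : ℕ) (a ρ : ℝ) : 0 ≤ w1 N a ρ := by unfold w1; positivity

lemma w1_measurable (N : ℕ) (a : ℝ) : Measurable (w1 N a) := by unfold w1; fun_prop

lemma w1_le_one (N : ℕ) {a : ℝ} (ha : 0 < a) (ρ : ℝ) : w1 N a ρ ≤ 1 := by
  unfold w1
  rcases le_total |ρ| 1 with h | h
  · exact (min_le_left _ _).trans (pow_le_one₀ (abs_nonneg _) h)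
  · exact (min_le_right _ _).trans (Real.rpow_le_one_of_one_le_of_nonpos h (by linarith))

lemma w1_integrable (N : ℕ) {a : ℝ} (ha : 0 < a) : Integrable (w1 N a) := by
  have h : Integrable (fun x : ℝ => (2 : ℝ) ^ (2 * a + 1) * (1 + ‖x‖) ^ (-(2 * a + 1))) :=
    (integrable_one_add_norm (by simp; linarith)).const_mul _
  refine h.mono' (w1_measurable N a).aestronglyMeasurable (Filter.Eventually.of_forall ?_)
  intro x
  rw [Real.norm_of_nonneg (w1_nonneg _ _ _), Real.norm_eq_abs, Real.rpow_neg (by positivity),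
    ← div_eq_mul_inv, ← Real.div_rpow (by norm_num) (by positivity)]
  rcases le_total |x| 1 with hx | hx
  · refine (w1_le_one N ha x).trans ?_
    apply Real.one_le_rpow _ (by linarith)
    rw [le_div_iff₀ (by positivity)]; linarith
  · refine (min_le_right _ _).trans ?_
    rw [show -2 * a - 1 = -(2 * a + 1) by ring, Real.rpow_neg (by positivity),
      ← Real.inv_rpow (by positivity)]
    apply Real.rpow_le_rpow (by positivity) _ (by linarith)
    rw [inv_eq_one_div, div_le_div_iff₀ (by positivity) (by positivity)]; linarith

lemma expsum_bound {n : ℕ} (s c : Fin n → ℝ) (ρ : ℝ) :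
    ‖∑ j, (c j : ℂ) * Complex.exp (-Complex.I * ρ * s j)‖ ≤ ∑ j, |c j| := by
  refine (norm_sum_le _ _).trans (Finset.sum_le_sum fun j _ => ?_)
  rw [norm_mul, show -Complex.I * ρ * s j = ((-ρ * s j : ℝ) : ℂ) * Complex.I by push_cast; ring,
    Complex.norm_exp_ofReal_mul_I]
  simp

lemma Q1_integrable (N : ℕ) {a : ℝ} (ha : 0 < a) {n : ℕ} (s c : Fin n → ℝ) :
    Integrable (fun ρ : ℝ => w1 N a ρ * ‖∑ j, (c j : ℂ) * Complex.exp (-Complex.I * ρ * s j)‖ ^ 2) := by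
  refine (w1_integrable N ha).mul_bdd (c := (∑ j, |c j|) ^ 2) ?_ ?_
  · apply Continuous.aestronglyMeasurable; fun_prop
  · refine Filter.Eventually.of_forall fun ρ => ?_
    rw [norm_pow, norm_norm]
    gcongr
    exact expsum_bound s c ρ

lemma Q1_nonneg (N : ℕ) (a : ℝ) {n : ℕ} (s c : Fin n → ℝ) : 0 ≤ Q1 N a s c :=
  integral_nonneg fun ρ => mul_nonneg (w1_nonneg _ _ _) (by positivity)

lemma Q1_perm (N : ℕ) (a : ℝ) {n : ℕ} (s c : Fin n → ℝ) (π : Equiv.Perm (Fin n)) :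
    Q1 N a (s ∘ π) (c ∘ π) = Q1 N a s c := by
  unfold Q1
  congr 1; ext ρ
  congr 3
  exact Equiv.sum_comp π (fun j => (c j : ℂ) * Complex.exp (-Complex.I * ρ * s j))

open scoped FourierTransform

lemma schwartz_rep (f : SchwartzMap ℝ ℂ) :
    ∃ g : ℝ → ℂ, Continuous g ∧ (∃ C : ℝ, 0 < C ∧ ∀ u, ‖g u‖ ≤ C * (1 + |u|) ^ (-(4:ℝ))) ∧
      ∀ s : ℝ, f s = ∫ u : ℝ, Complex.exp (-Complex.I * s * u) * g u := by
  set F : SchwartzMap ℝ ℂ := 𝓕 f with hF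
  have hFc : (F : ℝ → ℂ) = 𝓕 (f : ℝ → ℂ) := SchwartzMap.fourier_coe f
  have hpi := Real.pi_pos
  refine ⟨fun u => ((2 * Real.pi)⁻¹ : ℝ) * F (-(u / (2 * Real.pi))), ?_, ?_, ?_⟩
  · have := F.continuous
    fun_prop
  · set M : ℝ := 2 ^ 4 * ((Finset.Iic (4, 0)).sup
      fun m : ℕ × ℕ => SchwartzMap.seminorm ℝ m.1 m.2) F with hM
    have hb : ∀ x, (1 + ‖x‖) ^ 4 * ‖F x‖ ≤ M := by
      intro x
      have := SchwartzMap.one_add_le_sup_seminorm_apply (𝕜 := ℝ) (m := (4, 0)) (k := 4) (n := 0)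
        le_rfl le_rfl F x
      simpa using this
    have hM0 : 0 ≤ M := le_trans (by positivity) (hb 0)
    refine ⟨(2 * Real.pi) ^ 4 * (M + 1), by positivity, fun u => ?_⟩
    rw [norm_mul, Complex.norm_real, Real.norm_of_nonneg (by positivity)]
    have h1 := hb (-(u / (2 * Real.pi)))
    have h2pi : (1:ℝ) ≤ 2 * Real.pi := by linarith [Real.pi_gt_three]
    rw [Real.rpow_neg (by positivity), ← div_eq_mul_inv, le_div_iff₀ (by positivity)]
    rw [show (4:ℝ) = ((4:ℕ):ℝ) by norm_num, Real.rpow_natCast]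
    rw [norm_neg, norm_div, Real.norm_eq_abs, Real.norm_of_nonneg (by positivity : 0 ≤ 2 * Real.pi)] at h1
    have h3 : (1 + |u|) ^ 4 ≤ (2 * Real.pi) ^ 4 * (1 + |u| / (2 * Real.pi)) ^ 4 := by
      rw [← mul_pow]
      gcongr
      rw [mul_add, mul_div_cancel₀ _ (by positivity)]
      linarith
    calc (2 * Real.pi)⁻¹ * ‖F (-(u / (2 * Real.pi)))‖ * (1 + |u|) ^ 4
        ≤ 1 * ‖F (-(u / (2 * Real.pi)))‖ * ((2 * Real.pi) ^ 4 * (1 + |u| / (2 * Real.pi)) ^ 4) := by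
          gcongr
          exact inv_le_one_of_one_le₀ h2pi
      _ = (2 * Real.pi) ^ 4 * ((1 + |u| / (2 * Real.pi)) ^ 4 * ‖F (-(u / (2 * Real.pi)))‖) := by ring
      _ ≤ (2 * Real.pi) ^ 4 * (M + 1) := by gcongr; linarith
  · intro s
    have hinv : 𝓕⁻ (𝓕 (f : ℝ → ℂ)) s = f s :=
      f.integrable.fourierInv_fourier_eq (by rw [← hFc]; exact F.integrable) f.continuous.continuousAt
    rw [← hinv, Real.fourierInv_eq', ← hFc]
    have := Measure.integral_comp_mul_left
      (fun v : ℝ => Complex.exp (↑(2 * Real.pi * inner ℝ v s) * Complex.I) • F v)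
      (-(2 * Real.pi)⁻¹)
    rw [show |(-(2 * Real.pi)⁻¹)⁻¹| = 2 * Real.pi by
      rw [inv_neg, abs_neg, inv_inv, abs_of_pos (by positivity)]] at this
    have h2 : (∫ v : ℝ, Complex.exp (↑(2 * Real.pi * inner ℝ v s) * Complex.I) • F v) =
        ((2 * Real.pi)⁻¹ : ℝ) • ∫ (x : ℝ), (fun v : ℝ => Complex.exp (↑(2 * Real.pi * inner ℝ v s) * Complex.I) • F v) (-(2 * Real.pi)⁻¹ * x) := by
      rw [this, smul_smul, inv_mul_cancel₀ (by positivity), one_smul]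
    rw [h2, ← integral_smul]
    congr 1; ext u
    simp only [smul_eq_mul, Complex.real_smul]
    rw [show -(2 * Real.pi)⁻¹ * u = -(u / (2 * Real.pi)) by field_simp]
    rw [show (↑(2 * Real.pi * inner ℝ (-(u / (2 * Real.pi))) s) * Complex.I : ℂ)
      = -Complex.I * s * u by
        simp only [inner, RCLike.re_to_real, star_trivial]
        push_cast
        have : (Real.pi : ℂ) ≠ 0 := by exact_mod_cast hpi.ne'
        field_simp]
    ring

lemma integrable_exp_mul {g : ℝ → ℂ} (hg : Continuous g) {C : ℝ}
    (hb : ∀ u, ‖g u‖ ≤ C * (1 + |u|) ^ (-(4:ℝ))) (s : ℝ) :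
    Integrable (fun u : ℝ => Complex.exp (-Complex.I * s * u) * g u) := by
  have h : Integrable (fun x : ℝ => C * (1 + ‖x‖) ^ (-(4:ℝ))) :=
    (integrable_one_add_norm (by simp)).const_mul _
  refine h.mono' (by apply Continuous.aestronglyMeasurable; fun_prop)
    (Filter.Eventually.of_forall fun u => ?_)
  rw [norm_mul, show -Complex.I * s * u = ((-s * u : ℝ) : ℂ) * Complex.I by push_cast; ring,
    Complex.norm_exp_ofReal_mul_I, one_mul]
  exact hb u

lemma exists_test (N : ℕ) : ∀ r : ℝ, 0 < r →
    ∃ (φ g : ℝ → ℂ) (C : ℝ), 0 < C ∧ Continuous g ∧ (∀ u, ‖g u‖ ≤ C * (1 + |u|) ^ (-(4:ℝ))) ∧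
      (∀ u, ‖g u‖ ≤ C * |u| ^ N) ∧ φ 0 = 1 ∧ (∀ s, r ≤ |s| → φ s = 0) ∧
      ∀ s : ℝ, φ s = ∫ u : ℝ, Complex.exp (-Complex.I * s * u) * g u := by
  induction N with
  | zero =>
    intro r hr
    let b : ContDiffBump (0:ℝ) := ⟨r / 4, r / 2, by positivity, by linarith⟩
    have hs : HasCompactSupport (fun x => ((b x : ℝ) : ℂ)) :=
      b.hasCompactSupport.comp_left (g := fun x : ℝ => (x : ℂ)) (by simp)
    have hc : ContDiff ℝ (⊤ : ℕ∞) (fun x => ((b x : ℝ) : ℂ)) :=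
      Complex.ofRealCLM.contDiff.comp b.contDiff
    obtain ⟨g, hg, ⟨C, hC, hb⟩, hrep⟩ := schwartz_rep (hs.toSchwartzMap hc)
    refine ⟨fun x => ((b x : ℝ) : ℂ), g, C, hC, hg, hb, ?_, ?_, ?_, ?_⟩
    · intro u
      refine (hb u).trans ?_
      rw [pow_zero]
      gcongr
      exact Real.rpow_le_one_of_one_le_of_nonpos (by linarith [abs_nonneg u]) (by norm_num)
    · have : b 0 = 1 := b.one_of_mem_closedBall (by simp [b.rIn_pos.le])
      simp [this]
    · intro s hs
      have : b s = 0 := b.zero_of_le_dist (by simp [b]; linarith)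
      simp [this]
    · intro s
      exact hrep s
  | succ N ih =>
    intro r hr
    obtain ⟨φ, g, C, hC, hg, hb, hN, h0, hsupp, hrep⟩ := ih (r / 2) (by positivity)
    refine ⟨fun s => φ s - φ (s - r / 2), fun u => g u * (1 - Complex.exp (Complex.I * (r / 2 : ℝ) * u)),
      C * (2 + r), by positivity, by fun_prop, ?_, ?_, ?_, ?_, ?_⟩
    · intro u
      have h1 : ‖1 - Complex.exp (Complex.I * (r / 2 : ℝ) * u)‖ ≤ 2 := by
        refine (norm_sub_le _ _).trans ?_
        rw [show Complex.I * (r / 2 : ℝ) * u = ((r / 2 * u : ℝ) : ℂ) * Complex.I by push_cast; ring,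
          Complex.norm_exp_ofReal_mul_I]
        norm_num
      rw [norm_mul]
      calc _ ≤ (C * (1 + |u|) ^ (-(4:ℝ))) * 2 := by gcongr; exact hb u
        _ ≤ _ := by
          have : 0 ≤ (1 + |u|) ^ (-(4:ℝ)) := by positivity
          nlinarith [mul_nonneg (mul_nonneg hC.le this) hr.le]
    · intro u
      have h1 : ‖1 - Complex.exp (Complex.I * (r / 2 : ℝ) * u)‖ ≤ r * |u| := by
        rw [norm_sub_rev, show Complex.I * (r / 2 : ℝ) * u = Complex.I * ((r / 2 * u : ℝ) : ℂ) by push_cast; ring]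
        refine (Real.norm_exp_I_mul_ofReal_sub_one_le (x := r / 2 * u)).trans ?_
        rw [Real.norm_eq_abs, abs_mul, abs_of_pos (by positivity : 0 < r / 2)]
        nlinarith [abs_nonneg u]
      rw [norm_mul, pow_succ]
      calc _ ≤ (C * |u| ^ N) * (r * |u|) := by gcongr; exact hN u
        _ ≤ _ := by
          have : 0 ≤ C * (|u| ^ N * |u|) := by positivity
          nlinarith
    · simp only [zero_sub, h0]
      rw [hsupp (-(r / 2)) (by rw [abs_neg, abs_of_pos (by positivity)]), sub_zero]
    · intro s hs
      have h2 : r / 2 ≤ |s - r / 2| := by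
        have := abs_sub_abs_le_abs_sub s (r / 2)
        rw [abs_of_pos (by positivity : 0 < r / 2)] at this
        linarith
      simp only [hsupp s (by linarith), hsupp _ h2, sub_zero]
    · intro s
      simp only
      rw [hrep s, hrep (s - r / 2), ← integral_sub (integrable_exp_mul hg hb s)
        (integrable_exp_mul hg hb (s - r / 2))]
      congr 1; ext u
      rw [show -Complex.I * ((s - r / 2 : ℝ) : ℂ) * u = -Complex.I * s * u + Complex.I * (r / 2 : ℝ) * u by
        push_cast; ring, Complex.exp_add]
      ring

lemma w1_inv_le (N : ℕ) {a ε : ℝ} (ha : 0 < a) (hε : 0 < ε) (hε1 : ε ≤ 1) {u : ℝ} (hu : u ≠ 0) :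
    (w1 N a (u / ε))⁻¹ ≤ ε ^ (-2 * a - 1) * ((|u| ^ N)⁻¹ + |u| ^ (2 * a + 1)) := by
  have hu' : 0 < |u| := abs_pos.2 hu
  have e1 : (1:ℝ) ≤ ε ^ (-2 * a - 1) := Real.one_le_rpow_of_pos_of_le_one_of_nonpos hε hε1 (by linarith)
  unfold w1
  rw [abs_div, abs_of_pos hε]
  rcases min_choice ((|u| / ε) ^ N) ((|u| / ε) ^ (-2 * a - 1)) with h | h
  · rw [h, div_pow, inv_div]
    calc ε ^ N / |u| ^ N ≤ 1 / |u| ^ N := by gcongr; exact pow_le_one₀ hε.le hε1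
      _ = 1 * ((|u| ^ N)⁻¹ + 0) := by ring
      _ ≤ _ := by gcongr; positivity
  · rw [h, ← Real.rpow_neg (by positivity), Real.div_rpow hu'.le hε.le, neg_sub,
      show (1:ℝ) - -2 * a = 2 * a + 1 by ring, div_eq_mul_inv, ← Real.rpow_neg hε.le,
      show -(2 * a + 1) = -2 * a - 1 by ring, mul_comm] 
    gcongr
    have : 0 ≤ (|u| ^ N)⁻¹ := by positivity
    linarith

lemma SLND1 (N : ℕ) {a : ℝ} (ha : 0 < a) (ha1 : a < 1) :
    ∃ κ : ℝ, 0 < κ ∧ ∀ (n : ℕ) (s c : Fin n → ℝ) (j : Fin n) (ε : ℝ), 0 < ε → ε ≤ 1 →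
      (∀ l, l ≠ j → ε ≤ |s l - s j|) → κ * ε ^ (2 * a) * c j ^ 2 ≤ Q1 N a s c := by
  obtain ⟨φ, g, C, hC, hg, hb, hN, h0, hsupp, hrep⟩ := exists_test N 1 one_pos
  set M : ℝ := ∫ u : ℝ, 2 * C ^ 2 * (1 + ‖u‖) ^ (-(4:ℝ)) with hM
  have hMint : Integrable (fun u : ℝ => 2 * C ^ 2 * (1 + ‖u‖) ^ (-(4:ℝ))) :=
    (integrable_one_add_norm (by simp)).const_mul _
  have hM0 : 0 ≤ M := integral_nonneg fun u => by positivity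
  refine ⟨(M + 1)⁻¹, by positivity, ?_⟩
  intro n s c j ε hε hε1 hsep
  set P : ℝ → ℂ := fun ρ => ∑ l, (c l : ℂ) * Complex.exp (-Complex.I * ρ * s l) with hP
  have hPc : Continuous P := by rw [hP]; fun_prop
  -- representation of c j
  have hcj : (c j : ℂ) = ∫ u : ℝ, Complex.exp (Complex.I * (s j / ε : ℝ) * u) * P (u / ε) * g u := by
    have h1 : (c j : ℂ) = ∑ l, (c l : ℂ) * φ ((s l - s j) / ε) := by
      rw [Finset.sum_eq_single j]
      · simp [h0]
      · intro l _ hl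
        rw [hsupp, mul_zero]
        rw [abs_div, abs_of_pos hε, le_div_iff₀ hε, one_mul]
        exact hsep l hl
      · simp
    rw [h1]
    simp_rw [hrep, ← integral_const_mul]
    rw [← integral_finsetSum _ (fun l _ => (integrable_exp_mul hg hb _).const_mul _)]
    congr 1; ext u
    rw [hP]
    simp only
    rw [Finset.mul_sum, Finset.sum_mul]
    refine Finset.sum_congr rfl fun l _ => ?_
    rw [show -Complex.I * (((s l - s j) / ε : ℝ) : ℂ) * u =
      Complex.I * (s j / ε : ℝ) * u + -Complex.I * (u / ε : ℝ) * s l by push_cast; ring,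
      Complex.exp_add]
    ring
  have hne : ∀ᵐ u : ℝ, u ≠ 0 := by simp [ae_iff]
  have hw0 : ∀ u : ℝ, u ≠ 0 → 0 < w1 N a (u / ε) := by
    intro u hu
    have : 0 < |u / ε| := abs_pos.2 (div_ne_zero hu hε.ne')
    unfold w1
    positivity
  have hle : ENNReal.ofReal |c j| ≤ ∫⁻ u : ℝ, ENNReal.ofReal (‖P (u / ε)‖ * √(w1 N a (u / ε))) *
      ENNReal.ofReal (‖g u‖ / √(w1 N a (u / ε))) := by
    have h1 : ENNReal.ofReal |c j| = ‖(c j : ℂ)‖ₑ := by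
      rw [← ofReal_norm, Complex.norm_real, Real.norm_eq_abs]
    rw [h1, hcj]
    refine (enorm_integral_le_lintegral_enorm _).trans (lintegral_mono_ae ?_)
    filter_upwards [hne] with u hu
    have hw := hw0 u hu
    rw [← ENNReal.ofReal_mul (by positivity), ← ofReal_norm]
    apply ENNReal.ofReal_le_ofReal
    rw [norm_mul, norm_mul, show Complex.I * (s j / ε : ℝ) * u = ((s j / ε * u : ℝ) : ℂ) * Complex.I by
      push_cast; ring, Complex.norm_exp_ofReal_mul_I]
    have : √(w1 N a (u / ε)) ≠ 0 := (Real.sqrt_pos.2 hw).ne'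
    field_simp
    simp
  have hm1 : AEMeasurable (fun u : ℝ => ENNReal.ofReal (‖P (u / ε)‖ * √(w1 N a (u / ε)))) := by
    have := w1_measurable N a
    have h2 : Measurable P := hPc.measurable
    fun_prop
  have hm2 : AEMeasurable (fun u : ℝ => ENNReal.ofReal (‖g u‖ / √(w1 N a (u / ε)))) := by
    have := w1_measurable N a
    have h2 : Measurable g := hg.measurable
    fun_prop
  have hcs := lintegral_cs volume _ _ hm1 hm2
  have hI1 : ∫⁻ u : ℝ, ENNReal.ofReal (‖P (u / ε)‖ * √(w1 N a (u / ε))) ^ 2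
      = ENNReal.ofReal (ε * Q1 N a s c) := by
    have e1 : ∀ u : ℝ, ENNReal.ofReal (‖P (u / ε)‖ * √(w1 N a (u / ε))) ^ 2 =
        ENNReal.ofReal ((fun ρ => w1 N a ρ * ‖P ρ‖ ^ 2) (u / ε)) := by
      intro u
      rw [← ENNReal.ofReal_pow (by positivity), mul_pow, Real.sq_sqrt (w1_nonneg _ _ _), mul_comm]
    simp_rw [e1]
    have hintg := Q1_integrable N ha s c
    rw [← ofReal_integral_eq_lintegral_ofReal]
    · rw [Measure.integral_comp_div (fun ρ => w1 N a ρ * ‖P ρ‖ ^ 2) ε, abs_of_pos hε, smul_eq_mul]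
      rfl
    · exact hintg.comp_div hε.ne'
    · exact Filter.Eventually.of_forall fun u => mul_nonneg (w1_nonneg _ _ _) (by positivity)
  have hI2 : ∫⁻ u : ℝ, ENNReal.ofReal (‖g u‖ / √(w1 N a (u / ε))) ^ 2
      ≤ ENNReal.ofReal (ε ^ (-2 * a - 1) * M) := by
    rw [hM, ← integral_const_mul, ofReal_integral_eq_lintegral_ofReal (hMint.const_mul _)
      (Filter.Eventually.of_forall fun u => by positivity)]
    refine lintegral_mono_ae ?_
    filter_upwards [hne] with u hu
    have hw := hw0 u hu
    have hu' : 0 < |u| := abs_pos.2 hu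
    rw [← ENNReal.ofReal_pow (by positivity), div_pow, Real.sq_sqrt hw.le]
    apply ENNReal.ofReal_le_ofReal
    rw [div_eq_mul_inv]
    calc ‖g u‖ ^ 2 * (w1 N a (u / ε))⁻¹
        ≤ ‖g u‖ ^ 2 * (ε ^ (-2 * a - 1) * ((|u| ^ N)⁻¹ + |u| ^ (2 * a + 1))) := by
          gcongr; exact w1_inv_le N ha hε hε1 hu
      _ = ε ^ (-2 * a - 1) * (‖g u‖ * ‖g u‖ * (|u| ^ N)⁻¹ + ‖g u‖ * ‖g u‖ * |u| ^ (2 * a + 1)) := by ring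
      _ ≤ ε ^ (-2 * a - 1) * ((C * (1 + |u|) ^ (-(4:ℝ))) * (C * |u| ^ N) * (|u| ^ N)⁻¹ +
          (C * (1 + |u|) ^ (-(4:ℝ))) * (C * (1 + |u|) ^ (-(4:ℝ))) * (1 + |u|) ^ (4:ℝ)) := by
          gcongr
          · exact hb u
          · exact hN u
          · exact hb u
          · exact hb u
          · calc |u| ^ (2 * a + 1) ≤ (1 + |u|) ^ (2 * a + 1) := by gcongr; linarith
              _ ≤ (1 + |u|) ^ (4:ℝ) := Real.rpow_le_rpow_of_exponent_le (by linarith) (by linarith)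
      _ = _ := by
          have e2 : (1 + |u|) ^ (-(4:ℝ)) * (1 + |u|) ^ (4:ℝ) = 1 := by
            rw [← Real.rpow_add (by positivity)]; simp
          rw [Real.norm_eq_abs]
          have e3 : |u| ^ N * (|u| ^ N)⁻¹ = 1 := mul_inv_cancel₀ (by positivity)
          linear_combination (ε ^ (-2 * a - 1) * C ^ 2 * (1 + |u|) ^ (-(4:ℝ))) * (e2 + e3)
  have hQ0 := Q1_nonneg N a s c
  have hfin : ENNReal.ofReal (c j ^ 2) ≤ ENNReal.ofReal (ε * Q1 N a s c * (ε ^ (-2 * a - 1) * M)) := by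
    calc ENNReal.ofReal (c j ^ 2) = ENNReal.ofReal |c j| ^ 2 := by
          rw [← ENNReal.ofReal_pow (abs_nonneg _), sq_abs]
      _ ≤ _ := pow_le_pow_left₀ (by positivity) hle 2
      _ ≤ _ := hcs
      _ ≤ _ := by rw [ENNReal.ofReal_mul (by positivity)]; rw [hI1]; gcongr
  have hfin' := (ENNReal.ofReal_le_ofReal_iff (by positivity)).1 hfin
  have e4 : ε * ε ^ (-2 * a - 1) * ε ^ (2 * a) = 1 := by
    nth_rewrite 1 [← Real.rpow_one ε]
    rw [← Real.rpow_add hε, ← Real.rpow_add hε]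
    ring_nf
    simp
  calc (M + 1)⁻¹ * ε ^ (2 * a) * c j ^ 2
      ≤ (M + 1)⁻¹ * ε ^ (2 * a) * (ε * Q1 N a s c * (ε ^ (-2 * a - 1) * M)) := by gcongr
    _ = (M + 1)⁻¹ * M * Q1 N a s c * (ε * ε ^ (-2 * a - 1) * ε ^ (2 * a)) := by ring
    _ = (M + 1)⁻¹ * M * Q1 N a s c := by rw [e4, mul_one]
    _ ≤ 1 * Q1 N a s c := by
        gcongr
        rw [inv_mul_le_iff₀ (by positivity)]; linarith
    _ = _ := one_mul _


lemma exists_proj {E : Type*} [NormedAddCommGroup E] [InnerProductSpace ℝ E] {m : ℕ}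
    (v : Fin m → E) (x : E) :
    ∃ (b : Fin m → ℝ) (r : E), x = ∑ l, b l • v l + r ∧ ∀ c : Fin m → ℝ, inner ℝ (∑ l, c l • v l) r = 0 := by
  let K : Submodule ℝ E := Submodule.span ℝ (Set.range v)
  haveI : FiniteDimensional ℝ K := FiniteDimensional.span_of_finite ℝ (Set.finite_range v)
  have h1 : K.starProjection x ∈ K := Submodule.starProjection_apply_mem _ _
  obtain ⟨b, hb⟩ := (Submodule.mem_span_range_iff_exists_fun ℝ).1 h1
  refine ⟨b, x - K.starProjection x, by rw [hb]; abel, fun c => ?_⟩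
  have h2 : x - K.starProjection x ∈ Kᗮ := Submodule.sub_starProjection_mem_orthogonal x
  rw [Submodule.mem_orthogonal] at h2
  exact h2 _ ((Submodule.mem_span_range_iff_exists_fun ℝ).2 ⟨c, rfl⟩)

lemma lintegral_gauss {b : ℝ} (hb : 0 < b) :
    ∫⁻ x : ℝ, ENNReal.ofReal (Real.exp (-b * x ^ 2)) = ENNReal.ofReal (√(Real.pi / b)) := by
  rw [← integral_gaussian b, ofReal_integral_eq_lintegral_ofReal (integrable_exp_neg_mul_sq hb)
    (Filter.Eventually.of_forall fun x => (Real.exp_pos _).le)]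

lemma gaussian_chain {E : Type*} [NormedAddCommGroup E] [InnerProductSpace ℝ E] (θ : ℝ) (hθ : 0 < θ) :
    ∀ (m : ℕ) (v : Fin m → E) (V : Fin m → ℝ), (∀ j, 0 < V j) →
    (∀ j (c : Fin m → ℝ), (∀ l, j < l → c l = 0) → V j * c j ^ 2 ≤ ‖∑ l, c l • v l‖ ^ 2) →
    ∫⁻ c : Fin m → ℝ, ENNReal.ofReal (Real.exp (-θ * ‖∑ l, c l • v l‖ ^ 2)) ≤
      ∏ j, ENNReal.ofReal (√(Real.pi / (θ * V j))) := by
  intro m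
  induction m with
  | zero =>
    intro v V hV h
    simp [volume_pi]
  | succ m ih =>
    intro v V hV h
    obtain ⟨b, r, hr, horth⟩ := exists_proj (fun i : Fin m => v i.castSucc) (v (Fin.last m))
    have hrV : V (Fin.last m) ≤ ‖r‖ ^ 2 := by
      have := h (Fin.last m) (Fin.snoc (fun i => - b i) 1) (by
        intro l hl; exact absurd hl (not_lt.2 (Fin.le_last l)))
      simp only [Fin.snoc_last, one_pow, mul_one, Fin.sum_univ_castSucc, Fin.snoc_castSucc, one_smul,
        neg_smul, Finset.sum_neg_distrib] at this
      rw [hr] at this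
      simpa using this
    have key : ∀ (x : ℝ) (c : Fin m → ℝ),
        ‖∑ l, (Fin.snoc c x : Fin (m+1) → ℝ) l • v l‖ ^ 2
          = ‖∑ l, (c l + x * b l) • v l.castSucc‖ ^ 2 + x ^ 2 * ‖r‖ ^ 2 := by
      intro x c
      rw [Fin.sum_univ_castSucc]
      simp only [Fin.snoc_castSucc, Fin.snoc_last]
      have : ∑ l, c l • v l.castSucc + x • v (Fin.last m)
          = ∑ l, (c l + x * b l) • v l.castSucc + x • r := by
        rw [hr]
        simp only [add_smul, Finset.sum_add_distrib, smul_add, Finset.smul_sum, smul_smul]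
        abel
      rw [this, norm_add_sq_real, inner_smul_right, horth (fun l => c l + x * b l), norm_smul, mul_pow]
      simp
    have hcv := (volume_preserving_piFinSuccAbove (fun _ : Fin (m+1) => ℝ) (Fin.last m)).symm
    rw [← hcv.lintegral_comp_emb (MeasurableEquiv.measurableEmbedding _)]
    have hsn : ∀ p : ℝ × (Fin m → ℝ), (MeasurableEquiv.piFinSuccAbove (fun _ : Fin (m+1) => ℝ) (Fin.last m)).symm p
        = Fin.snoc p.2 p.1 := by
      intro p
      rw [MeasurableEquiv.piFinSuccAbove_symm_apply]
      simp [Fin.insertNthEquiv, Fin.insertNth_last']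
    simp_rw [hsn, key]
    rw [Measure.volume_eq_prod, lintegral_prod]
    swap
    · apply Measurable.aemeasurable
      refine (ENNReal.continuous_ofReal.comp ?_).measurable
      fun_prop
    simp only
    have step : ∀ x : ℝ, ∫⁻ c : Fin m → ℝ, ENNReal.ofReal (Real.exp (-θ * (‖∑ l, (c l + x * b l) • v l.castSucc‖ ^ 2 + x ^ 2 * ‖r‖ ^ 2)))
        ≤ ENNReal.ofReal (Real.exp (-(θ * V (Fin.last m)) * x ^ 2)) * ∏ j : Fin m, ENNReal.ofReal (√(Real.pi / (θ * V j.castSucc))) := by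
      intro x
      calc _ ≤ ∫⁻ c : Fin m → ℝ, ENNReal.ofReal (Real.exp (-(θ * V (Fin.last m)) * x ^ 2)) *
            ENNReal.ofReal (Real.exp (-θ * ‖∑ l, (c + fun l => x * b l) l • v l.castSucc‖ ^ 2)) := by
            refine lintegral_mono fun c => ?_
            rw [← ENNReal.ofReal_mul (by positivity), ← Real.exp_add]
            apply ENNReal.ofReal_le_ofReal
            apply Real.exp_le_exp.2
            simp only [Pi.add_apply]
            nlinarith [mul_le_mul_of_nonneg_left hrV (mul_nonneg hθ.le (sq_nonneg x))]
        _ = ENNReal.ofReal (Real.exp (-(θ * V (Fin.last m)) * x ^ 2)) *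
            ∫⁻ c : Fin m → ℝ, ENNReal.ofReal (Real.exp (-θ * ‖∑ l, c l • v l.castSucc‖ ^ 2)) := by
            rw [lintegral_const_mul']
            · congr 1
              exact lintegral_add_right_eq_self (fun c : Fin m → ℝ => ENNReal.ofReal (Real.exp (-θ * ‖∑ l, c l • v l.castSucc‖ ^ 2))) _
            · exact ENNReal.ofReal_ne_top
        _ ≤ _ := by
            gcongr
            refine ih (fun l => v l.castSucc) (fun l => V l.castSucc) (fun l => hV _) ?_
            intro j c hc
            have := h j.castSucc (Fin.snoc c 0) (by
              intro l hl
              induction l using Fin.lastCases with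
              | last => simp
              | cast l => simpa using hc l (by simpa using hl))
            simpa [Fin.sum_univ_castSucc] using this
    refine (lintegral_mono step).trans ?_
    rw [lintegral_mul_const' _ _ (by exact (ENNReal.prod_lt_top fun _ _ => ENNReal.ofReal_lt_top).ne),
      lintegral_gauss (mul_pos hθ (hV _)), Fin.prod_univ_castSucc, mul_comm]


lemma Q1_rep (N : ℕ) {a : ℝ} (ha : 0 < a) {n : ℕ} (s : Fin n → ℝ) :
    ∃ v : Fin n → Lp ℂ 2 ((volume : Measure ℝ).withDensity (fun ρ => ENNReal.ofReal (w1 N a ρ))),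
      ∀ c : Fin n → ℝ, Q1 N a s c = ‖∑ l, c l • v l‖ ^ 2 := by
  set μ := (volume : Measure ℝ).withDensity (fun ρ => ENNReal.ofReal (w1 N a ρ)) with hμ
  have hfin : IsFiniteMeasure μ := by
    refine isFiniteMeasure_withDensity ?_
    have := (w1_integrable N ha).lintegral_lt_top
    exact this.ne
  have hmem : ∀ l, MemLp (fun ρ : ℝ => Complex.exp (-Complex.I * ρ * s l)) 2 μ := by
    intro l
    refine MemLp.of_bound (C := 1) ?_ ?_
    · apply Continuous.aestronglyMeasurable; fun_prop
    · refine Filter.Eventually.of_forall fun ρ => ?_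
      rw [show -Complex.I * ρ * s l = ((-ρ * s l : ℝ) : ℂ) * Complex.I by push_cast; ring,
        Complex.norm_exp_ofReal_mul_I]
  refine ⟨fun l => (hmem l).toLp _, fun c => ?_⟩
  rw [← real_inner_self_eq_norm_sq, L2.inner_def]
  have hae : ∀ᵐ ρ ∂μ, (∑ l, c l • (hmem l).toLp _ : Lp ℂ 2 μ) ρ
      = ∑ l, (c l : ℂ) * Complex.exp (-Complex.I * ρ * s l) := by
    have h1 := Lp.coeFn_finsetSum (s := Finset.univ) (fun l => (c l • (hmem l).toLp _ : Lp ℂ 2 μ))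
    have h2 : ∀ᵐ ρ ∂μ, ∀ l, (c l • (hmem l).toLp _ : Lp ℂ 2 μ) ρ = (c l : ℂ) * Complex.exp (-Complex.I * ρ * s l) := by
      rw [ae_all_iff]
      intro l
      filter_upwards [Lp.coeFn_smul (c l) ((hmem l).toLp _), (hmem l).coeFn_toLp] with ρ h3 h4
      rw [h3, Pi.smul_apply, h4, Complex.real_smul]
    filter_upwards [h1, h2] with ρ h3 h4
    rw [h3, Finset.sum_apply]
    exact Finset.sum_congr rfl fun l _ => h4 l
  rw [integral_congr_ae (g := fun ρ : ℝ => ‖∑ l, (c l : ℂ) * Complex.exp (-Complex.I * ρ * s l)‖ ^ 2)]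
  · rw [hμ, integral_withDensity_eq_integral_toReal_smul]
    · unfold Q1
      congr 1; ext ρ
      rw [ENNReal.toReal_ofReal (w1_nonneg _ _ _), smul_eq_mul]
    · exact (w1_measurable N a).ennreal_ofReal
    · exact Filter.Eventually.of_forall fun _ => ENNReal.ofReal_lt_top
  · filter_upwards [hae] with ρ h
    rw [h, real_inner_self_eq_norm_sq]

lemma gauss_Q1 (N : ℕ) {a : ℝ} (ha : 0 < a) {κ : ℝ} (hκ : 0 < κ)
    (hS : ∀ (n : ℕ) (s c : Fin n → ℝ) (j : Fin n) (ε : ℝ), 0 < ε → ε ≤ 1 →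
      (∀ l, l ≠ j → ε ≤ |s l - s j|) → κ * ε ^ (2 * a) * c j ^ 2 ≤ Q1 N a s c)
    {θ : ℝ} (hθ : 0 < θ) {m : ℕ} (s : Fin (m + 1) → ℝ) (hs : StrictMono s)
    (h1 : ∀ j l, |s j - s l| ≤ 1) :
    ∫⁻ c : Fin (m + 1) → ℝ, ENNReal.ofReal (Real.exp (-θ * Q1 N a s c)) ≤
      ENNReal.ofReal (√(Real.pi / (θ * κ))) ^ (m + 1) *
        ∏ i : Fin m, ENNReal.ofReal ((s i.succ - s i.castSucc) ^ (-a)) := by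
  obtain ⟨v, hv⟩ := Q1_rep N ha s
  simp_rw [hv]
  have hg : ∀ i : Fin m, 0 < s i.succ - s i.castSucc := fun i => sub_pos.2 (hs (Fin.castSucc_lt_succ))
  let G : Fin (m + 1) → ℝ := Fin.cons 1 (fun i : Fin m => s i.succ - s i.castSucc)
  have hG0 : ∀ j, 0 < G j := by
    intro j; induction j using Fin.cases with
    | zero => simp [G]
    | succ i => simpa [G] using hs (Fin.castSucc_lt_succ)
  have hG1 : ∀ j, G j ≤ 1 := by
    intro j; induction j using Fin.cases with
    | zero => simp [G]
    | succ i => simpa only [G, Fin.cons_succ] using (le_abs_self _).trans (h1 i.succ i.castSucc)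
  have hGl : ∀ j l, l < j → G j ≤ s j - s l := by
    intro j; induction j using Fin.cases with
    | zero => intro l hl; exact absurd hl (by simp)
    | succ i =>
      intro l hl
      simp only [G, Fin.cons_succ]
      have : l ≤ i.castSucc := by rw [Fin.le_def]; simpa [Fin.lt_def, Nat.lt_succ_iff] using hl
      linarith [hs.monotone this]
  refine (gaussian_chain θ hθ (m + 1) v (fun j => κ * G j ^ (2 * a))
    (fun j => mul_pos hκ (Real.rpow_pos_of_pos (hG0 j) _)) ?_).trans ?_
  · intro j c hc
    rw [← hv]
    have := hS (m + 1) (fun l => if j < l then s j + G j else s l) c j (G j) (hG0 j) (hG1 j) ?_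
    · refine this.trans_eq ?_
      unfold Q1
      congr 1; ext ρ
      congr 3
      refine Finset.sum_congr rfl fun l _ => ?_
      by_cases hl : j < l
      · simp [hc l hl]
      · simp [hl]
    · intro l hl
      by_cases hl' : j < l
      · simp [hl', abs_of_pos (hG0 j)]
      · have h3 : l < j := lt_of_le_of_ne (not_lt.1 hl') hl
        simp only [hl', if_false, lt_irrefl]
        rw [abs_sub_comm]
        exact (hGl j l h3).trans (le_abs_self _)
  · have hfac : ∀ j, ENNReal.ofReal (√(Real.pi / (θ * (κ * G j ^ (2 * a))))) =
        ENNReal.ofReal (√(Real.pi / (θ * κ))) * ENNReal.ofReal (G j ^ (-a)) := by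
      intro j
      rw [← ENNReal.ofReal_mul (by positivity), ← mul_assoc, ← div_div, Real.sqrt_div (by positivity),
        div_eq_mul_inv]
      congr 2
      rw [Real.rpow_neg (hG0 j).le, show G j ^ (2 * a) = (G j ^ a) ^ 2 by
        rw [← Real.rpow_natCast, ← Real.rpow_mul (hG0 j).le]; congr 1; push_cast; ring,
        Real.sqrt_sq (Real.rpow_nonneg (hG0 j).le _)]
    simp_rw [hfac]
    rw [Finset.prod_mul_distrib, Finset.prod_const, Finset.card_univ, Fintype.card_fin, Fin.prod_univ_succ]
    simp [G]


/-- the one-dimensional gap kernel -/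
noncomputable def fker (γ1 γ2 lam g : ℝ) : ℝ≥0∞ :=
  if g < 0 then 0 else (ENNReal.ofReal g) ^ (-γ1) * (1 + (ENNReal.ofReal (lam * g)) ^ (-(2 * γ2))) *
    ENNReal.ofReal (Real.exp (-lam * g))

/-- product over gaps -/
noncomputable def Psi (f : ℝ → ℝ≥0∞) {m : ℕ} (s : Fin (m + 1) → ℝ) : ℝ≥0∞ :=
  ∏ i : Fin m, f (s i.succ - s i.castSucc)

lemma sorted_eps {lam γ2 : ℝ} (hl : 1 ≤ lam) (hγ2 : 0 ≤ γ2) {m : ℕ} (t : Fin (m + 1) → ℝ)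
    (ht : StrictMono t) :
    ∃ ε : Fin (m + 1) → ℝ, (∀ j, 0 < ε j ∧ ε j ≤ 1 ∧ ∀ l, l ≠ j → ε j ≤ |t l - t j|) ∧
      ∏ j, ε j ^ (-γ2) ≤ lam ^ ((m + 1 : ℕ) * γ2) *
        ∏ i : Fin m, (1 + (lam * (t i.succ - t i.castSucc)) ^ (-(2 * γ2))) := by
  have hl0 : 0 < lam := by linarith
  set g : Fin m → ℝ := fun i => t i.succ - t i.castSucc with hg
  have hgpos : ∀ i, 0 < g i := fun i => sub_pos.2 (ht (Fin.castSucc_lt_succ))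
  set h : Fin m → ℝ := fun i => max 1 (1 / (lam * g i)) with hh
  have hh1 : ∀ i, 1 ≤ h i := fun i => le_max_left _ _
  have hhg : ∀ i, 1 / (lam * h i) ≤ g i := by
    intro i
    have h2 : 1 / (lam * g i) ≤ h i := le_max_right _ _
    have hp : 0 < h i := by linarith [hh1 i]
    rw [div_le_iff₀ (mul_pos hl0 (hgpos i))] at h2
    rw [div_le_iff₀ (mul_pos hl0 hp)]
    linarith
  let hL : Fin (m + 1) → ℝ := Fin.cons 1 h
  let hR : Fin (m + 1) → ℝ := Fin.snoc h 1
  have hL1 : ∀ j, 1 ≤ hL j := by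
    intro j; induction j using Fin.cases with
    | zero => simp [hL]
    | succ i => simpa [hL] using hh1 i
  have hR1 : ∀ j, 1 ≤ hR j := by
    intro j; induction j using Fin.lastCases with
    | last => simp [hR]
    | cast i => simpa [hR] using hh1 i
  refine ⟨fun j => (lam * hL j * hR j)⁻¹, fun j => ⟨?_, ?_, ?_⟩, ?_⟩
  · have := hL1 j; have := hR1 j; positivity
  · apply inv_le_one_of_one_le₀
    have h1 : 1 ≤ lam * hL j := one_le_mul_of_one_le_of_one_le hl (hL1 j)
    exact one_le_mul_of_one_le_of_one_le h1 (hR1 j)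
  · intro l hlj
    have hLp : 0 < hL j := by linarith [hL1 j]
    have hRp : 0 < hR j := by linarith [hR1 j]
    rcases lt_or_gt_of_ne hlj with h3 | h3
    · have e1 : (lam * hL j * hR j)⁻¹ ≤ 1 / (lam * hL j) := by
        rw [one_div]
        apply inv_anti₀ (by positivity)
        exact le_mul_of_one_le_right (by positivity) (hR1 j)
      refine e1.trans ?_
      induction j using Fin.cases with
      | zero => exact absurd h3 (by simp)
      | succ i =>
        simp only [hL, Fin.cons_succ]
        refine (hhg i).trans ?_
        have : l ≤ i.castSucc := by rw [Fin.le_def]; simpa [Fin.lt_def, Nat.lt_succ_iff] using h3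
        rw [abs_sub_comm]
        refine le_trans ?_ (le_abs_self _)
        simp only [g]
        linarith [ht.monotone this]
    · have e1 : (lam * hL j * hR j)⁻¹ ≤ 1 / (lam * hR j) := by
        rw [one_div]
        apply inv_anti₀ (by positivity)
        rw [mul_right_comm]
        exact le_mul_of_one_le_right (by positivity) (hL1 j)
      refine e1.trans ?_
      induction j using Fin.lastCases with
      | last => exact absurd h3 (not_lt.2 (Fin.le_last l))
      | cast i =>
        simp only [hR, Fin.snoc_castSucc]
        refine (hhg i).trans ?_
        have : i.succ ≤ l := by
          rw [Fin.le_def]; simp [Fin.lt_def] at h3; simp; omega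
        refine le_trans ?_ (le_abs_self _)
        simp only [g]
        linarith [ht.monotone this]
  · have e1 : ∀ j, ((lam * hL j * hR j)⁻¹) ^ (-γ2) = lam ^ γ2 * (hL j) ^ γ2 * (hR j) ^ γ2 := by
      intro j
      have := hL1 j; have := hR1 j
      rw [Real.rpow_neg (by positivity), Real.inv_rpow (by positivity), inv_inv,
        Real.mul_rpow (by positivity) (by positivity), Real.mul_rpow (by positivity) (by positivity)]
    simp_rw [e1]
    rw [Finset.prod_mul_distrib, Finset.prod_mul_distrib, Finset.prod_const, Finset.card_univ,
      Fintype.card_fin, Fin.prod_univ_succ (fun j => hL j ^ γ2), Fin.prod_univ_castSucc (fun j => hR j ^ γ2)]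
    simp only [hL, hR, Fin.cons_zero, Fin.cons_succ, Fin.snoc_castSucc, Fin.snoc_last, Real.one_rpow,
      one_mul, mul_one]
    rw [mul_assoc, ← Finset.prod_mul_distrib, mul_comm ((m + 1 : ℕ) : ℝ) γ2, Real.rpow_mul hl0.le, Real.rpow_natCast]
    gcongr with i
    · have hp : 0 < h i := by linarith [hh1 i]
      rw [← Real.rpow_add hp, ← two_mul]
      have hgl : 0 < lam * g i := mul_pos hl0 (hgpos i)
      rcases le_total 1 (1 / (lam * g i)) with h4 | h4
      · simp only [h, max_eq_right h4]
        rw [one_div, Real.inv_rpow hgl.le, ← Real.rpow_neg hgl.le]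
        linarith
      · simp only [h, max_eq_left h4, Real.one_rpow]
        have := Real.rpow_nonneg hgl.le (-(2 * γ2))
        linarith

lemma fker_of_pos {γ1 γ2 lam g : ℝ} (hl : 0 < lam) (hg : 0 < g) :
    fker γ1 γ2 lam g = ENNReal.ofReal (g ^ (-γ1) * (1 + (lam * g) ^ (-(2 * γ2))) * Real.exp (-lam * g)) := by
  unfold fker
  have : 0 < lam * g := by positivity
  rw [if_neg (by linarith), ENNReal.ofReal_mul (q := Real.exp _) (by positivity), ENNReal.ofReal_mul (p := g ^ (-γ1)) (by positivity),
    ENNReal.ofReal_add (by positivity) (by positivity), ENNReal.ofReal_rpow_of_pos hg,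
    ENNReal.ofReal_rpow_of_pos this, ENNReal.ofReal_one]

lemma fker_zero {γ1 γ2 lam : ℝ} (hγ1 : 0 < γ1) : fker γ1 γ2 lam 0 = ⊤ := by
  unfold fker
  simp [ENNReal.zero_rpow_of_neg, hγ1]

lemma fker_ne_zero {γ1 γ2 lam g : ℝ} (hγ1 : 0 < γ1) (hl : 0 < lam) (hg : 0 ≤ g) :
    fker γ1 γ2 lam g ≠ 0 := by
  rcases hg.eq_or_lt with h | h
  · rw [← h, fker_zero hγ1]; simp
  · rw [fker_of_pos hl h]
    have : 0 < g ^ (-γ1) * (1 + (lam * g) ^ (-(2 * γ2))) * Real.exp (-lam * g) := by positivity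
    simpa using this

lemma fker_measurable (γ1 γ2 lam : ℝ) : Measurable (fker γ1 γ2 lam) := by
  unfold fker
  refine Measurable.ite measurableSet_Iio measurable_const ?_
  fun_prop

lemma psisum_ne_zero {γ1 γ2 lam : ℝ} (hγ1 : 0 < γ1) (hl : 0 < lam) {m : ℕ} (s : Fin (m + 1) → ℝ) :
    ∑ π : Equiv.Perm (Fin (m + 1)), Psi (fker γ1 γ2 lam) (s ∘ π) ≠ 0 := by
  have h : Psi (fker γ1 γ2 lam) (s ∘ Tuple.sort s) ≠ 0 := by
    unfold Psi
    rw [Finset.prod_ne_zero_iff]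
    intro i _
    apply fker_ne_zero hγ1 hl
    exact sub_nonneg.2 (Tuple.monotone_sort s (Fin.castSucc_lt_succ).le)
  intro h0
  exact h ((Finset.sum_eq_zero_iff.1 h0) _ (Finset.mem_univ _))

lemma psisum_eq_top {γ1 γ2 lam : ℝ} (hγ1 : 0 < γ1) (hl : 0 < lam) {m : ℕ} (s : Fin (m + 1) → ℝ)
    (hs : ¬ Function.Injective s) :
    ∑ π : Equiv.Perm (Fin (m + 1)), Psi (fker γ1 γ2 lam) (s ∘ π) = ⊤ := by
  rw [ENNReal.sum_eq_top]
  refine ⟨Tuple.sort s, Finset.mem_univ _, ?_⟩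
  have hmono := Tuple.monotone_sort s
  have : ¬ StrictMono (s ∘ Tuple.sort s) := by
    intro h
    apply hs
    have := h.injective
    exact (Function.Injective.of_comp_iff' s (Tuple.sort s).bijective).1 this
  rw [Fin.strictMono_iff_lt_succ] at this
  push Not at this
  obtain ⟨i, hi⟩ := this
  have hle : ∀ i : Fin m, (s ∘ Tuple.sort s) i.castSucc ≤ (s ∘ Tuple.sort s) i.succ := fun i => hmono (Fin.castSucc_lt_succ).le
  unfold Psi
  refine WithTop.prod_eq_top (i := i) (by simp) ?_ ?_
  · rw [le_antisymm hi (hle i), sub_self, fker_zero hγ1]; rfl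
  · intro j _
    exact fker_ne_zero hγ1 hl (sub_nonneg.2 (hle j))

/-- one-dimensional bound, in one direction -/
lemma oneD (N : ℕ) {a : ℝ} (ha : 0 < a) {κ : ℝ} (hκ : 0 < κ)
    (hS : ∀ (n : ℕ) (s c : Fin n → ℝ) (j : Fin n) (ε : ℝ), 0 < ε → ε ≤ 1 →
      (∀ l, l ≠ j → ε ≤ |s l - s j|) → κ * ε ^ (2 * a) * c j ^ 2 ≤ Q1 N a s c)
    {θ : ℝ} (hθ : 0 < θ) {e γ2 : ℝ} (he : 0 ≤ e) (hγ2 : 0 ≤ γ2)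
    {lam R : ℝ} (hl : 1 ≤ lam) (hR : R ≤ 1)
    {m : ℕ} (s : Fin (m + 1) → ℝ) (hs : Function.Injective s) (h1 : ∀ j l, |s j - s l| ≤ R) :
    ∃ ε : Fin (m + 1) → ℝ, (∀ j, 0 < ε j ∧ ε j ≤ 1 ∧ ∀ l, l ≠ j → ε j ≤ |s l - s j|) ∧
      ENNReal.ofReal (∏ j, ε j ^ (-γ2)) *
      (∫⁻ c : Fin (m + 1) → ℝ, ENNReal.ofReal (Real.exp (-θ * Q1 N a s c))) ^ e ≤
      ENNReal.ofReal ((√(Real.pi / (θ * κ)) ^ e) ^ (m + 1) * lam ^ ((m + 1 : ℕ) * γ2) * Real.exp (lam * R)) *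
        ∑ π : Equiv.Perm (Fin (m + 1)), Psi (fker (a * e) γ2 lam) (s ∘ π) := by
  have hl0 : 0 < lam := by linarith
  set π := Tuple.sort s
  set t := s ∘ π with ht
  have htm : StrictMono t := (Tuple.monotone_sort s).strictMono_of_injective (hs.comp π.injective)
  have hg : ∀ i : Fin m, 0 < t i.succ - t i.castSucc := fun i => sub_pos.2 (htm (Fin.castSucc_lt_succ))
  obtain ⟨ε, hε, hprod⟩ := sorted_eps hl hγ2 t htm
  refine ⟨fun j => ε (π.symm j), fun j => ⟨(hε _).1, (hε _).2.1, fun l hlj => ?_⟩, ?_⟩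
  · have := (hε (π.symm j)).2.2 (π.symm l) (by simpa using hlj)
    simpa [t] using this
  have hD : (∫⁻ c : Fin (m + 1) → ℝ, ENNReal.ofReal (Real.exp (-θ * Q1 N a s c))) =
      ∫⁻ c : Fin (m + 1) → ℝ, ENNReal.ofReal (Real.exp (-θ * Q1 N a t c)) := by
    have hmp := volume_measurePreserving_piCongrLeft (fun _ : Fin (m + 1) => ℝ) π
    rw [← hmp.lintegral_comp_emb (MeasurableEquiv.measurableEmbedding _)]
    refine lintegral_congr fun c => ?_
    rw [← Q1_perm N a s _ π]
    congr 4
    ext j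
    simp [MeasurableEquiv.coe_piCongrLeft, Equiv.piCongrLeft_apply]
  have hD2 := gauss_Q1 N ha hκ hS hθ t htm (fun j l => (h1 _ _).trans hR)
  rw [← hD] at hD2
  rw [Equiv.prod_comp π.symm (fun j => ε j ^ (-γ2))]
  have hsum : ∑ i : Fin m, (t i.succ - t i.castSucc) ≤ R := by
    have : ∑ i : Fin m, (t i.succ - t i.castSucc) = t (Fin.last m) - t 0 := by
      have e1 := Fin.sum_univ_succ t
      have e2 := Fin.sum_univ_castSucc t
      rw [Finset.sum_sub_distrib]; linarith
    rw [this]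
    exact (le_abs_self _).trans (h1 _ _)
  have hexp : (1:ℝ) ≤ Real.exp (lam * R) * ∏ i : Fin m, Real.exp (-lam * (t i.succ - t i.castSucc)) := by
    rw [← Real.exp_sum, ← Finset.mul_sum, ← Real.exp_add]
    apply Real.one_le_exp
    nlinarith
  calc _ ≤ ENNReal.ofReal (lam ^ ((m + 1 : ℕ) * γ2) *
        ∏ i : Fin m, (1 + (lam * (t i.succ - t i.castSucc)) ^ (-(2 * γ2)))) *
        (ENNReal.ofReal (√(Real.pi / (θ * κ)) ^ (m + 1) *
        ∏ i : Fin m, ((t i.succ - t i.castSucc) ^ (-a)))) ^ e := by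
        gcongr
        rw [ENNReal.ofReal_mul (by positivity), ENNReal.ofReal_pow (by positivity), ENNReal.ofReal_prod_of_nonneg]
        · exact hD2
        · intro i _; exact Real.rpow_nonneg (hg i).le _
    _ = ENNReal.ofReal ((√(Real.pi / (θ * κ)) ^ e) ^ (m + 1) * lam ^ ((m + 1 : ℕ) * γ2) *
        ∏ i : Fin m, ((t i.succ - t i.castSucc) ^ (-(a * e)) * (1 + (lam * (t i.succ - t i.castSucc)) ^ (-(2 * γ2))))) := by
        have hpp : 0 ≤ ∏ i : Fin m, ((t i.succ - t i.castSucc) ^ (-a)) :=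
          Finset.prod_nonneg fun i _ => Real.rpow_nonneg (hg i).le _
        rw [ENNReal.ofReal_rpow_of_nonneg (by positivity) he, Real.mul_rpow (by positivity) hpp,
          ← ENNReal.ofReal_mul, ← Real.finsetProd_rpow _ _ (fun i _ => Real.rpow_nonneg (hg i).le _),
          Finset.prod_mul_distrib, ← Real.rpow_natCast, ← Real.rpow_mul (by positivity),
          ← Real.rpow_natCast, ← Real.rpow_mul (by positivity)]
        · congr 1
          have : ∀ i : Fin m, ((t i.succ - t i.castSucc) ^ (-a)) ^ e = (t i.succ - t i.castSucc) ^ (-(a * e)) := by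
            intro i
            rw [← Real.rpow_mul (hg i).le]; congr 1; ring
          simp_rw [this]
          rw [mul_comm e]
          ring
        · apply mul_nonneg (by positivity)
          exact Finset.prod_nonneg fun i _ => add_nonneg zero_le_one (Real.rpow_nonneg (mul_nonneg hl0.le (hg i).le) _)
    _ ≤ ENNReal.ofReal ((√(Real.pi / (θ * κ)) ^ e) ^ (m + 1) * lam ^ ((m + 1 : ℕ) * γ2) * Real.exp (lam * R) *
        ∏ i : Fin m, ((t i.succ - t i.castSucc) ^ (-(a * e)) * (1 + (lam * (t i.succ - t i.castSucc)) ^ (-(2 * γ2)))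
          * Real.exp (-lam * (t i.succ - t i.castSucc)))) := by
        apply ENNReal.ofReal_le_ofReal
        rw [Finset.prod_mul_distrib (g := fun i : Fin m => Real.exp (-lam * (t i.succ - t i.castSucc)))]
        set P := ∏ i : Fin m, ((t i.succ - t i.castSucc) ^ (-(a * e)) * (1 + (lam * (t i.succ - t i.castSucc)) ^ (-(2 * γ2))))
        have hP : 0 ≤ P := Finset.prod_nonneg fun i _ => mul_nonneg (Real.rpow_nonneg (hg i).le _)
          (add_nonneg zero_le_one (Real.rpow_nonneg (mul_nonneg hl0.le (hg i).le) _))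
        calc _ = (√(Real.pi / (θ * κ)) ^ e) ^ (m + 1) * lam ^ ((m + 1 : ℕ) * γ2) * P * 1 := by ring
          _ ≤ (√(Real.pi / (θ * κ)) ^ e) ^ (m + 1) * lam ^ ((m + 1 : ℕ) * γ2) * P * _ :=
            mul_le_mul_of_nonneg_left hexp (by positivity)
          _ = _ := by ring
    _ = ENNReal.ofReal ((√(Real.pi / (θ * κ)) ^ e) ^ (m + 1) * lam ^ ((m + 1 : ℕ) * γ2) * Real.exp (lam * R)) *
        Psi (fker (a * e) γ2 lam) (s ∘ π) := by
        rw [ENNReal.ofReal_mul (by positivity), ENNReal.ofReal_prod_of_nonneg]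
        · congr 1
          exact Finset.prod_congr rfl fun i _ => (fker_of_pos hl0 (hg i)).symm
        · intro i _
          have := hg i
          positivity
    _ ≤ _ := by
        gcongr
        exact Finset.single_le_sum (f := fun π : Equiv.Perm (Fin (m+1)) => Psi (fker (a * e) γ2 lam) (s ∘ π)) (fun _ _ => zero_le) (Finset.mem_univ π)


lemma rpow_mul_exp_le {x u : ℝ} (hx : 0 ≤ x) (hu : 0 ≤ u) : x ^ u * Real.exp (-x) ≤ u ^ u := by
  rcases hu.eq_or_lt with h | h
  · rw [← h]; simpa using hx
  · have h1 : (x / u) ^ u ≤ Real.exp x := by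
      calc (x / u) ^ u ≤ (Real.exp (x / u)) ^ u := by
            apply Real.rpow_le_rpow (by positivity) _ hu
            linarith [Real.add_one_le_exp (x / u)]
        _ = Real.exp x := by rw [← Real.exp_mul]; congr 1; field_simp
    rw [Real.div_rpow hx hu, div_le_iff₀ (by positivity)] at h1
    rw [Real.exp_neg, ← div_eq_mul_inv, div_le_iff₀ (Real.exp_pos _)]
    linarith

lemma prod_const_rpow {K : ℕ} (hK : 0 < K) {x : ℝ} (hx : 0 ≤ x) : ∏ _i : Fin K, x ^ (1 / (K : ℝ)) = x := by
  rw [Finset.prod_const, Finset.card_univ, Fintype.card_fin, ← Real.rpow_natCast, ← Real.rpow_mul hx,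
    one_div, inv_mul_cancel₀ (by positivity), Real.rpow_one]

lemma real_bound {a : ℝ} {κ θ : ℝ} (hκ : 0 < κ) (hθ : 0 < θ) {n K : ℕ} (hK : 0 < K)
    (ε : Fin K → Fin n → ℝ) (hε : ∀ i j, 0 < ε i j) (c : Fin n → ℝ) {Q : ℝ} (hQ : 0 ≤ Q)
    (h : ∀ i j, κ * ε i j ^ (2 * a) * c j ^ 2 ≤ Q) (p : Fin n → ℝ) (hp : ∀ j, 0 ≤ p j)
    {M : ℝ} (hM : ∑ j, p j ≤ M) :
    (∏ j, |c j| ^ p j) * Real.exp (-θ * Q) ≤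
      ((M / (κ * θ)) ^ ((∑ j, p j) / 2) * ∏ j, (∏ i, ε i j ^ (-(a / K))) ^ p j) * Real.exp (-(θ / 2) * Q) := by
  set Y := √(Q / κ) with hY
  have hY0 : 0 ≤ Y := Real.sqrt_nonneg _
  have hp0 : 0 ≤ ∑ j, p j := Finset.sum_nonneg fun j _ => hp j
  have hcj : ∀ j, |c j| ≤ Y * ∏ i, ε i j ^ (-(a / K)) := by
    intro j
    have h1 : ∀ i, |c j| ≤ Y * ε i j ^ (-a) := by
      intro i
      have e1 : 0 < ε i j ^ a := Real.rpow_pos_of_pos (hε i j) _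
      rw [Real.rpow_neg (hε i j).le, ← div_eq_mul_inv, le_div_iff₀ e1]
      apply Real.le_sqrt_of_sq_le
      rw [le_div_iff₀ hκ, mul_pow, sq_abs, ← Real.rpow_natCast (ε i j ^ a), ← Real.rpow_mul (hε i j).le]
      have := h i j
      calc _ = κ * ε i j ^ (2 * a) * c j ^ 2 := by rw [mul_comm a]; push_cast; ring
        _ ≤ _ := this
    calc |c j| = ∏ _i : Fin K, |c j| ^ (1 / (K : ℝ)) := (prod_const_rpow hK (abs_nonneg _)).symm
      _ ≤ ∏ i : Fin K, (Y * ε i j ^ (-a)) ^ (1 / (K : ℝ)) := by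
        apply Finset.prod_le_prod
        · intro i _; positivity
        · intro i _; exact Real.rpow_le_rpow (abs_nonneg _) (h1 i) (by positivity)
      _ = ∏ i : Fin K, (Y ^ (1 / (K : ℝ)) * ε i j ^ (-(a / K))) := by
        refine Finset.prod_congr rfl fun i _ => ?_
        rw [Real.mul_rpow hY0 (Real.rpow_nonneg (hε i j).le _), ← Real.rpow_mul (hε i j).le]
        congr 2; ring
      _ = _ := by rw [Finset.prod_mul_distrib, prod_const_rpow hK hY0]
  have hW : ∀ j, 0 ≤ ∏ i, ε i j ^ (-(a / K)) := fun j => Finset.prod_nonneg fun i _ => Real.rpow_nonneg (hε i j).le _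
  set W := ∏ j, (∏ i, ε i j ^ (-(a / K))) ^ p j
  have hWn : 0 ≤ W := Finset.prod_nonneg fun j _ => Real.rpow_nonneg (hW j) _
  have h2 : ∏ j, |c j| ^ p j ≤ Y ^ (∑ j, p j) * W := by
    calc _ ≤ ∏ j, (Y * ∏ i, ε i j ^ (-(a / K))) ^ p j := by
          apply Finset.prod_le_prod
          · intro i _; positivity
          · intro j _; exact Real.rpow_le_rpow (abs_nonneg _) (hcj j) (hp j)
      _ = ∏ j, (Y ^ p j * (∏ i, ε i j ^ (-(a / K))) ^ p j) :=
          Finset.prod_congr rfl fun j _ => Real.mul_rpow hY0 (hW j)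
      _ = _ := by
          rw [Finset.prod_mul_distrib, Real.rpow_sum_of_nonneg hY0 (fun j _ => hp j)]
  set P := ∑ j, p j
  have h3 : Y ^ P * Real.exp (-(θ / 2) * Q) ≤ (M / (κ * θ)) ^ (P / 2) := by
    have e1 : Y ^ P = (2 / (κ * θ)) ^ (P / 2) * (θ / 2 * Q) ^ (P / 2) := by
      rw [← Real.mul_rpow (by positivity) (by positivity), hY, Real.sqrt_eq_rpow, ← Real.rpow_mul (by positivity)]
      congr 1
      · field_simp
      · ring
    have e2 := rpow_mul_exp_le (x := θ / 2 * Q) (u := P / 2) (by positivity) (by positivity)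
    calc _ = (2 / (κ * θ)) ^ (P / 2) * ((θ / 2 * Q) ^ (P / 2) * Real.exp (-(θ / 2 * Q))) := by
          rw [e1, mul_assoc, neg_mul]
      _ ≤ (2 / (κ * θ)) ^ (P / 2) * (P / 2) ^ (P / 2) := by gcongr
      _ = (P / (κ * θ)) ^ (P / 2) := by
          rw [← Real.mul_rpow (by positivity) (by positivity)]; congr 1; field_simp
      _ ≤ _ := by gcongr
  calc _ = (∏ j, |c j| ^ p j) * (Real.exp (-(θ / 2) * Q) * Real.exp (-(θ / 2) * Q)) := by
        rw [← Real.exp_add]; congr 2; ring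
    _ ≤ (Y ^ P * W) * (Real.exp (-(θ / 2) * Q) * Real.exp (-(θ / 2) * Q)) := by gcongr
    _ = (Y ^ P * Real.exp (-(θ / 2) * Q)) * W * Real.exp (-(θ / 2) * Q) := by ring
    _ ≤ _ := by gcongr

lemma pointwise_bound (N : ℕ) {a : ℝ} (ha : 0 < a) {κ : ℝ} (hκ : 0 < κ)
    (hS : ∀ (n : ℕ) (s c : Fin n → ℝ) (j : Fin n) (ε : ℝ), 0 < ε → ε ≤ 1 →
      (∀ l, l ≠ j → ε ≤ |s l - s j|) → κ * ε ^ (2 * a) * c j ^ 2 ≤ Q1 N a s c)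
    {θ : ℝ} (hθ : 0 < θ) {K d : ℕ} (hK : 0 < K) (hd : 0 < d) {q : ℝ} (hq : 0 < q)
    {lam R : ℝ} (hl : 1 ≤ lam) (hR : R ≤ 1) {m : ℕ}
    (qm : Fin (m + 1) → Fin d → ℝ) (hqm : ∀ j k, 0 ≤ qm j k) (hqs : ∀ j, ∑ k, qm j k = q)
    (s : Fin K → Fin (m + 1) → ℝ) (h1 : ∀ i j l, |s i j - s i l| ≤ R) :
    ∏ k : Fin d, ∫⁻ c : Fin (m + 1) → ℝ,
      ENNReal.ofReal ((∏ j, |c j| ^ qm j k) * Real.exp (-θ * ∑ i, Q1 N a (s i) c)) ≤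
    ENNReal.ofReal (((m + 1 : ℕ) * q / (κ * θ)) ^ ((m + 1 : ℕ) * q / 2)) *
      ∏ i : Fin K, (ENNReal.ofReal ((√(Real.pi / (θ / 2 * κ)) ^ (d / K : ℝ)) ^ (m + 1) *
        lam ^ ((m + 1 : ℕ) * (a * q / K)) * Real.exp (lam * R)) *
        ∑ π : Equiv.Perm (Fin (m + 1)), Psi (fker (a * (d / K)) (a * q / K) lam) (s i ∘ π)) := by
  have hl0 : 0 < lam := by linarith
  have hg1 : 0 < a * (d / K : ℝ) := by positivity
  have hM0 : 0 < ((m + 1 : ℕ) * q / (κ * θ)) := by positivity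
  have hB0 : 0 < ((√(Real.pi / (θ / 2 * κ)) ^ (d / K : ℝ)) ^ (m + 1) *
        lam ^ ((m + 1 : ℕ) * (a * q / K)) * Real.exp (lam * R)) := by
    have := Real.pi_pos
    positivity
  by_cases hinj : ∀ i, Function.Injective (s i)
  swap
  · push Not at hinj
    obtain ⟨i, hi⟩ := hinj
    have : ∏ i : Fin K, (ENNReal.ofReal ((√(Real.pi / (θ / 2 * κ)) ^ (d / K : ℝ)) ^ (m + 1) *
        lam ^ ((m + 1 : ℕ) * (a * q / K)) * Real.exp (lam * R)) *
        ∑ π : Equiv.Perm (Fin (m + 1)), Psi (fker (a * (d / K)) (a * q / K) lam) (s i ∘ π)) = ⊤ := by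
      refine WithTop.prod_eq_top (i := i) (by simp) ?_ ?_
      · rw [psisum_eq_top hg1 hl0 _ hi, ENNReal.mul_top]; rfl
        simpa using hB0
      · intro j _
        exact mul_ne_zero (M₀ := ℝ≥0∞) (ENNReal.ofReal_pos.2 hB0).ne' (psisum_ne_zero hg1 hl0 _)
    rw [this, ENNReal.mul_top]
    · exact le_top
    · have : 0 < ((m + 1 : ℕ) * q / (κ * θ)) ^ ((m + 1 : ℕ) * q / 2) := by positivity
      exact (ENNReal.ofReal_pos.2 this).ne'
  have hchoose := fun i => oneD N ha hκ hS (θ := θ / 2) (by positivity) (e := (d / K : ℝ)) (γ2 := a * q / K)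
    (by positivity) (by positivity) hl hR (s i) (hinj i) (h1 i)
  choose ε hε hbound using hchoose
  set D := ∫⁻ c : Fin (m + 1) → ℝ, ENNReal.ofReal (Real.exp (-(θ / 2) * ∑ i, Q1 N a (s i) c)) with hD
  have hDi : ∀ i, D ≤ ∫⁻ c : Fin (m + 1) → ℝ, ENNReal.ofReal (Real.exp (-(θ / 2) * Q1 N a (s i) c)) := by
    intro i
    refine lintegral_mono fun c => ENNReal.ofReal_le_ofReal (Real.exp_le_exp.2 ?_)
    have := Finset.single_le_sum (f := fun i => Q1 N a (s i) c) (fun i _ => Q1_nonneg _ _ _ _) (Finset.mem_univ i)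
    nlinarith
  set P : Fin d → ℝ := fun k => ∑ j, qm j k with hP
  have hPk : ∀ k, P k ≤ (m + 1 : ℕ) * q := by
    intro k
    calc P k ≤ ∑ j : Fin (m+1), q := Finset.sum_le_sum fun j _ => by
          rw [← hqs j]
          exact Finset.single_le_sum (f := fun k => qm j k) (fun k _ => hqm j k) (Finset.mem_univ k)
      _ = _ := by simp
  set W : Fin (m + 1) → ℝ := fun j => ∏ i, ε i j ^ (-(a / K)) with hW
  have hWpos : ∀ j, 0 < W j := fun j => Finset.prod_pos fun i _ => Real.rpow_pos_of_pos (hε i j).1 _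
  set M := ((m + 1 : ℕ) * q / (κ * θ)) with hM
  have step1 : ∀ k, ∫⁻ c : Fin (m + 1) → ℝ,
      ENNReal.ofReal ((∏ j, |c j| ^ qm j k) * Real.exp (-θ * ∑ i, Q1 N a (s i) c)) ≤
      ENNReal.ofReal (M ^ (P k / 2) * ∏ j, W j ^ qm j k) * D := by
    intro k
    rw [hD, ← lintegral_const_mul' _ _ ENNReal.ofReal_ne_top]
    refine lintegral_mono fun c => ?_
    rw [← ENNReal.ofReal_mul (mul_nonneg (by positivity) (Finset.prod_nonneg fun j _ => Real.rpow_nonneg (hWpos j).le _))]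
    apply ENNReal.ofReal_le_ofReal
    refine real_bound hκ hθ hK ε (fun i j => (hε i j).1) c (Finset.sum_nonneg fun i _ => Q1_nonneg _ _ _ _) ?_ _ (fun j => hqm j k) (hPk k)
    intro i j
    refine (hS _ (s i) c j (ε i j) (hε i j).1 (hε i j).2.1 (hε i j).2.2).trans ?_
    exact Finset.single_le_sum (f := fun i => Q1 N a (s i) c) (fun i _ => Q1_nonneg _ _ _ _) (Finset.mem_univ i)
  have hPsum : ∑ k, P k / 2 = (m + 1 : ℕ) * q / 2 := by
    rw [← Finset.sum_div, hP, Finset.sum_comm]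
    simp [hqs]
  calc _ ≤ ∏ k, (ENNReal.ofReal (M ^ (P k / 2) * ∏ j, W j ^ qm j k) * D) :=
        Finset.prod_le_prod' fun k _ => step1 k
    _ = ENNReal.ofReal (M ^ ((m + 1 : ℕ) * q / 2)) * (ENNReal.ofReal (∏ j, W j ^ q) * D ^ d) := by
        rw [Finset.prod_mul_distrib, Finset.prod_const, Finset.card_univ, Fintype.card_fin,
          ← ENNReal.ofReal_prod_of_nonneg, Finset.prod_mul_distrib, ← Real.rpow_sum_of_pos hM0, hPsum,
          Finset.prod_comm, ENNReal.ofReal_mul (by positivity), mul_assoc]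
        · congr 3
          refine Finset.prod_congr rfl fun j _ => ?_
          rw [← Real.rpow_sum_of_pos (hWpos j), hqs]
        · intro k _
          exact mul_nonneg (by positivity) (Finset.prod_nonneg fun j _ => Real.rpow_nonneg (hWpos j).le _)
    _ ≤ _ := by
        gcongr
        have e1 : ∏ j, W j ^ q = ∏ i, ∏ j, ε i j ^ (-(a * q / K)) := by
          rw [Finset.prod_comm]
          refine Finset.prod_congr rfl fun j _ => ?_
          rw [hW]
          simp only
          rw [← Real.finsetProd_rpow _ _ (fun i _ => Real.rpow_nonneg (hε i j).1.le _)]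
          refine Finset.prod_congr rfl fun i _ => ?_
          rw [← Real.rpow_mul (hε i j).1.le]; congr 1; ring
        have e2 : D ^ d = ∏ _i : Fin K, D ^ (d / K : ℝ) := by
          rw [Finset.prod_const, Finset.card_univ, Fintype.card_fin, ← ENNReal.rpow_natCast, ← ENNReal.rpow_natCast,
            ← ENNReal.rpow_mul]
          congr 1
          field_simp
        rw [e1, e2, ENNReal.ofReal_prod_of_nonneg (fun i _ => Finset.prod_nonneg fun j _ => Real.rpow_nonneg (hε i j).1.le _),
          ← Finset.prod_mul_distrib]
        apply Finset.prod_le_prod'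
        intro i _
        refine le_trans ?_ (hbound i)
        gcongr
        exact hDi i


lemma Psi_measurable {f : ℝ → ℝ≥0∞} (hf : Measurable f) (m : ℕ) :
    Measurable (fun s : Fin (m + 1) → ℝ => Psi f s) := by
  unfold Psi
  refine Finset.measurable_prod _ fun i _ => hf.comp ?_
  fun_prop

lemma lintegral_Psi {f : ℝ → ℝ≥0∞} (hf : Measurable f) (A : Set ℝ) (hA : MeasurableSet A) (m : ℕ) :
    ∫⁻ s : Fin (m + 1) → ℝ, A.indicator 1 (s (Fin.last m)) * Psi f s = volume A * (∫⁻ x, f x) ^ m := by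
  have hA1 : Measurable (A.indicator (1 : ℝ → ℝ≥0∞)) := measurable_one.indicator hA
  induction m with
  | zero =>
    have hmp := (volume_preserving_funUnique (Fin 1) ℝ)
    have := hmp.lintegral_comp hA1
    simp only [Psi, Finset.univ_eq_empty, Finset.prod_empty, mul_one, pow_zero]
    rw [lintegral_indicator_one hA] at this
    rw [← this]
    rfl
  | succ m ih =>
    have hcv := (volume_preserving_piFinSuccAbove (fun _ : Fin (m+2) => ℝ) 0).symm
    rw [← hcv.lintegral_comp_emb (MeasurableEquiv.measurableEmbedding _)]
    have hsn : ∀ p : ℝ × (Fin (m + 1) → ℝ), (MeasurableEquiv.piFinSuccAbove (fun _ : Fin (m+2) => ℝ) 0).symm p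
        = Fin.cons p.1 p.2 := by
      intro p
      rw [MeasurableEquiv.piFinSuccAbove_symm_apply]
      simp [Fin.insertNthEquiv]
    simp_rw [hsn]
    have hP : ∀ p : ℝ × (Fin (m + 1) → ℝ), A.indicator 1 ((Fin.cons p.1 p.2 : Fin (m + 2) → ℝ) (Fin.last (m+1))) *
        Psi f (Fin.cons p.1 p.2 : Fin (m + 2) → ℝ) = f (p.2 0 - p.1) * (A.indicator 1 (p.2 (Fin.last m)) * Psi f p.2) := by
      intro p
      rw [← Fin.succ_last, Fin.cons_succ]
      have : Psi f (Fin.cons p.1 p.2 : Fin (m + 2) → ℝ) = f (p.2 0 - p.1) * Psi f p.2 := by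
        unfold Psi
        rw [Fin.prod_univ_succ]
        simp only [Fin.castSucc_zero, Fin.cons_zero, Fin.cons_succ, ← Fin.succ_castSucc]
      rw [this]; ring
    simp_rw [hP]
    rw [Measure.volume_eq_prod, lintegral_prod_symm]
    · have e : ∀ y : Fin (m+1) → ℝ, ∫⁻ x : ℝ, f (y 0 - x) * (A.indicator 1 (y (Fin.last m)) * Psi f y)
          = (∫⁻ x, f x) * (A.indicator 1 (y (Fin.last m)) * Psi f y) := by
        intro y
        rw [lintegral_mul_const _ (by fun_prop : Measurable fun x : ℝ => f (y 0 - x)), lintegral_sub_left_eq_self f (y 0)]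
      simp only
      simp_rw [e]
      rw [lintegral_const_mul, ih]
      · ring
      · exact (hA1.comp (measurable_pi_apply _)).mul (Psi_measurable hf m)
    · apply Measurable.aemeasurable
      refine (hf.comp ?_).mul ?_
      · fun_prop
      · exact (hA1.comp ((measurable_pi_apply _).comp measurable_snd)).mul ((Psi_measurable hf m).comp measurable_snd)

lemma lintegral_Psisum {f : ℝ → ℝ≥0∞} (hf : Measurable f) (A : Set ℝ) (hA : MeasurableSet A) (m : ℕ) :
    ∫⁻ s in univ.pi (fun _ : Fin (m + 1) => A), ∑ π : Equiv.Perm (Fin (m + 1)), Psi f (s ∘ π) ≤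
      (m + 1).factorial * (volume A * (∫⁻ x, f x) ^ m) := by
  have hcomp : ∀ π : Equiv.Perm (Fin (m + 1)), Measurable fun s : Fin (m + 1) → ℝ => s ∘ π := by
    intro π
    exact measurable_pi_lambda _ fun i => measurable_pi_apply _
  rw [lintegral_finsetSum]
  swap
  · intro π _
    exact (Psi_measurable hf m).comp (hcomp π)
  have : ∀ π : Equiv.Perm (Fin (m + 1)), ∫⁻ s in univ.pi (fun _ : Fin (m + 1) => A), Psi f (s ∘ π) ≤
      volume A * (∫⁻ x, f x) ^ m := by
    intro π
    rw [← lintegral_Psi hf A hA m]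
    have hmp2 := volume_measurePreserving_piCongrLeft (fun _ : Fin (m + 1) => ℝ) π.symm
    rw [← hmp2.lintegral_comp_emb (MeasurableEquiv.measurableEmbedding _),
      ← lintegral_indicator (MeasurableSet.univ_pi fun _ => hA)]
    refine lintegral_mono fun s => ?_
    have e : (MeasurableEquiv.piCongrLeft (fun _ : Fin (m + 1) => ℝ) π.symm) s = s ∘ π := by
      ext j
      simp [MeasurableEquiv.coe_piCongrLeft, Equiv.piCongrLeft_apply]
    rw [e]
    by_cases hs : s ∈ univ.pi (fun _ : Fin (m + 1) => A)
    · rw [indicator_of_mem hs]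
      have : (s ∘ π) (Fin.last m) ∈ A := hs _ (mem_univ _)
      rw [indicator_of_mem this]; simp
    · rw [indicator_of_notMem hs]; exact zero_le
  refine (Finset.sum_le_sum fun π _ => this π).trans ?_
  simp [Fintype.card_perm]

lemma lintegral_gamma {a r : ℝ} (ha : 0 < a) (hr : 0 < r) :
    ∫⁻ t in Ioi (0:ℝ), ENNReal.ofReal (t ^ (a - 1) * Real.exp (-(r * t))) = ENNReal.ofReal ((1 / r) ^ a * Real.Gamma a) := by
  rw [← Real.integral_rpow_mul_exp_neg_mul_Ioi ha hr, ofReal_integral_eq_lintegral_ofReal]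
  · by_contra h
    have h1 := integral_undef h
    rw [Real.integral_rpow_mul_exp_neg_mul_Ioi ha hr] at h1
    have := Real.Gamma_pos_of_pos ha
    have : 0 < (1 / r) ^ a * Real.Gamma a := by positivity
    linarith
  · refine (ae_restrict_iff' measurableSet_Ioi).2 (Filter.Eventually.of_forall fun t ht => ?_)
    exact mul_nonneg (Real.rpow_nonneg (le_of_lt ht) _) (Real.exp_pos _).le

lemma lintegral_fker {γ1 γ2 lam : ℝ} (hl : 0 < lam) (hγ2 : 0 ≤ γ2) (h : γ1 + 2 * γ2 < 1) :
    ∫⁻ g, fker γ1 γ2 lam g ≤ ENNReal.ofReal (lam ^ (γ1 - 1) * (Real.Gamma (1 - γ1) + Real.Gamma (1 - γ1 - 2 * γ2))) := by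
  have h0 : ∫⁻ g, fker γ1 γ2 lam g = ∫⁻ g in Ioi (0:ℝ), fker γ1 γ2 lam g := by
    rw [← setLIntegral_congr Ioi_ae_eq_Ici.symm, ← lintegral_indicator measurableSet_Ici]
    refine lintegral_congr fun g => ?_
    by_cases hg : 0 ≤ g
    · rw [indicator_of_mem (by exact hg)]
    · rw [indicator_of_notMem (by exact hg)]; unfold fker; rw [if_pos (not_le.1 hg)]
  have h1 : ∫⁻ g in Ioi (0:ℝ), fker γ1 γ2 lam g = ∫⁻ g in Ioi (0:ℝ),
      (ENNReal.ofReal (g ^ ((1 - γ1) - 1) * Real.exp (-(lam * g))) + ENNReal.ofReal (lam ^ (-(2 * γ2))) *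
        ENNReal.ofReal (g ^ ((1 - γ1 - 2 * γ2) - 1) * Real.exp (-(lam * g)))) := by
    refine setLIntegral_congr_fun measurableSet_Ioi fun g hg => ?_
    have hg : 0 < g := hg
    rw [fker_of_pos hl hg, ← ENNReal.ofReal_mul (by positivity), ← ENNReal.ofReal_add (by positivity) (by positivity)]
    congr 1
    rw [Real.mul_rpow hl.le hg.le, show 1 - γ1 - 2 * γ2 - 1 = -γ1 + -(2 * γ2) by ring, Real.rpow_add hg,
      show 1 - γ1 - 1 = -γ1 by ring, neg_mul]
    ring
  rw [h0, h1, lintegral_add_left (by fun_prop), lintegral_const_mul _ (by fun_prop), lintegral_gamma (by linarith) hl,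
    lintegral_gamma (by linarith) hl, ← ENNReal.ofReal_mul (by positivity), ← ENNReal.ofReal_add]
  · apply ENNReal.ofReal_le_ofReal
    apply le_of_eq
    rw [one_div, Real.inv_rpow hl.le, Real.inv_rpow hl.le, ← Real.rpow_neg hl.le, ← Real.rpow_neg hl.le,
      ← mul_assoc, ← Real.rpow_add hl, mul_add]
    congr 2
    · congr 1; ring
    · congr 1; ring
  · have := Real.Gamma_pos_of_pos (s := 1 - γ1) (by linarith)
    positivity
  · have := Real.Gamma_pos_of_pos (s := 1 - γ1 - 2 * γ2) (by linarith)
    positivity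

lemma nn_le (n : ℕ) {g : ℝ} (hg : 0 ≤ g) : (n : ℝ) ^ (n * g) ≤ (Real.exp g) ^ n * (n.factorial : ℝ) ^ g := by
  have h := Real.pow_div_factorial_le_exp (x := n) (by positivity) n
  rw [div_le_iff₀ (by positivity)] at h
  calc (n : ℝ) ^ (n * g) = ((n : ℝ) ^ n) ^ g := by rw [Real.rpow_mul (by positivity), Real.rpow_natCast]
    _ ≤ (Real.exp n * n.factorial) ^ g := by gcongr
    _ = _ := by
      rw [Real.mul_rpow (by positivity) (by positivity), ← Real.exp_mul, ← Real.exp_nat_mul]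

lemma numeric_dir {B G0 γ1 γ2 R : ℝ} (hB : 0 ≤ B) (hG : 0 ≤ G0) (h1 : 0 < γ1) (h2 : 0 ≤ γ2) (hR : 0 < R) (hR1 : R ≤ 1)
    (m : ℕ) :
    B ^ (m + 1) * ((m + 1 : ℕ) / R) ^ ((m + 1 : ℕ) * γ2) * Real.exp ((m + 1 : ℕ) / R * R) *
      ((m + 1).factorial * (R * (((m + 1 : ℕ) / R) ^ (γ1 - 1) * G0) ^ m)) ≤
    (B * Real.exp 1 * (1 + G0) * Real.exp (γ1 + γ2) * 2) ^ (m + 1) * ((m + 1).factorial : ℝ) ^ (γ1 + γ2) *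
      R ^ ((m + 1 : ℕ) * (1 - (γ1 + γ2))) := by
  set n := m + 1 with hn
  have hnm : (n : ℝ) = m + 1 := by rw [hn]; push_cast; ring
  have hn0 : (0:ℝ) < n := by rw [hnm]; positivity
  set lam := (n : ℝ) / R with hlam
  have hl0 : 0 < lam := by positivity
  rw [show lam * R = n by rw [hlam]; field_simp]
  have e1 : lam ^ (n * γ2) * (lam ^ (γ1 - 1)) ^ m = (n : ℝ) ^ (n * (γ1 + γ2)) * (n : ℝ) ^ (1 - γ1) * ((n : ℝ) ^ n)⁻¹ *
      (R ^ (n * (1 - (γ1 + γ2))) * R ^ γ1 * R⁻¹) := by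
    rw [← Real.rpow_natCast, ← Real.rpow_mul hl0.le, ← Real.rpow_add hl0, hlam, Real.div_rpow hn0.le hR.le,
      div_eq_mul_inv, ← Real.rpow_natCast, ← Real.rpow_neg hn0.le, ← Real.rpow_neg hR.le, ← Real.rpow_neg_one R,
      ← Real.rpow_add hR, ← Real.rpow_add hR, ← Real.rpow_add hn0, ← Real.rpow_add hn0]
    congr 2
    · rw [hnm]; ring
    · rw [hnm]; ring
  have f1 : (n.factorial : ℝ) * ((n : ℝ) ^ n)⁻¹ ≤ 1 := by
    rw [← div_eq_mul_inv]
    apply div_le_one_of_le₀ _ (by positivity)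
    exact_mod_cast Nat.factorial_le_pow n
  have f2 : (n : ℝ) ^ (1 - γ1) ≤ 2 ^ n := by
    calc (n : ℝ) ^ (1 - γ1) ≤ (n : ℝ) ^ (1 : ℝ) := by
          apply Real.rpow_le_rpow_of_exponent_le
          · rw [hnm]; linarith [(Nat.cast_nonneg m : (0:ℝ) ≤ m)]
          · linarith
      _ ≤ 2 ^ n := by rw [Real.rpow_one]; exact_mod_cast Nat.lt_two_pow_self.le
  have f3 : R ^ γ1 ≤ 1 := Real.rpow_le_one hR.le hR1 h1.le
  have f4 : G0 ^ m ≤ (1 + G0) ^ n := by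
    calc G0 ^ m ≤ (1 + G0) ^ m := by gcongr; linarith
      _ ≤ _ := by apply pow_le_pow_right₀ (by linarith); omega
  have f5 := nn_le n (g := γ1 + γ2) (by linarith)
  have f6 : Real.exp n = Real.exp 1 ^ n := by rw [← Real.exp_nat_mul, mul_one]
  calc _ = B ^ n * Real.exp 1 ^ n * G0 ^ m * n.factorial * R * (lam ^ (n * γ2) * (lam ^ (γ1 - 1)) ^ m) := by
        rw [mul_pow, f6]; ring
    _ = B ^ n * Real.exp 1 ^ n * G0 ^ m * (n : ℝ) ^ (n * (γ1 + γ2)) * (n : ℝ) ^ (1 - γ1) *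
        (n.factorial * ((n : ℝ) ^ n)⁻¹) * R ^ γ1 * R ^ (n * (1 - (γ1 + γ2))) := by
        rw [e1]
        field_simp
    _ ≤ B ^ n * Real.exp 1 ^ n * (1 + G0) ^ n * ((Real.exp (γ1 + γ2)) ^ n * (n.factorial : ℝ) ^ (γ1 + γ2)) * 2 ^ n *
        1 * 1 * R ^ (n * (1 - (γ1 + γ2))) := by
        gcongr
    _ = _ := by
        rw [mul_pow, mul_pow, mul_pow, mul_pow]; ring


lemma lintegral_swap_prod {n : ℕ} : ∀ (K : ℕ) (Φ : Fin K → (Fin n → ℝ) → ℝ≥0∞), (∀ i, Measurable (Φ i)) →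
    ∫⁻ x : Fin n → Fin K → ℝ, ∏ i, Φ i (fun l => x l i) = ∏ i, ∫⁻ y, Φ i y := by
  intro K
  induction K with
  | zero =>
    intro Φ hΦ
    simp only [Finset.univ_eq_empty, Finset.prod_empty, lintegral_one]
    rw [← Set.pi_univ (univ : Set (Fin n)), volume_pi, Measure.pi_pi]
    simp [volume_pi]
  | succ K ih =>
    intro Φ hΦ
    have h1 : MeasurePreserving (fun (x : Fin n → ℝ × (Fin K → ℝ)) (l : Fin n) =>
        (MeasurableEquiv.piFinSuccAbove (fun _ : Fin (K+1) => ℝ) 0).symm (x l)) volume volume :=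
      volume_preserving_pi fun _ => (volume_preserving_piFinSuccAbove (fun _ : Fin (K+1) => ℝ) 0).symm
    have h2 := (volume_measurePreserving_arrowProdEquivProdArrow ℝ (Fin K → ℝ) (Fin n)).symm
    have hm : Measurable fun x : Fin n → Fin (K+1) → ℝ => ∏ i, Φ i (fun l => x l i) := by
      refine Finset.measurable_prod _ fun i _ => (hΦ i).comp ?_
      fun_prop
    rw [← h1.lintegral_comp hm, ← h2.lintegral_comp (f := fun a : Fin n → ℝ × (Fin K → ℝ) => ∏ i, Φ i fun l => (fun l => (MeasurableEquiv.piFinSuccAbove (fun _ : Fin (K+1) => ℝ) 0).symm (a l)) l i) (hm.comp h1.measurable)]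
    have hsn : ∀ p : ℝ × (Fin K → ℝ), (MeasurableEquiv.piFinSuccAbove (fun _ : Fin (K+1) => ℝ) 0).symm p
        = Fin.cons p.1 p.2 := by
      intro p
      rw [MeasurableEquiv.piFinSuccAbove_symm_apply]
      simp [Fin.insertNthEquiv]
    simp_rw [hsn]
    have e : ∀ a : (Fin n → ℝ) × (Fin n → Fin K → ℝ), ∏ i, Φ i (fun l =>
        (Fin.cons ((MeasurableEquiv.arrowProdEquivProdArrow ℝ (Fin K → ℝ) (Fin n)).symm a l).1
          ((MeasurableEquiv.arrowProdEquivProdArrow ℝ (Fin K → ℝ) (Fin n)).symm a l).2 : Fin (K+1) → ℝ) i)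
        = Φ 0 a.1 * ∏ i : Fin K, Φ i.succ (fun l => a.2 l i) := by
      intro a
      rw [Fin.prod_univ_succ]
      rfl
    simp_rw [e]
    rw [Measure.volume_eq_prod, lintegral_prod_mul (f := Φ 0) (g := fun b : Fin n → Fin K → ℝ => ∏ i : Fin K, Φ i.succ (fun l => b l i)), ih _ (fun i => hΦ _), Fin.prod_univ_succ]
    · exact (hΦ 0).aemeasurable
    · refine (Finset.measurable_prod _ fun i _ => (hΦ i.succ).comp ?_).aemeasurable
      fun_prop

/-- the linear phase in direction `v` -/
noncomputable def sdir {N : ℕ} (v : EuclideanSpace ℝ (Fin N)) (z : ℝ × EuclideanSpace ℝ (Fin N)) : ℝ :=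
  z.1 * ‖v‖ + inner ℝ z.2 v

/-- the matrix of the phases -/
noncomputable def dmat {N : ℕ} (v : Fin (N + 1) → EuclideanSpace ℝ (Fin N)) : Matrix (Fin (N + 1)) (Fin (N + 1)) ℝ :=
  Matrix.of fun i => Fin.cons ‖v i‖ (fun j => v i j)

lemma dmat_mulVec {N : ℕ} (v : Fin (N + 1) → EuclideanSpace ℝ (Fin N)) (z : ℝ × EuclideanSpace ℝ (Fin N)) :
    (dmat v).mulVec (Fin.cons z.1 (fun j => z.2 j)) = fun i => sdir (v i) z := by
  ext i
  simp [Matrix.mulVec, dotProduct, dmat, sdir, Fin.sum_univ_succ, PiLp.inner_apply, mul_comm]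

lemma sigmaFinite_smul_aux {α : Type*} [MeasurableSpace α] {μ : Measure α} [SigmaFinite μ] {c : ℝ≥0∞} (hc : c ≠ ⊤) :
    SigmaFinite (c • μ) := by
  lift c to NNReal using hc
  exact inferInstanceAs (SigmaFinite (c • μ))

lemma pi_smul_volume {n : ℕ} {α : Type*} [MeasureSpace α] [SigmaFinite (volume : Measure α)] (c : ℝ≥0∞) (hc : c ≠ ⊤) :
    Measure.pi (fun _ : Fin n => c • (volume : Measure α)) = c ^ n • (volume : Measure (Fin n → α)) := by
  have : SigmaFinite (c • (volume : Measure α)) := sigmaFinite_smul_aux hc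
  refine Measure.pi_eq fun s hs => ?_
  simp [volume_pi, Measure.pi_pi, Finset.prod_mul_distrib]

lemma map_dmat {N : ℕ} (v : Fin (N + 1) → EuclideanSpace ℝ (Fin N)) (hv : (dmat v).det ≠ 0) :
    Measure.map (fun z : ℝ × EuclideanSpace ℝ (Fin N) => fun i => sdir (v i) z) volume =
      ENNReal.ofReal |(dmat v).det⁻¹| • volume := by
  rw [← Real.map_matrix_volume_pi_eq_smul_volume_pi hv]
  have h1 : MeasurePreserving (fun z : ℝ × EuclideanSpace ℝ (Fin N) => (z.1, (WithLp.ofLp z.2 : Fin N → ℝ))) volume volume :=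
    (MeasurePreserving.id volume).prod (PiLp.volume_preserving_ofLp (Fin N))
  have h2 := (volume_preserving_piFinSuccAbove (fun _ : Fin (N+1) => ℝ) 0).symm
  have h3 := h2.comp h1
  rw [← h3.map_eq, Measure.map_map]
  · congr 1
    ext z i
    refine (congrFun (dmat_mulVec v z) i).symm.trans ?_
    simp only [Function.comp_apply, Matrix.toLin'_apply]
    congr 2
    rw [MeasurableEquiv.piFinSuccAbove_symm_apply]
    simp [Fin.insertNthEquiv]
  · exact (LinearMap.continuous_of_finiteDimensional _).measurable
  · exact h3.measurable

lemma change_var {N n : ℕ} (v : Fin (N + 1) → EuclideanSpace ℝ (Fin N)) {δ : ℝ} (hδ : 0 < δ) (hv : δ ≤ |(dmat v).det|)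
    (I : Set (ℝ × EuclideanSpace ℝ (Fin N))) (hI : MeasurableSet I) (A : Fin (N + 1) → Set ℝ)
    (hA : ∀ i, MeasurableSet (A i))
    (hIA : ∀ z ∈ I, ∀ i, sdir (v i) z ∈ A i) (Φ : Fin (N + 1) → (Fin n → ℝ) → ℝ≥0∞) (hΦ : ∀ i, Measurable (Φ i)) :
    ∫⁻ z in univ.pi (fun _ : Fin n => I), ∏ i, Φ i (fun l => sdir (v i) (z l)) ≤
      ENNReal.ofReal (1 / δ) ^ n * ∏ i, ∫⁻ y in univ.pi (fun _ : Fin n => A i), Φ i y := by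
  have hdet : (dmat v).det ≠ 0 := by
    intro h; rw [h] at hv; simp at hv; linarith
  have hm := map_dmat v hdet
  have hL : Measurable (fun z : ℝ × EuclideanSpace ℝ (Fin N) => fun i => sdir (v i) z) := by
    unfold sdir
    fun_prop
  set Ψ : Fin (N + 1) → (Fin n → ℝ) → ℝ≥0∞ := fun i => (univ.pi (fun _ : Fin n => A i)).indicator (Φ i)
  have hΨ : ∀ i, Measurable (Ψ i) := fun i => (hΦ i).indicator (MeasurableSet.univ_pi fun _ => hA i)
  set c := ENNReal.ofReal |(dmat v).det⁻¹|
  have hc : c ≠ ⊤ := ENNReal.ofReal_ne_top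
  have hcle : c ≤ ENNReal.ofReal (1 / δ) := by
    apply ENNReal.ofReal_le_ofReal
    rw [abs_inv, one_div]
    exact inv_anti₀ hδ hv
  have hmap : Measure.map (fun (z : Fin n → ℝ × EuclideanSpace ℝ (Fin N)) (l : Fin n) => (fun i => sdir (v i) (z l))) volume =
      c ^ n • volume := by
    rw [← pi_smul_volume c hc, ← hm, volume_pi]
    have : SigmaFinite (Measure.map (fun z : ℝ × EuclideanSpace ℝ (Fin N) => fun i => sdir (v i) z) volume) := by
      rw [hm]; exact sigmaFinite_smul_aux hc
    exact Measure.pi_map_pi (fun _ => hL.aemeasurable)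
  calc _ ≤ ∫⁻ z in univ.pi (fun _ : Fin n => I), ∏ i, Ψ i (fun l => sdir (v i) (z l)) := by
        refine setLIntegral_mono' (MeasurableSet.univ_pi fun _ => hI) fun z hz => ?_
        refine Finset.prod_le_prod' fun i _ => ?_
        simp only [Ψ]
        rw [indicator_of_mem]
        intro l _
        exact hIA _ (hz l (mem_univ _)) i
    _ ≤ ∫⁻ z : Fin n → ℝ × EuclideanSpace ℝ (Fin N), ∏ i, Ψ i (fun l => sdir (v i) (z l)) := setLIntegral_le_lintegral _ _
    _ = ∫⁻ x : Fin n → Fin (N+1) → ℝ, ∏ i, Ψ i (fun l => x l i)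
        ∂(Measure.map (fun (z : Fin n → ℝ × EuclideanSpace ℝ (Fin N)) (l : Fin n) => (fun i => sdir (v i) (z l))) volume) := by
        rw [lintegral_map]
        · refine Finset.measurable_prod _ fun i _ => (hΨ i).comp ?_
          fun_prop
        · exact measurable_pi_lambda _ fun l => hL.comp (measurable_pi_apply l)
    _ = c ^ n * ∏ i, ∫⁻ y, Ψ i y := by
        rw [hmap, lintegral_smul_measure, lintegral_swap_prod _ _ hΨ, smul_eq_mul]
    _ ≤ _ := by
        refine mul_le_mul' (pow_le_pow_left' hcle n) (Finset.prod_le_prod' fun i _ => ?_)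
        exact (lintegral_indicator (MeasurableSet.univ_pi fun _ => hA i) _).le

lemma exists_dirs (N : ℕ) (hN : 1 ≤ N) : ∃ (p : Fin (N + 1) → EuclideanSpace ℝ (Fin N)) (δ δ0 : ℝ), 0 < δ ∧ 0 < δ0 ∧
    ∀ η ∈ Metric.ball (0 : EuclideanSpace ℝ (Fin N)) δ, (∀ i, 1 / 2 ≤ ‖p i + η‖ ∧ ‖p i + η‖ ≤ 2) ∧
      δ0 ≤ |(dmat (fun i => p i + η)).det| := by
  let o : Fin N := ⟨0, hN⟩
  let p : Fin (N + 1) → EuclideanSpace ℝ (Fin N) :=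
    Fin.cons (-EuclideanSpace.single o 1) (fun i => EuclideanSpace.single i 1)
  have hp : ∀ i, ‖p i‖ = 1 := by
    intro i
    induction i using Fin.cases with
    | zero => simp [p]
    | succ i => simp [p]
  have hdet : (dmat p).det ≠ 0 := by
    intro h0
    obtain ⟨w, hw, hw0⟩ := Matrix.exists_mulVec_eq_zero_iff.2 h0
    apply hw
    have hx : ∀ i : Fin N, w i.succ = - w 0 := by
      intro i
      have := congrFun hw0 i.succ
      simp only [Matrix.mulVec, dotProduct, dmat, Fin.sum_univ_succ, Matrix.of_apply, Fin.cons_zero, Fin.cons_succ, hp] at this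
      simp [p, Fin.sum_univ_succ] at this
      linarith
    have h3 := congrFun hw0 0
    simp only [Matrix.mulVec, dotProduct, dmat, Fin.sum_univ_succ, Matrix.of_apply, Fin.cons_zero, Fin.cons_succ, hp] at h3
    simp [p] at h3
    have h4 := hx o
    have h5 : w 0 = 0 := by linarith
    ext i
    induction i using Fin.cases with
    | zero => simpa using h5
    | succ i => simp [hx i, h5]
  have hcont : Continuous fun η : EuclideanSpace ℝ (Fin N) => |(dmat (fun i => p i + η)).det| := by
    refine Continuous.abs (Continuous.matrix_det ?_)
    refine continuous_matrix fun i j => ?_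
    induction j using Fin.cases with
    | zero => simp only [dmat, Matrix.of_apply, Fin.cons_zero]; fun_prop
    | succ j => simp only [dmat, Matrix.of_apply, Fin.cons_succ]; fun_prop
  have hpos : 0 < |(dmat p).det| := abs_pos.2 hdet
  have hev := (hcont.tendsto 0).eventually (lt_mem_nhds (a := |(dmat p).det| / 2) (by simp only [add_zero]; linarith))
  obtain ⟨δ, hδ, hball⟩ := Metric.eventually_nhds_iff_ball.1 hev
  refine ⟨p, min δ (1 / 2), |(dmat p).det| / 2, by positivity, by positivity, fun η hη => ⟨fun i => ?_, ?_⟩⟩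
  · have h1 : ‖η‖ < 1 / 2 := by
      have := mem_ball_zero_iff.1 hη
      exact this.trans_le (min_le_right _ _)
    have h2 := norm_add_le (p i) η
    have h3 := norm_sub_le_norm_add (p i) η
    rw [hp] at h2 h3
    constructor <;> linarith
  · exact (hball η (Metric.ball_subset_ball (min_le_left _ _) hη)).le


lemma lintegral_smul_comp {N : ℕ} {ρ : ℝ} (hρ : 0 < ρ) (h : EuclideanSpace ℝ (Fin N) → ℝ≥0∞) (hh : Measurable h) :
    ∫⁻ v, h (ρ • v) = ENNReal.ofReal ((ρ ^ N)⁻¹) * ∫⁻ v, h v := by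
  have := Measure.map_addHaar_smul (volume : Measure (EuclideanSpace ℝ (Fin N))) hρ.ne'
  rw [← lintegral_map (f := h) (g := fun v => ρ • v) hh (by fun_prop), this, lintegral_smul_measure, smul_eq_mul]
  congr 2
  simp [abs_of_pos hρ]

lemma radial_bound {N : ℕ} (hN : 1 ≤ N) (g : EuclideanSpace ℝ (Fin N) → ℝ≥0∞) (hg : Measurable g)
    (p : EuclideanSpace ℝ (Fin N)) {δ : ℝ}
    (hp : ∀ η ∈ Metric.ball (0 : EuclideanSpace ℝ (Fin N)) δ, 1 / 2 ≤ ‖p + η‖ ∧ ‖p + η‖ ≤ 2) :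
    ∫⁻ η in Metric.ball (0 : EuclideanSpace ℝ (Fin N)) δ, ∫⁻ ρ in Ioi (0:ℝ),
      ENNReal.ofReal (ρ ^ (N - 1)) * g (ρ • (p + η)) ≤ 3 * ∫⁻ ξ, g ξ := by
  set S : Set (EuclideanSpace ℝ (Fin N)) := {v | 1 / 2 ≤ ‖v‖ ∧ ‖v‖ ≤ 2} with hS
  have hSm : MeasurableSet S := by
    apply IsClosed.measurableSet
    exact (isClosed_le continuous_const continuous_norm).inter (isClosed_le continuous_norm continuous_const)
  set F : EuclideanSpace ℝ (Fin N) → ℝ≥0∞ := fun v => S.indicator 1 v * ∫⁻ ρ in Ioi (0:ℝ), ENNReal.ofReal (ρ ^ (N - 1)) * g (ρ • v) with hF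
  calc _ ≤ ∫⁻ η in Metric.ball (0 : EuclideanSpace ℝ (Fin N)) δ, F (p + η) := by
        refine setLIntegral_mono' measurableSet_ball fun η hη => ?_
        simp only [hF]
        rw [indicator_of_mem (by exact hp η hη)]; simp
    _ ≤ ∫⁻ η, F (p + η) := setLIntegral_le_lintegral _ _
    _ = ∫⁻ v, F v := lintegral_add_left_eq_self F p
    _ = ∫⁻ v, ∫⁻ ρ in Ioi (0:ℝ), S.indicator 1 v * (ENNReal.ofReal (ρ ^ (N - 1)) * g (ρ • v)) := by
        refine lintegral_congr fun v => ?_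
        simp only [hF]
        rw [lintegral_const_mul _ (by fun_prop)]
    _ = ∫⁻ ρ in Ioi (0:ℝ), ∫⁻ v, S.indicator 1 v * (ENNReal.ofReal (ρ ^ (N - 1)) * g (ρ • v)) := by
        rw [lintegral_lintegral_swap]
        apply Measurable.aemeasurable
        have : Measurable (S.indicator (1 : EuclideanSpace ℝ (Fin N) → ℝ≥0∞)) := measurable_one.indicator hSm
        exact (this.comp measurable_fst).mul (by fun_prop)
    _ = ∫⁻ ρ in Ioi (0:ℝ), ∫⁻ ξ, ENNReal.ofReal (ρ⁻¹) * (S.indicator 1 (ρ⁻¹ • ξ) * g ξ) := by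
        refine setLIntegral_congr_fun measurableSet_Ioi fun ρ hρ => ?_
        have hρ : 0 < ρ := hρ
        have hi : Measurable (S.indicator (1 : EuclideanSpace ℝ (Fin N) → ℝ≥0∞)) := measurable_one.indicator hSm
        have e := lintegral_smul_comp hρ (fun ξ => ENNReal.ofReal (ρ ^ (N - 1)) * (S.indicator 1 (ρ⁻¹ • ξ) * g ξ)) (by
          refine Measurable.const_mul (Measurable.mul (hi.comp (by fun_prop)) hg) _)
        simp only [smul_smul, inv_mul_cancel₀ hρ.ne', one_smul] at e
        rw [lintegral_congr (g := fun v => ENNReal.ofReal (ρ ^ (N - 1)) * (S.indicator 1 v * g (ρ • v))) (fun v => by ring), e,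
          lintegral_const_mul' _ _ ENNReal.ofReal_ne_top, lintegral_const_mul' _ _ ENNReal.ofReal_ne_top, ← mul_assoc, ← ENNReal.ofReal_mul (by positivity)]
        congr 2
        obtain ⟨k, rfl⟩ : ∃ k, N = k + 1 := ⟨N - 1, by omega⟩
        simp only [Nat.add_sub_cancel, pow_succ]
        field_simp
    _ = ∫⁻ ξ, ∫⁻ ρ in Ioi (0:ℝ), ENNReal.ofReal (ρ⁻¹) * (S.indicator 1 (ρ⁻¹ • ξ) * g ξ) := by
        rw [lintegral_lintegral_swap]
        apply Measurable.aemeasurable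
        have : Measurable (S.indicator (1 : EuclideanSpace ℝ (Fin N) → ℝ≥0∞)) := measurable_one.indicator hSm
        refine Measurable.mul (by fun_prop) (Measurable.mul (this.comp (by fun_prop)) (by fun_prop))
    _ ≤ ∫⁻ ξ, 3 * g ξ := by
        refine lintegral_mono fun ξ => ?_
        have hi : Measurable (S.indicator (1 : EuclideanSpace ℝ (Fin N) → ℝ≥0∞)) := measurable_one.indicator hSm
        simp_rw [← mul_assoc]
        have hm2 : Measurable fun ρ : ℝ => ENNReal.ofReal ρ⁻¹ * S.indicator 1 (ρ⁻¹ • ξ) := Measurable.mul (by fun_prop) (hi.comp (by fun_prop))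
        rw [lintegral_mul_const _ hm2]
        gcongr
        by_cases hξ : ξ = 0
        · have h0 : (0 : EuclideanSpace ℝ (Fin N)) ∉ S := by
            simp only [hS, mem_setOf_eq, norm_zero]; norm_num
          simp [hξ, h0]
        have hpos : 0 < ‖ξ‖ := norm_pos_iff.2 hξ
        calc _ ≤ ∫⁻ ρ in Ioi (0:ℝ), (Icc (‖ξ‖ / 2) (2 * ‖ξ‖)).indicator (fun _ => ENNReal.ofReal (2 / ‖ξ‖)) ρ := by
              refine setLIntegral_mono' measurableSet_Ioi fun ρ hρ => ?_
              have hρ : 0 < ρ := hρ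
              by_cases hm : ρ⁻¹ • ξ ∈ S
              · have hm' := hm
                simp only [hS, mem_setOf_eq, norm_smul, norm_inv, Real.norm_eq_abs, abs_of_pos hρ] at hm'
                obtain ⟨h1, h2⟩ := hm'
                rw [inv_mul_eq_div, div_le_iff₀ hρ] at h2
                rw [inv_mul_eq_div, le_div_iff₀ hρ] at h1
                rw [indicator_of_mem hm, indicator_of_mem (by constructor <;> linarith)]
                simp only [Pi.one_apply, mul_one]
                apply ENNReal.ofReal_le_ofReal
                rw [inv_eq_one_div, div_le_div_iff₀ hρ hpos]
                linarith
              · rw [indicator_of_notMem hm]; simp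
          _ ≤ ∫⁻ ρ, (Icc (‖ξ‖ / 2) (2 * ‖ξ‖)).indicator (fun _ => ENNReal.ofReal (2 / ‖ξ‖)) ρ := setLIntegral_le_lintegral _ _
          _ = 3 := by
              rw [lintegral_indicator measurableSet_Icc, setLIntegral_const, Real.volume_Icc, ← ENNReal.ofReal_mul (by positivity)]
              rw [show 2 / ‖ξ‖ * (2 * ‖ξ‖ - ‖ξ‖ / 2) = 3 by field_simp; ring]
              norm_num
    _ = _ := by rw [lintegral_const_mul _ hg]

lemma weight_bound {N : ℕ} (hN : 1 ≤ N) {H β : ℝ} (hH : 0 < H) (hβ : 0 < β) {ρ v : ℝ} (hρ : 0 < ρ) (hv1 : 1 / 2 ≤ v) (hv2 : v ≤ 2) :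
    (2:ℝ) ^ (-β) * 3 ^ (-(2 * H + 1)) * w1 N (alphaExp N H β) ρ ≤ ρ ^ (N - 1) * ((ρ * v) ^ (-β) * (1 + ρ * v) ^ (-(2 * H + 1))) := by
  have hv0 : 0 < v := by linarith
  have hρv : 0 < ρ * v := by positivity
  unfold w1
  rw [abs_of_pos hρ]
  rcases le_total ρ 1 with h | h
  · have e1 : (2:ℝ) ^ (-β) ≤ (ρ * v) ^ (-β) := Real.rpow_le_rpow_of_nonpos hρv (by nlinarith) (by linarith)
    have e2 : (3:ℝ) ^ (-(2 * H + 1)) ≤ (1 + ρ * v) ^ (-(2 * H + 1)) :=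
      Real.rpow_le_rpow_of_nonpos (by positivity) (by nlinarith) (by linarith)
    have e3 : min (ρ ^ N) (ρ ^ (-2 * alphaExp N H β - 1)) ≤ ρ ^ (N - 1) :=
      (min_le_left _ _).trans (pow_le_pow_of_le_one hρ.le h (by omega))
    calc _ ≤ (ρ * v) ^ (-β) * (1 + ρ * v) ^ (-(2 * H + 1)) * ρ ^ (N - 1) := by gcongr
      _ = _ := by ring
  · have e1 : (2 * ρ) ^ (-β) ≤ (ρ * v) ^ (-β) := Real.rpow_le_rpow_of_nonpos hρv (by nlinarith) (by linarith)
    have e2 : (3 * ρ) ^ (-(2 * H + 1)) ≤ (1 + ρ * v) ^ (-(2 * H + 1)) :=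
      Real.rpow_le_rpow_of_nonpos (by positivity) (by nlinarith) (by linarith)
    calc _ ≤ (2:ℝ) ^ (-β) * 3 ^ (-(2 * H + 1)) * ρ ^ (-2 * alphaExp N H β - 1) := by
          gcongr; exact min_le_right _ _
      _ = ρ ^ (N - 1) * ((2 * ρ) ^ (-β) * (3 * ρ) ^ (-(2 * H + 1))) := by
          rw [Real.mul_rpow (by norm_num) hρ.le, Real.mul_rpow (by norm_num) hρ.le, ← Real.rpow_natCast ρ (N - 1)]
          have : ρ ^ (-2 * alphaExp N H β - 1) = ρ ^ ((N - 1 : ℕ) : ℝ) * ρ ^ (-β) * ρ ^ (-(2 * H + 1)) := by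
            rw [← Real.rpow_add hρ, ← Real.rpow_add hρ, Nat.cast_sub hN]
            congr 1
            unfold alphaExp
            push_cast
            ring
          rw [this]; ring
      _ ≤ _ := by gcongr

lemma Q1_half (N : ℕ) {a : ℝ} (ha : 0 < a) {n : ℕ} (s c : Fin n → ℝ) :
    ENNReal.ofReal (Q1 N a s c) = 2 * ∫⁻ ρ in Ioi (0:ℝ),
      ENNReal.ofReal (w1 N a ρ * ‖∑ j, (c j : ℂ) * Complex.exp (-Complex.I * ρ * s j)‖ ^ 2) := by
  have hnn : ∀ ρ : ℝ, 0 ≤ w1 N a ρ * ‖∑ j, (c j : ℂ) * Complex.exp (-Complex.I * ρ * s j)‖ ^ 2 :=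
    fun ρ => mul_nonneg (w1_nonneg _ _ _) (by positivity)
  have hev : ∀ ρ : ℝ, w1 N a |ρ| * ‖∑ j, (c j : ℂ) * Complex.exp (-Complex.I * (|ρ| : ℝ) * s j)‖ ^ 2
      = w1 N a ρ * ‖∑ j, (c j : ℂ) * Complex.exp (-Complex.I * ρ * s j)‖ ^ 2 := by
    intro ρ
    rcases abs_choice ρ with h | h
    · rw [h]
    · rw [h]
      congr 1
      · simp [w1]
      · rw [← RCLike.norm_conj, map_sum]
        congr 3
        ext j
        rw [map_mul, ← Complex.exp_conj]
        simp
  rw [← ofReal_integral_eq_lintegral_ofReal (Q1_integrable N ha s c).integrableOn (Filter.Eventually.of_forall hnn)]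
  have := integral_comp_abs (f := fun ρ : ℝ => w1 N a ρ * ‖∑ j, (c j : ℂ) * Complex.exp (-Complex.I * ρ * s j)‖ ^ 2)
  simp only [hev] at this
  unfold Q1
  rw [this, ENNReal.ofReal_mul (by norm_num)]
  norm_num

/-- radial reduction -/
lemma radial_lower {N : ℕ} (hN : 1 ≤ N) {H β : ℝ} (hH : 0 < H) (hβ : 0 < β) (ha : 0 < alphaExp N H β)
    (p : EuclideanSpace ℝ (Fin N)) {δ : ℝ}
    (hp : ∀ η ∈ Metric.ball (0 : EuclideanSpace ℝ (Fin N)) δ, 1 / 2 ≤ ‖p + η‖ ∧ ‖p + η‖ ≤ 2)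
    {n : ℕ} (z : Fin n → ℝ × EuclideanSpace ℝ (Fin N)) (c : Fin n → ℝ) :
    ENNReal.ofReal ((2:ℝ) ^ (-β) * 3 ^ (-(2 * H + 1))) *
      ∫⁻ η in Metric.ball (0 : EuclideanSpace ℝ (Fin N)) δ,
        ENNReal.ofReal (Q1 N (alphaExp N H β) (fun l => sdir (p + η) (z l)) c) ≤
    6 * ∫⁻ ξ : EuclideanSpace ℝ (Fin N), ENNReal.ofReal (‖ξ‖ ^ (-β) * (1 + ‖ξ‖) ^ (-(2 * H + 1)) *
      ‖∑ l, (c l : ℂ) * Complex.exp (-Complex.I * (sdir ξ (z l) : ℝ))‖ ^ 2) := by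
  set g : EuclideanSpace ℝ (Fin N) → ℝ≥0∞ := fun ξ => ENNReal.ofReal (‖ξ‖ ^ (-β) * (1 + ‖ξ‖) ^ (-(2 * H + 1)) *
      ‖∑ l, (c l : ℂ) * Complex.exp (-Complex.I * (sdir ξ (z l) : ℝ))‖ ^ 2) with hgdef
  have hg : Measurable g := by
    have hs : ∀ l, Measurable fun ξ => sdir ξ (z l) := by
      intro l; unfold sdir; fun_prop
    have : Measurable fun ξ : EuclideanSpace ℝ (Fin N) => ∑ l, (c l : ℂ) * Complex.exp (-Complex.I * (sdir ξ (z l) : ℝ)) := by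
      refine Finset.measurable_sum _ fun l _ => Measurable.const_mul (Complex.measurable_exp.comp (Measurable.const_mul (Complex.measurable_ofReal.comp (hs l)) _)) _
    refine ENNReal.measurable_ofReal.comp ?_
    refine Measurable.mul (by fun_prop) (this.norm.pow_const 2)
  have h1 := radial_bound hN g hg p hp
  rw [show (6 : ℝ≥0∞) = 2 * 3 by norm_num, mul_assoc]
  refine le_trans ?_ (mul_le_mul_right h1 2)
  rw [← lintegral_const_mul' _ _ ENNReal.ofReal_ne_top, ← lintegral_const_mul' _ _ (by norm_num)]
  refine setLIntegral_mono' measurableSet_ball fun η hη => ?_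
  rw [Q1_half N ha, mul_left_comm]
  gcongr
  rw [← lintegral_const_mul' _ _ ENNReal.ofReal_ne_top]
  refine setLIntegral_mono' measurableSet_Ioi fun ρ hρ => ?_
  have hρ : 0 < ρ := hρ
  simp only [hgdef]
  rw [← ENNReal.ofReal_mul (by positivity), ← ENNReal.ofReal_mul (by positivity)]
  apply ENNReal.ofReal_le_ofReal
  have hw := weight_bound hN (H := H) hH hβ hρ (hp η hη).1 (hp η hη).2
  have hnorm : ‖ρ • (p + η)‖ = ρ * ‖p + η‖ := by rw [norm_smul, Real.norm_of_nonneg hρ.le]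
  have hs : ∀ l, sdir (ρ • (p + η)) (z l) = ρ * sdir (p + η) (z l) := by
    intro l; unfold sdir; rw [hnorm, inner_smul_right]; ring
  simp_rw [hnorm, hs]
  rw [← mul_assoc, ← mul_assoc]
  have e : ∀ l, -Complex.I * ((ρ * sdir (p + η) (z l) : ℝ) : ℂ) = -Complex.I * ρ * (sdir (p + η) (z l) : ℝ) := by
    intro l; push_cast; ring
  simp_rw [e]
  gcongr


lemma gk_int (t a : ℝ) (ha : a ≠ 0) :
    ∫ s in (0:ℝ)..t, Complex.exp (-Complex.I * a * s) = (1 - Complex.exp (-Complex.I * a * t)) / (Complex.I * a) := by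
  have ha' : (a : ℂ) ≠ 0 := by exact_mod_cast ha
  rw [integral_exp_mul_complex (by simp [ha'])]
  have : Complex.I ≠ 0 := Complex.I_ne_zero
  simp
  field_simp
  ring

lemma Gker_rep {N : ℕ} (t : ℝ) (x ξ : EuclideanSpace ℝ (Fin N)) (τ : ℝ) (hξ : ξ ≠ 0)
    (h1 : τ + ‖ξ‖ ≠ 0) (h2 : τ - ‖ξ‖ ≠ 0) :
    Gker N t x τ ξ = Complex.exp (-Complex.I * ((inner ℝ x ξ : ℝ) : ℂ)) *
      ∫ s in (0:ℝ)..t, Complex.exp (-Complex.I * s * τ) * ((Real.sin ((t - s) * ‖ξ‖) / ‖ξ‖ : ℝ) : ℂ) := by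
  have hρ : ‖ξ‖ ≠ 0 := norm_ne_zero_iff.2 hξ
  unfold Gker
  generalize ‖ξ‖ = ρ at *
  have hρ' : (ρ : ℂ) ≠ 0 := by exact_mod_cast hρ
  have h1' : (τ : ℂ) + ρ ≠ 0 := by exact_mod_cast h1
  have h2' : (τ : ℂ) - ρ ≠ 0 := by exact_mod_cast h2
  have hI : Complex.I ≠ 0 := Complex.I_ne_zero
  have e : ∀ s : ℝ, Complex.exp (-Complex.I * s * τ) * ((Real.sin ((t - s) * ρ) / ρ : ℝ) : ℂ)
      = (Complex.exp (Complex.I * t * ρ) / (2 * Complex.I * ρ)) * Complex.exp (-Complex.I * ((τ + ρ : ℝ) : ℂ) * s)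
        - (Complex.exp (-Complex.I * t * ρ) / (2 * Complex.I * ρ)) * Complex.exp (-Complex.I * ((τ - ρ : ℝ) : ℂ) * s) := by
    intro s
    push_cast
    rw [Complex.sin]
    have e1 : Complex.exp (-Complex.I * (τ + ρ) * s) = Complex.exp (-Complex.I * s * τ) * Complex.exp (-Complex.I * ρ * s) := by
      rw [← Complex.exp_add]; ring_nf
    have e2 : Complex.exp (-Complex.I * (τ - ρ) * s) = Complex.exp (-Complex.I * s * τ) * Complex.exp (Complex.I * ρ * s) := by
      rw [← Complex.exp_add]; ring_nf
    have e3 : Complex.exp (-((t - s) * ρ) * Complex.I) = Complex.exp (-Complex.I * t * ρ) * Complex.exp (Complex.I * ρ * s) := by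
      rw [← Complex.exp_add]; ring_nf
    have e4 : Complex.exp ((t - s) * ρ * Complex.I) = Complex.exp (Complex.I * t * ρ) * Complex.exp (-Complex.I * ρ * s) := by
      rw [← Complex.exp_add]; ring_nf
    rw [e1, e2, e3, e4]
    field_simp
    rw [Complex.I_sq]; ring
  simp_rw [e]
  rw [intervalIntegral.integral_sub (by apply Continuous.intervalIntegrable; fun_prop)
    (by apply Continuous.intervalIntegrable; fun_prop), intervalIntegral.integral_const_mul,
    intervalIntegral.integral_const_mul, gk_int _ _ h1, gk_int _ _ h2]
  push_cast
  have e1 : Complex.exp (-Complex.I * (τ + ρ) * t) = Complex.exp (-Complex.I * t * τ) * Complex.exp (-Complex.I * t * ρ) := by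
    rw [← Complex.exp_add]; ring_nf
  have e2 : Complex.exp (-Complex.I * (τ - ρ) * t) = Complex.exp (-Complex.I * t * τ) * Complex.exp (Complex.I * t * ρ) := by
    rw [← Complex.exp_add]; ring_nf
  have e3 : Complex.exp (-Complex.I * t * ρ) = (Complex.exp (Complex.I * t * ρ))⁻¹ := by
    rw [← Complex.exp_neg]; ring_nf
  have hne : Complex.exp (Complex.I * t * ρ) ≠ 0 := Complex.exp_ne_zero _
  rw [e1, e2, e3]
  field_simp
  simp only [Complex.I_sq]
  ring

lemma exp_sub_bound (t u : ℝ) (ht : 0 ≤ t) (hu : u ≠ 0) (w : ℝ) :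
    ‖(Complex.exp (-Complex.I * t * (u + w : ℝ)) - Complex.exp (-Complex.I * t * w)) / (u : ℂ)‖ ≤ (t + 2) / (1 + |u|)
    ∧ ‖(Complex.exp (-Complex.I * t * (u + w : ℝ)) - Complex.exp (-Complex.I * t * w)) / (u : ℂ)‖ ≤ t := by
  have hu' : 0 < |u| := abs_pos.2 hu
  have e : Complex.exp (-Complex.I * t * (u + w : ℝ)) - Complex.exp (-Complex.I * t * w) =
      Complex.exp ((-t * w : ℝ) * Complex.I) * (Complex.exp (Complex.I * (-t * u : ℝ)) - 1) := by
    rw [mul_sub, ← Complex.exp_add]; push_cast; ring_nf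
  have n1 : ‖Complex.exp (Complex.I * (-t * u : ℝ)) - 1‖ ≤ t * |u| := by
    have := Real.norm_exp_I_mul_ofReal_sub_one_le (x := -t * u)
    rwa [Real.norm_eq_abs, abs_mul, abs_neg, abs_of_nonneg ht] at this
  have n2 : ‖Complex.exp (Complex.I * (-t * u : ℝ)) - 1‖ ≤ 2 := by
    refine (norm_sub_le _ _).trans ?_
    rw [Complex.norm_exp_I_mul_ofReal]; norm_num
  rw [e, norm_div, norm_mul, Complex.norm_exp_ofReal_mul_I, one_mul, Complex.norm_real, Real.norm_eq_abs]
  constructor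
  · rw [div_le_div_iff₀ hu' (by positivity)]
    nlinarith
  · rw [div_le_iff₀ hu']; exact n1

lemma Gker_bounds {N : ℕ} {t : ℝ} (ht : 0 ≤ t) (x ξ : EuclideanSpace ℝ (Fin N)) (τ : ℝ) (hξ : ξ ≠ 0)
    (h1 : τ + ‖ξ‖ ≠ 0) (h2 : τ - ‖ξ‖ ≠ 0) :
    ‖Gker N t x τ ξ‖ ≤ (t ^ 2 + 2 * t) / (1 + |τ|) ∧
    ‖Gker N t x τ ξ‖ ≤ (t + 2) / ‖ξ‖ * ((1 + |τ + ‖ξ‖|)⁻¹ + (1 + |τ - ‖ξ‖|)⁻¹) := by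
  have hρ : 0 < ‖ξ‖ := norm_pos_iff.2 hξ
  have hG0 : ‖Gker N t x τ ξ‖ ≤ t ^ 2 := by
    rw [Gker_rep t x ξ τ hξ h1 h2, norm_mul,
      show -Complex.I * ((inner ℝ x ξ : ℝ) : ℂ) = ((-(inner ℝ x ξ : ℝ) : ℝ) : ℂ) * Complex.I by push_cast; ring,
      Complex.norm_exp_ofReal_mul_I, one_mul]
    have := intervalIntegral.norm_integral_le_of_norm_le_const (a := 0) (b := t) (C := t)
      (f := fun s : ℝ => Complex.exp (-Complex.I * s * τ) * ((Real.sin ((t - s) * ‖ξ‖) / ‖ξ‖ : ℝ) : ℂ)) ?_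
    · rw [sub_zero, abs_of_nonneg ht] at this; nlinarith
    · intro s hs
      rw [uIoc_of_le ht] at hs
      rw [norm_mul, show -Complex.I * s * τ = ((-s * τ : ℝ) : ℂ) * Complex.I by push_cast; ring,
        Complex.norm_exp_ofReal_mul_I, one_mul, Complex.norm_real, Real.norm_eq_abs, abs_div, abs_of_pos hρ,
        div_le_iff₀ hρ]
      refine Real.abs_sin_le_abs.trans ?_
      rw [abs_mul, abs_of_pos hρ, abs_of_nonneg (by linarith [hs.2])]
      nlinarith [hs.1]
  have hGd : ‖Gker N t x τ ξ‖ = 1 / (2 * ‖ξ‖) *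
     ‖((Complex.exp (-Complex.I * (t : ℂ) * (τ : ℂ)) -
        Complex.exp (Complex.I * (t : ℂ) * (‖ξ‖ : ℂ))) / ((τ : ℂ) + (‖ξ‖ : ℂ)) -
      (Complex.exp (-Complex.I * (t : ℂ) * (τ : ℂ)) -
        Complex.exp (-Complex.I * (t : ℂ) * (‖ξ‖ : ℂ))) / ((τ : ℂ) - (‖ξ‖ : ℂ)))‖ := by
    unfold Gker
    rw [norm_mul, norm_div, 
      show -Complex.I * ((inner ℝ x ξ : ℝ) : ℂ) = ((-(inner ℝ x ξ : ℝ) : ℝ) : ℂ) * Complex.I by push_cast; ring,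
      Complex.norm_exp_ofReal_mul_I]
    simp
  obtain ⟨a1, a2⟩ := exp_sub_bound t _ ht h1 (-‖ξ‖)
  obtain ⟨b1, b2⟩ := exp_sub_bound t _ ht h2 (‖ξ‖)
  set ρ := ‖ξ‖ with hρdef
  have e1 : Complex.exp (-Complex.I * t * ((τ + ρ) + -ρ : ℝ)) - Complex.exp (-Complex.I * t * (-ρ : ℝ))
      = Complex.exp (-Complex.I * (t : ℂ) * (τ : ℂ)) - Complex.exp (Complex.I * (t : ℂ) * (ρ : ℂ)) := by
    push_cast; ring_nf
  have e2 : Complex.exp (-Complex.I * t * ((τ - ρ) + ρ : ℝ)) - Complex.exp (-Complex.I * t * (ρ : ℝ))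
      = Complex.exp (-Complex.I * (t : ℂ) * (τ : ℂ)) - Complex.exp (-Complex.I * (t : ℂ) * (ρ : ℂ)) := by
    push_cast; ring_nf
  rw [e1] at a1 a2
  rw [e2] at b1 b2
  push_cast at a1 a2 b1 b2
  have h1' : (τ : ℂ) + ρ ≠ 0 := by exact_mod_cast h1
  have h2' : (τ : ℂ) - ρ ≠ 0 := by exact_mod_cast h2
  constructor
  · rw [le_div_iff₀ (by positivity)]
    have hτ : |τ| * ‖Gker N t x τ ξ‖ ≤ 2 * t := by
      rw [hGd, ← mul_assoc, mul_comm |τ|, mul_assoc, ← Real.norm_eq_abs, ← Complex.norm_real, ← norm_mul]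
      have es : Complex.exp (Complex.I * t * ρ) - Complex.exp (-Complex.I * t * ρ) = 2 * Complex.I * (Real.sin (t * ρ) : ℝ) := by
        push_cast
        rw [Complex.sin, show (t : ℂ) * ρ * Complex.I = Complex.I * t * ρ by ring,
          show -((t : ℂ) * ρ) * Complex.I = -Complex.I * t * ρ by ring]
        linear_combination (-(Complex.exp (-Complex.I * t * ρ) - Complex.exp (Complex.I * t * ρ))) * Complex.I_sq
      set E := Complex.exp (-Complex.I * (t : ℂ) * (τ : ℂ))
      set P := Complex.exp (Complex.I * (t : ℂ) * (ρ : ℂ))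
      set M := Complex.exp (-Complex.I * (t : ℂ) * (ρ : ℂ))
      have e3 : (τ : ℂ) * ((E - P) / (τ + ρ) - (E - M) / (τ - ρ)) =
          -(2 * Complex.I * (Real.sin (t * ρ) : ℝ)) - ρ * ((E - P) / (τ + ρ)) - ρ * ((E - M) / (τ - ρ)) := by
        rw [← es]
        field_simp
        ring
      rw [e3]
      have hs : ‖-(2 * Complex.I * ((Real.sin (t * ρ) : ℝ) : ℂ))‖ ≤ 2 * (t * ρ) := by
        rw [norm_neg, norm_mul, norm_mul, Complex.norm_real, Complex.norm_I, Real.norm_eq_abs]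
        have := (Real.abs_sin_le_abs (x := t * ρ))
        rw [abs_of_nonneg (by positivity : 0 ≤ t * ρ)] at this
        norm_num
        linarith
      have hn : ‖-(2 * Complex.I * ((Real.sin (t * ρ) : ℝ) : ℂ)) - ρ * ((E - P) / (τ + ρ)) - ρ * ((E - M) / (τ - ρ))‖
          ≤ 2 * (t * ρ) + ρ * t + ρ * t := by
        refine (norm_sub_le _ _).trans (add_le_add ((norm_sub_le _ _).trans (add_le_add hs ?_)) ?_)
        all_goals
          rw [norm_mul, Complex.norm_real, Real.norm_of_nonneg hρ.le]
          gcongr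
      calc _ ≤ 1 / (2 * ρ) * (2 * (t * ρ) + ρ * t + ρ * t) := by gcongr
        _ = 2 * t := by field_simp; ring
    nlinarith
  · rw [hGd]
    calc _ ≤ 1 / (2 * ρ) * ((t + 2) / (1 + |τ + ρ|) + (t + 2) / (1 + |τ - ρ|)) := by
          gcongr
          exact (norm_sub_le _ _).trans (add_le_add a1 b1)
      _ ≤ 1 / ρ * ((t + 2) / (1 + |τ + ρ|) + (t + 2) / (1 + |τ - ρ|)) := by
          gcongr; linarith
      _ = _ := by ring


lemma tau_pt {θ : ℝ} (hθ0 : 0 ≤ θ) (hθ1 : θ < 1) {τ : ℝ} (hτ : τ ≠ 0) (u : ℝ) :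
    |τ| ^ (-θ) * (1 + |u|) ^ (θ - 2) ≤ (Icc (-1:ℝ) 1).indicator (fun x => |x| ^ (-θ)) τ + (1 + |u|) ^ (θ - 2) := by
  have h0 : 0 < |τ| := abs_pos.2 hτ
  have hu : 1 ≤ 1 + |u| := by linarith [abs_nonneg u]
  by_cases h : τ ∈ Icc (-1:ℝ) 1
  · rw [indicator_of_mem h]
    have : (1 + |u|) ^ (θ - 2) ≤ 1 := Real.rpow_le_one_of_one_le_of_nonpos hu (by linarith)
    have h2 : 0 ≤ (1 + |u|) ^ (θ - 2) := by positivity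
    have h3 : 0 ≤ |τ| ^ (-θ) := by positivity
    nlinarith
  · rw [indicator_of_notMem h, zero_add]
    have : 1 ≤ |τ| := by
      by_contra hc
      push Not at hc
      exact h (abs_le.1 hc.le)
    have : |τ| ^ (-θ) ≤ 1 := Real.rpow_le_one_of_one_le_of_nonpos this (by linarith)
    have h2 : 0 ≤ (1 + |u|) ^ (θ - 2) := by positivity
    nlinarith

lemma tau_pt2 {θ : ℝ} (hθ0 : 0 ≤ θ) (hθ1 : θ < 1) {τ : ℝ} (hτ : τ ≠ 0) (σ : ℝ) :
    |σ| ^ θ * (|τ| ^ (-θ) * ((1 + |τ - σ|)⁻¹) ^ 2) ≤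
      (Icc (-1:ℝ) 1).indicator (fun x => |x| ^ (-θ)) τ + 2 * (1 + |τ - σ|) ^ (θ - 2) := by
  have h0 : 0 < |τ| := abs_pos.2 hτ
  have h1 := tau_pt hθ0 hθ1 hτ (τ - σ)
  set u := |τ - σ| with hu
  have hu0 : 0 ≤ u := abs_nonneg _
  have hs : |σ| ^ θ ≤ |τ| ^ θ + u ^ θ := by
    refine le_trans ?_ (Real.rpow_add_le_add_rpow (abs_nonneg _) hu0 hθ0 hθ1.le)
    gcongr
    have : |σ| = |τ - (τ - σ)| := by ring_nf
    rw [this]; exact abs_sub _ _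
  have e1 : ((1 + u)⁻¹) ^ 2 = (1 + u) ^ (-(2:ℝ)) := by
    rw [Real.rpow_neg (by positivity), inv_pow]; norm_cast
  have e2 : (1 + u) ^ (-(2:ℝ)) ≤ (1 + u) ^ (θ - 2) :=
    Real.rpow_le_rpow_of_exponent_le (by linarith) (by linarith)
  have e3 : u ^ θ * (1 + u) ^ (-(2:ℝ)) ≤ (1 + u) ^ (θ - 2) := by
    rw [show θ - 2 = θ + -(2:ℝ) by ring, Real.rpow_add (by positivity)]
    gcongr
    linarith
  have e4 : |τ| ^ θ * |τ| ^ (-θ) = 1 := by rw [← Real.rpow_add h0]; simp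
  rw [e1]
  calc _ ≤ (|τ| ^ θ + u ^ θ) * (|τ| ^ (-θ) * (1 + u) ^ (-(2:ℝ))) := by gcongr
    _ = (|τ| ^ θ * |τ| ^ (-θ)) * (1 + u) ^ (-(2:ℝ)) + |τ| ^ (-θ) * (u ^ θ * (1 + u) ^ (-(2:ℝ))) := by ring
    _ ≤ (1 + u) ^ (θ - 2) + |τ| ^ (-θ) * (1 + u) ^ (θ - 2) := by
      rw [e4, one_mul]; gcongr
    _ ≤ _ := by linarith

lemma tau_A {θ : ℝ} (hθ1 : θ < 1) :
    Integrable ((Icc (-1:ℝ) 1).indicator (fun x => |x| ^ (-θ))) := by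
  rw [integrable_indicator_iff measurableSet_Icc]
  have h1 : IntegrableOn (fun x : ℝ => |x| ^ (-θ)) (Icc 0 1) := by
    have := (intervalIntegral.intervalIntegrable_rpow' (a := 0) (b := 1) (r := -θ) (by linarith))
    rw [intervalIntegrable_iff_integrableOn_Icc_of_le zero_le_one] at this
    refine this.congr_fun (fun x hx => ?_) measurableSet_Icc
    simp only [abs_of_nonneg hx.1]
  have h2 : IntegrableOn (fun x : ℝ => |x| ^ (-θ)) (Icc (-1) 0) := by
    have h3 := (Measure.measurePreserving_neg (volume : Measure ℝ)).integrableOn_comp_preimage (Homeomorph.neg ℝ).measurableEmbedding (f := fun x : ℝ => |x| ^ (-θ)) (s := Icc 0 1)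
    have := h3.2 h1
    simpa [Function.comp_def] using this
  have := h2.union h1
  rwa [Icc_union_Icc_eq_Icc (by norm_num) (by norm_num)] at this

lemma tau_B {θ : ℝ} (hθ1 : θ < 1) : Integrable (fun u : ℝ => (1 + |u|) ^ (θ - 2)) := by
  have := integrable_one_add_norm (E := ℝ) (μ := volume) (r := 2 - θ) (by simp; linarith)
  simpa using this

lemma tau_C {θ : ℝ} (hθ0 : 0 ≤ θ) (hθ1 : θ < 1) :
    ∃ K : ℝ, 0 < K ∧ (∫⁻ τ : ℝ, ENNReal.ofReal (|τ| ^ (-θ) * ((1 + |τ|)⁻¹) ^ 2) ≤ ENNReal.ofReal K) ∧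
     ∀ σ : ℝ, σ ≠ 0 → ∫⁻ τ : ℝ, ENNReal.ofReal (|τ| ^ (-θ) * ((1 + |τ - σ|)⁻¹) ^ 2) ≤ ENNReal.ofReal (K * |σ| ^ (-θ)) := by
  have hA := tau_A hθ1
  have hB := tau_B hθ1
  have hBs : ∀ σ : ℝ, Integrable (fun τ : ℝ => 2 * (1 + |τ - σ|) ^ (θ - 2)) := fun σ => (hB.comp_sub_right σ).const_mul 2
  set KA := ∫ τ : ℝ, (Icc (-1:ℝ) 1).indicator (fun x => |x| ^ (-θ)) τ
  set KB := ∫ u : ℝ, (1 + |u|) ^ (θ - 2)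
  have hKA : 0 ≤ KA := integral_nonneg fun τ => indicator_nonneg (fun x _ => by positivity) _
  have hKB : 0 ≤ KB := integral_nonneg fun τ => by positivity
  have hi : ∀ σ : ℝ, ∫⁻ τ, ENNReal.ofReal ((Icc (-1:ℝ) 1).indicator (fun x => |x| ^ (-θ)) τ + 2 * (1 + |τ - σ|) ^ (θ - 2)) = ENNReal.ofReal (KA + 2 * KB) := by
    intro σ
    have hadd : Integrable (fun τ => (Icc (-1:ℝ) 1).indicator (fun x => |x| ^ (-θ)) τ + 2 * (1 + |τ - σ|) ^ (θ - 2)) := hA.add (hBs σ)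
    rw [← ofReal_integral_eq_lintegral_ofReal hadd, integral_add hA (hBs σ), integral_const_mul,
      integral_sub_right_eq_self (fun u => (1 + |u|) ^ (θ - 2)) σ]
    refine Filter.Eventually.of_forall fun τ => ?_
    have : 0 ≤ (Icc (-1:ℝ) 1).indicator (fun x => |x| ^ (-θ)) τ := indicator_nonneg (fun x _ => by positivity) _
    have h2 : 0 ≤ 2 * (1 + |τ - σ|) ^ (θ - 2) := by positivity
    simpa using add_nonneg this h2
  have hne : ∀ᵐ τ : ℝ, τ ≠ 0 := by simp [ae_iff]
  refine ⟨KA + 2 * KB + 1, by positivity, ?_, ?_⟩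
  · calc _ ≤ ∫⁻ τ : ℝ, ENNReal.ofReal ((Icc (-1:ℝ) 1).indicator (fun x => |x| ^ (-θ)) τ + 2 * (1 + |τ - 0|) ^ (θ - 2)) := by
          refine lintegral_mono_ae ?_
          filter_upwards [hne] with τ hτ
          apply ENNReal.ofReal_le_ofReal
          have h1 := tau_pt hθ0 hθ1 hτ τ
          have e1 : ((1 + |τ|)⁻¹) ^ 2 ≤ (1 + |τ|) ^ (θ - 2) := by
            rw [show ((1 + |τ|)⁻¹) ^ 2 = (1 + |τ|) ^ (-(2:ℝ)) by
              rw [Real.rpow_neg (by positivity), inv_pow]; norm_cast]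
            exact Real.rpow_le_rpow_of_exponent_le (by linarith [abs_nonneg τ]) (by linarith)
          have e2 : |τ| ^ (-θ) * ((1 + |τ|)⁻¹) ^ 2 ≤ |τ| ^ (-θ) * (1 + |τ|) ^ (θ - 2) := by gcongr
          have e3 : 0 ≤ (1 + |τ|) ^ (θ - 2) := by positivity
          rw [sub_zero]
          linarith
      _ ≤ _ := by rw [hi]; apply ENNReal.ofReal_le_ofReal; linarith
  · intro σ hσ
    have hσ' : 0 < |σ| := abs_pos.2 hσ
    calc _ ≤ ∫⁻ τ : ℝ, ENNReal.ofReal (|σ| ^ (-θ)) * ENNReal.ofReal ((Icc (-1:ℝ) 1).indicator (fun x => |x| ^ (-θ)) τ + 2 * (1 + |τ - σ|) ^ (θ - 2)) := by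
          refine lintegral_mono_ae ?_
          filter_upwards [hne] with τ hτ
          rw [← ENNReal.ofReal_mul (by positivity)]
          apply ENNReal.ofReal_le_ofReal
          have h1 := tau_pt2 hθ0 hθ1 hτ σ
          calc _ = |σ| ^ (-θ) * (|σ| ^ θ * (|τ| ^ (-θ) * ((1 + |τ - σ|)⁻¹) ^ 2)) := by
                rw [← mul_assoc (|σ| ^ (-θ)), ← Real.rpow_add hσ']; simp
            _ ≤ _ := by gcongr
      _ ≤ _ := by
        rw [lintegral_const_mul' _ _ ENNReal.ofReal_ne_top, hi, ← ENNReal.ofReal_mul (by positivity)]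
        apply ENNReal.ofReal_le_ofReal
        rw [mul_comm]; exact mul_le_mul_of_nonneg_right (by linarith) (by positivity)

lemma Gker_tau {N : ℕ} {H : ℝ} (hH1 : 1 / 2 ≤ H) (hH2 : H < 1) {t : ℝ} (ht : 0 ≤ t) :
    ∃ K : ℝ, 0 < K ∧ ∀ x ξ : EuclideanSpace ℝ (Fin N), ξ ≠ 0 →
      ∫⁻ τ : ℝ, ENNReal.ofReal (‖Gker N t x τ ξ‖ ^ 2 * |τ| ^ (1 - 2 * H)) ≤
        ENNReal.ofReal (K * min 1 (‖ξ‖ ^ (-(2 * H + 1)))) := by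
  obtain ⟨K, hK, hK1, hK2⟩ := tau_C (θ := 2 * H - 1) (by linarith) (by linarith)
  rw [show -(2 * H - 1) = 1 - 2 * H by ring] at hK1 hK2
  refine ⟨((t ^ 2 + 2 * t) ^ 2 + 4 * (t + 2) ^ 2) * K, by positivity, ?_⟩
  intro x ξ hξ
  have hρ : 0 < ‖ξ‖ := norm_pos_iff.2 hξ
  have hne : ∀ a : ℝ, ∀ᵐ τ : ℝ, τ ≠ a := by intro a; simp [ae_iff]
  rw [mul_min_of_nonneg _ _ (by positivity), ENNReal.ofReal_min]
  refine le_min ?_ ?_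
  · calc _ ≤ ∫⁻ τ : ℝ, ENNReal.ofReal ((t ^ 2 + 2 * t) ^ 2) * ENNReal.ofReal (|τ| ^ (1 - 2 * H) * ((1 + |τ|)⁻¹) ^ 2) := by
          refine lintegral_mono_ae ?_
          filter_upwards [hne (-‖ξ‖), hne ‖ξ‖] with τ h1 h2
          rw [← ENNReal.ofReal_mul (by positivity)]
          apply ENNReal.ofReal_le_ofReal
          have := (Gker_bounds ht x ξ τ hξ (fun h => h1 (by linarith)) (fun h => h2 (by linarith))).1
          calc _ ≤ ((t ^ 2 + 2 * t) / (1 + |τ|)) ^ 2 * |τ| ^ (1 - 2 * H) := by gcongr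
            _ = _ := by rw [div_pow, inv_pow]; ring
      _ ≤ _ := by
        rw [lintegral_const_mul' _ _ ENNReal.ofReal_ne_top]
        calc _ ≤ ENNReal.ofReal ((t ^ 2 + 2 * t) ^ 2) * ENNReal.ofReal K := by gcongr
          _ ≤ _ := by
            rw [← ENNReal.ofReal_mul (by positivity)]
            apply ENNReal.ofReal_le_ofReal
            nlinarith [sq_nonneg (t + 2)]
  · have hm : ∀ σ : ℝ, Measurable fun τ : ℝ => ENNReal.ofReal (|τ| ^ (1 - 2 * H) * ((1 + |τ - σ|)⁻¹) ^ 2) := by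
      intro σ; fun_prop
    calc _ ≤ ∫⁻ τ : ℝ, ENNReal.ofReal (2 * (t + 2) ^ 2 / ‖ξ‖ ^ 2) *
           (ENNReal.ofReal (|τ| ^ (1 - 2 * H) * ((1 + |τ - (-‖ξ‖)|)⁻¹) ^ 2) + ENNReal.ofReal (|τ| ^ (1 - 2 * H) * ((1 + |τ - ‖ξ‖|)⁻¹) ^ 2)) := by
          refine lintegral_mono_ae ?_
          filter_upwards [hne (-‖ξ‖), hne ‖ξ‖] with τ h1 h2
          rw [← ENNReal.ofReal_add (by positivity) (by positivity), ← ENNReal.ofReal_mul (by positivity)]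
          apply ENNReal.ofReal_le_ofReal
          have := (Gker_bounds ht x ξ τ hξ (fun h => h1 (by linarith)) (fun h => h2 (by linarith))).2
          rw [sub_neg_eq_add]
          calc _ ≤ ((t + 2) / ‖ξ‖ * ((1 + |τ + ‖ξ‖|)⁻¹ + (1 + |τ - ‖ξ‖|)⁻¹)) ^ 2 * |τ| ^ (1 - 2 * H) := by gcongr
            _ = ((t + 2) ^ 2 / ‖ξ‖ ^ 2) * ((1 + |τ + ‖ξ‖|)⁻¹ + (1 + |τ - ‖ξ‖|)⁻¹) ^ 2 * |τ| ^ (1 - 2 * H) := by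
                rw [mul_pow, div_pow]
            _ ≤ ((t + 2) ^ 2 / ‖ξ‖ ^ 2) * (2 * (((1 + |τ + ‖ξ‖|)⁻¹) ^ 2 + ((1 + |τ - ‖ξ‖|)⁻¹) ^ 2)) * |τ| ^ (1 - 2 * H) := by
                gcongr; exact add_sq_le
            _ = _ := by ring
      _ ≤ _ := by
        rw [lintegral_const_mul' _ _ ENNReal.ofReal_ne_top, lintegral_add_left (hm _)]
        calc _ ≤ ENNReal.ofReal (2 * (t + 2) ^ 2 / ‖ξ‖ ^ 2) * (ENNReal.ofReal (K * |-‖ξ‖| ^ (1 - 2 * H)) + ENNReal.ofReal (K * |‖ξ‖| ^ (1 - 2 * H))) := by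
              gcongr
              · exact hK2 _ (by simpa using hξ)
              · exact hK2 _ (by simpa using hξ)
          _ ≤ _ := by
            rw [abs_neg, abs_of_pos hρ, ← ENNReal.ofReal_add (by positivity) (by positivity), ← ENNReal.ofReal_mul (by positivity)]
            apply ENNReal.ofReal_le_ofReal
            have : ‖ξ‖ ^ (-(2 * H + 1)) = ‖ξ‖ ^ (1 - 2 * H) / ‖ξ‖ ^ 2 := by
              rw [← Real.rpow_natCast, ← Real.rpow_sub hρ]; congr 1; push_cast; ring
            rw [this]
            calc _ = 4 * (t + 2) ^ 2 * K * (‖ξ‖ ^ (1 - 2 * H) / ‖ξ‖ ^ 2) := by ring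
              _ ≤ _ := by gcongr; nlinarith [sq_nonneg (t ^ 2 + 2 * t)]

lemma xi_int {N : ℕ} (hN : 1 ≤ N) {H β : ℝ} (hβN : β < N) (hlow : (N : ℝ) - 2 * H - 1 < β) (hH : 0 < H) (hβ : 0 < β) :
    Integrable (fun ξ : EuclideanSpace ℝ (Fin N) => min 1 (‖ξ‖ ^ (-(2 * H + 1))) * ‖ξ‖ ^ (-β)) := by
  have : Nonempty (Fin N) := ⟨⟨0, hN⟩⟩
  have : Nontrivial (EuclideanSpace ℝ (Fin N)) := inferInstance
  rw [integrable_fun_norm_addHaar volume (f := fun y : ℝ => min 1 (y ^ (-(2 * H + 1))) * y ^ (-β))]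
  rw [finrank_euclideanSpace_fin]
  have hcast : ((N - 1 : ℕ) : ℝ) = N - 1 := by push_cast [hN]; ring
  rw [← Ioc_union_Ioi_eq_Ioi (zero_le_one' ℝ)]
  refine IntegrableOn.union ?_ ?_
  · have := (intervalIntegral.intervalIntegrable_rpow' (a := 0) (b := 1) (r := N - 1 - β) (by linarith))
    rw [intervalIntegrable_iff_integrableOn_Ioc_of_le zero_le_one] at this
    refine Integrable.mono' this (by apply Measurable.aestronglyMeasurable; fun_prop) ?_
    refine (ae_restrict_iff' measurableSet_Ioc).2 (Filter.Eventually.of_forall fun y hy => ?_)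
    have hy0 := hy.1
    rw [Real.norm_of_nonneg (by have : 0 ≤ min 1 (y ^ (-(2 * H + 1))) := by positivity
                                simp only [smul_eq_mul]; positivity)]
    rw [smul_eq_mul, show (N : ℝ) - 1 - β = ((N - 1 : ℕ) : ℝ) + -β by rw [hcast]; ring, Real.rpow_add hy0, Real.rpow_natCast]
    gcongr
    calc _ ≤ 1 * y ^ (-β) := by gcongr; exact min_le_left _ _
      _ = _ := one_mul _
  · have := integrableOn_Ioi_rpow_of_lt (a := N - 1 - β - (2 * H + 1)) (c := 1) (by linarith) one_pos
    refine Integrable.mono' this (by apply Measurable.aestronglyMeasurable; fun_prop) ?_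
    refine (ae_restrict_iff' measurableSet_Ioi).2 (Filter.Eventually.of_forall fun y hy => ?_)
    have hy0 : 0 < y := lt_trans one_pos hy
    rw [Real.norm_of_nonneg (by have : 0 ≤ min 1 (y ^ (-(2 * H + 1))) := by positivity
                                simp only [smul_eq_mul]; positivity)]
    rw [smul_eq_mul, show (N : ℝ) - 1 - β - (2 * H + 1) = ((N - 1 : ℕ) : ℝ) + (-(2 * H + 1) + -β) by rw [hcast]; ring, Real.rpow_add hy0, Real.rpow_natCast, Real.rpow_add hy0]
    gcongr
    exact min_le_right _ _


lemma Gker_measurable {N : ℕ} (t : ℝ) (x : EuclideanSpace ℝ (Fin N)) :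
    Measurable (fun p : ℝ × EuclideanSpace ℝ (Fin N) => Gker N t x p.1 p.2) := by
  unfold Gker
  fun_prop

lemma norm_sum_sq_le {n : ℕ} (f : Fin n → ℂ) : ‖∑ j, f j‖ ^ 2 ≤ n * ∑ j, ‖f j‖ ^ 2 := by
  calc _ ≤ (∑ j, ‖f j‖) ^ 2 := by gcongr; exact norm_sum_le _ _
    _ ≤ _ := by
      have := sq_sum_le_card_mul_sum_sq (s := Finset.univ) (f := fun j => ‖f j‖)
      simpa using this

lemma Qvar_eq {N : ℕ} (hN : 1 ≤ N) {H β : ℝ} (hH1 : 1 / 2 ≤ H) (hH2 : H < 1)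
    (hβ0 : 0 < β) (hβN : β < N) (hβlow : (N : ℝ) - 2 * H - 1 < β)
    {hfun : EuclideanSpace ℝ (Fin N) → ℝ} (hmeas : Measurable hfun)
    {c₁ c₂ : ℝ} (hc₁ : 0 < c₁) (hc₁₂ : c₁ ≤ c₂)
    (hflow : ∀ ξ : EuclideanSpace ℝ (Fin N), ξ ≠ 0 → c₁ * ‖ξ‖ ^ (-β) ≤ hfun ξ)
    (hfup : ∀ ξ : EuclideanSpace ℝ (Fin N), ξ ≠ 0 → hfun ξ ≤ c₂ * ‖ξ‖ ^ (-β))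
    {n : ℕ} (z : Fin n → ℝ × EuclideanSpace ℝ (Fin N)) (hz : ∀ j, 0 ≤ (z j).1) (c : Fin n → ℝ) :
    ENNReal.ofReal (Qvar N H hfun z c) = ∫⁻ ξ : EuclideanSpace ℝ (Fin N), ∫⁻ τ : ℝ,
      ENNReal.ofReal (‖∑ j, (c j : ℂ) * Gker N (z j).1 (z j).2 τ ξ‖ ^ 2 * |τ| ^ (1 - 2 * H) * hfun ξ) := by
  have : Nonempty (Fin N) := ⟨⟨0, hN⟩⟩
  have : Nontrivial (EuclideanSpace ℝ (Fin N)) := inferInstance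
  have hm0 : Measurable (fun p : ℝ × EuclideanSpace ℝ (Fin N) => ‖∑ j, (c j : ℂ) * Gker N (z j).1 (z j).2 p.1 p.2‖ ^ 2 * |p.1| ^ (1 - 2 * H) * hfun p.2) := by
    refine Measurable.mul (Measurable.mul (Measurable.pow_const (Measurable.norm (Finset.measurable_sum _ fun j _ => (Gker_measurable _ _).const_mul _)) _) (by fun_prop)) (by fun_prop)
  have hm : Measurable (fun p : ℝ × EuclideanSpace ℝ (Fin N) => ENNReal.ofReal (‖∑ j, (c j : ℂ) * Gker N (z j).1 (z j).2 p.1 p.2‖ ^ 2 * |p.1| ^ (1 - 2 * H) * hfun p.2)) := hm0.ennreal_ofReal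
  have hswap : ∫⁻ ξ : EuclideanSpace ℝ (Fin N), ∫⁻ τ : ℝ,
      ENNReal.ofReal (‖∑ j, (c j : ℂ) * Gker N (z j).1 (z j).2 τ ξ‖ ^ 2 * |τ| ^ (1 - 2 * H) * hfun ξ)
      = ∫⁻ τ : ℝ, ∫⁻ ξ : EuclideanSpace ℝ (Fin N),
      ENNReal.ofReal (‖∑ j, (c j : ℂ) * Gker N (z j).1 (z j).2 τ ξ‖ ^ 2 * |τ| ^ (1 - 2 * H) * hfun ξ) := by
    rw [lintegral_lintegral_swap]
    exact (hm.comp measurable_swap).aemeasurable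
  have hne : ∀ᵐ ξ : EuclideanSpace ℝ (Fin N), ξ ≠ 0 := by simp [ae_iff]
  -- finiteness
  have hfin : ∫⁻ ξ : EuclideanSpace ℝ (Fin N), ∫⁻ τ : ℝ,
      ENNReal.ofReal (‖∑ j, (c j : ℂ) * Gker N (z j).1 (z j).2 τ ξ‖ ^ 2 * |τ| ^ (1 - 2 * H) * hfun ξ) < ∞ := by
    choose K hK hKb using fun j => Gker_tau (N := N) hH1 hH2 (hz j)
    have hintg := (xi_int hN hβN hβlow (by linarith) hβ0).const_mul (c₂ * (n * ∑ j, c j ^ 2 * K j))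
    refine lt_of_le_of_lt ?_ hintg.lintegral_lt_top
    refine lintegral_mono_ae ?_
    filter_upwards [hne] with ξ hξ
    have hρ : 0 < ‖ξ‖ := norm_pos_iff.2 hξ
    have hmj : ∀ j, Measurable fun τ : ℝ => ENNReal.ofReal (‖Gker N (z j).1 (z j).2 τ ξ‖ ^ 2 * |τ| ^ (1 - 2 * H)) := by
      intro j
      have := (Gker_measurable (z j).1 (z j).2).comp (measurable_id.prodMk (measurable_const (a := ξ)))
      have h2 : Measurable fun τ : ℝ => Gker N (z j).1 (z j).2 τ ξ := this
      fun_prop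
    have hc2 : 0 < c₂ := lt_of_lt_of_le hc₁ hc₁₂
    calc _ ≤ ∫⁻ τ : ℝ, ENNReal.ofReal (c₂ * ‖ξ‖ ^ (-β) * n) * ∑ j, ENNReal.ofReal (c j ^ 2) * ENNReal.ofReal (‖Gker N (z j).1 (z j).2 τ ξ‖ ^ 2 * |τ| ^ (1 - 2 * H)) := by
          refine lintegral_mono fun τ => ?_
          simp_rw [← ENNReal.ofReal_mul (sq_nonneg _)]
          rw [← ENNReal.ofReal_sum_of_nonneg (fun j _ => by positivity), ← ENNReal.ofReal_mul (by positivity)]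
          apply ENNReal.ofReal_le_ofReal
          have h1 := norm_sum_sq_le fun j => (c j : ℂ) * Gker N (z j).1 (z j).2 τ ξ
          calc _ ≤ (n * ∑ j, ‖(c j : ℂ) * Gker N (z j).1 (z j).2 τ ξ‖ ^ 2) * |τ| ^ (1 - 2 * H) * (c₂ * ‖ξ‖ ^ (-β)) := by
                gcongr
                · exact le_trans (by positivity) (hflow ξ hξ)
                · exact hfup ξ hξ
            _ = c₂ * ‖ξ‖ ^ (-β) * n * ((∑ j, ‖(c j : ℂ) * Gker N (z j).1 (z j).2 τ ξ‖ ^ 2) * |τ| ^ (1 - 2 * H)) := by ring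
            _ = _ := by
              rw [Finset.sum_mul]
              congr 1
              refine Finset.sum_congr rfl fun j _ => ?_
              rw [norm_mul, mul_pow, Complex.norm_real, Real.norm_eq_abs, sq_abs]; ring
      _ = ENNReal.ofReal (c₂ * ‖ξ‖ ^ (-β) * n) * ∑ j, ENNReal.ofReal (c j ^ 2) * ∫⁻ τ : ℝ, ENNReal.ofReal (‖Gker N (z j).1 (z j).2 τ ξ‖ ^ 2 * |τ| ^ (1 - 2 * H)) := by
          rw [lintegral_const_mul' _ _ ENNReal.ofReal_ne_top, lintegral_finsetSum _ (fun j _ => (hmj j).const_mul _)]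
          congr 1
          refine Finset.sum_congr rfl fun j _ => ?_
          rw [lintegral_const_mul' _ _ ENNReal.ofReal_ne_top]
      _ ≤ ENNReal.ofReal (c₂ * ‖ξ‖ ^ (-β) * n) * ∑ j, ENNReal.ofReal (c j ^ 2) * ENNReal.ofReal (K j * min 1 (‖ξ‖ ^ (-(2 * H + 1)))) := by
          gcongr with j
          exact hKb j _ ξ hξ
      _ ≤ _ := by
          have hmin : 0 ≤ min 1 (‖ξ‖ ^ (-(2 * H + 1))) := by positivity
          simp_rw [← ENNReal.ofReal_mul (sq_nonneg _)]
          rw [← ENNReal.ofReal_sum_of_nonneg (fun j _ => by have := (hK j).le; positivity), ← ENNReal.ofReal_mul (by positivity)]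
          apply ENNReal.ofReal_le_ofReal
          simp_rw [← mul_assoc]
          rw [← Finset.sum_mul]
          apply le_of_eq; ring
  rw [hswap] at hfin ⊢
  have hmo : Measurable fun τ : ℝ => ∫⁻ ξ : EuclideanSpace ℝ (Fin N),
      ENNReal.ofReal (‖∑ j, (c j : ℂ) * Gker N (z j).1 (z j).2 τ ξ‖ ^ 2 * |τ| ^ (1 - 2 * H) * hfun ξ) := hm.lintegral_prod_right'
  have e : Qvar N H hfun z c = ∫ τ : ℝ, (∫⁻ ξ : EuclideanSpace ℝ (Fin N),
      ENNReal.ofReal (‖∑ j, (c j : ℂ) * Gker N (z j).1 (z j).2 τ ξ‖ ^ 2 * |τ| ^ (1 - 2 * H) * hfun ξ)).toReal := by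
    unfold Qvar
    congr 1; ext τ
    rw [integral_eq_lintegral_of_nonneg_ae]
    · filter_upwards [hne] with ξ hξ
      have : 0 ≤ hfun ξ := le_trans (by positivity) (hflow ξ hξ)
      simp only [Pi.zero_apply]
      positivity
    · have : Measurable fun ξ : EuclideanSpace ℝ (Fin N) => _ := hm0.comp ((measurable_const (a := τ)).prodMk measurable_id)
      exact this.aestronglyMeasurable
  rw [e, integral_toReal hmo.aemeasurable (ae_lt_top hmo hfin.ne), ENNReal.ofReal_toReal hfin.ne]


/-- A smooth bump and its derivative, with their spectral representations. -/
lemma exists_bump {Ta : ℝ} (hTa : 0 < Ta) :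
    ∃ (b b' A B : ℝ → ℂ) (C : ℝ), 0 < C ∧ Continuous b' ∧ (∀ s, HasDerivAt b (b' s) s) ∧ Continuous A ∧ Continuous B ∧
      (∀ u, ‖A u‖ ≤ C * (1 + |u|) ^ (-(4:ℝ))) ∧ (∀ u, ‖B u‖ ≤ C * (1 + |u|) ^ (-(4:ℝ))) ∧
      (∀ s : ℝ, b' s = ∫ u : ℝ, Complex.exp (-Complex.I * s * u) * A u) ∧
      (∀ s : ℝ, b s = ∫ u : ℝ, Complex.exp (-Complex.I * s * u) * B u) ∧
      b 0 = 0 ∧ ∀ t, Ta ≤ t → b t = 0 ∧ ∫ s in (0:ℝ)..t, b s = 1 := by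
  let f : ContDiffBump (Ta / 2) := ⟨Ta / 8, Ta / 4, by positivity, by linarith⟩
  let b : ℝ → ℂ := fun x => ((f.normed volume x : ℝ) : ℂ)
  have hc : HasCompactSupport b := f.hasCompactSupport_normed.comp_left (g := fun x : ℝ => (x : ℂ)) (by simp)
  have hs : ContDiff ℝ (⊤ : ℕ∞) b := Complex.ofRealCLM.contDiff.comp (f.contDiff_normed (μ := volume))
  have hs' : ContDiff ℝ (⊤ : ℕ∞) (deriv b) := (contDiff_infty_iff_deriv.1 hs).2
  obtain ⟨B, hB, ⟨CB, hCB, hBb⟩, hBr⟩ := schwartz_rep (hc.toSchwartzMap hs)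
  obtain ⟨A, hA, ⟨CA, hCA, hAb⟩, hAr⟩ := schwartz_rep (hc.deriv.toSchwartzMap hs')
  have hz : ∀ x, x ≤ Ta / 4 ∨ 3 * Ta / 4 ≤ x → b x = 0 := by
    intro x hx
    have : f.normed volume x = 0 := by
      rw [ContDiffBump.normed_def, f.zero_of_le_dist, zero_div]
      rw [Real.dist_eq]
      change Ta / 4 ≤ _
      rcases hx with h | h
      · rw [abs_of_nonpos (by linarith)]; linarith
      · rw [abs_of_nonneg (by linarith)]; linarith
    simp [b, this]
  refine ⟨b, deriv b, A, B, CA + CB, by positivity, hs'.continuous, ?_, hA, hB, ?_, ?_, hAr, hBr, hz 0 (by left; positivity), ?_⟩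
  · intro s
    exact (hs.differentiable (by simp) s).hasDerivAt
  · intro u; refine (hAb u).trans ?_; gcongr; linarith
  · intro u; refine (hBb u).trans ?_; gcongr; linarith
  · intro t ht
    refine ⟨hz t (by right; linarith), ?_⟩
    rw [intervalIntegral.integral_of_le (by linarith), setIntegral_eq_integral_of_forall_compl_eq_zero]
    · change ∫ x, ((f.normed volume x : ℝ) : ℂ) = 1
      rw [integral_complex_ofReal, f.integral_normed]; simp
    · intro x hx
      apply hz
      by_contra h
      push Not at h
      exact hx ⟨by linarith, by linarith⟩

lemma theta_ft {A B : ℝ → ℂ} {C : ℝ} (hA : Continuous A) (hB : Continuous B)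
    (hAb : ∀ u, ‖A u‖ ≤ C * (1 + |u|) ^ (-(4:ℝ))) (hBb : ∀ u, ‖B u‖ ≤ C * (1 + |u|) ^ (-(4:ℝ))) (ρ s : ℝ) :
    ∫ τ : ℝ, Complex.exp (-Complex.I * s * τ) * (A (τ - ρ) - 2 * Complex.I * ρ * B (τ - ρ)) =
      Complex.exp (-Complex.I * ρ * s) * ((∫ u : ℝ, Complex.exp (-Complex.I * s * u) * A u) -
        2 * Complex.I * ρ * ∫ u : ℝ, Complex.exp (-Complex.I * s * u) * B u) := by
  rw [← integral_const_mul, ← integral_sub (integrable_exp_mul hA hAb s) ((integrable_exp_mul hB hBb s).const_mul _), ← integral_const_mul]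
  rw [← integral_sub_right_eq_self (fun u : ℝ => Complex.exp (-Complex.I * ρ * s) * (Complex.exp (-Complex.I * s * u) * A u - 2 * Complex.I * ρ * (Complex.exp (-Complex.I * s * u) * B u))) ρ]
  congr 1; ext τ
  rw [show -Complex.I * s * τ = -Complex.I * ρ * s + -Complex.I * s * ((τ - ρ : ℝ) : ℂ) by push_cast; ring, Complex.exp_add]
  ring

lemma theta_bound {A B : ℝ → ℂ} {C : ℝ} 
    (hAb : ∀ u, ‖A u‖ ≤ C * (1 + |u|) ^ (-(4:ℝ))) (hBb : ∀ u, ‖B u‖ ≤ C * (1 + |u|) ^ (-(4:ℝ))) {ρ : ℝ} (hρ : 0 < ρ) (u : ℝ) :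
    ‖A u - 2 * Complex.I * ρ * B u‖ ≤ 2 * C * (1 + ρ) * (1 + |u|) ^ (-(4:ℝ)) := by
  have h1 := hAb u
  have h2 := hBb u
  have h3 : ‖2 * Complex.I * ρ * B u‖ ≤ 2 * ρ * (C * (1 + |u|) ^ (-(4:ℝ))) := by
    rw [norm_mul, norm_mul, norm_mul, Complex.norm_real, Complex.norm_I, Real.norm_of_nonneg hρ.le]
    norm_num
    gcongr
    simpa using h2
  have h4 : 0 ≤ C * (1 + |u|) ^ (-(4:ℝ)) := (norm_nonneg _).trans h1
  refine (norm_sub_le _ _).trans ?_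
  nlinarith

lemma wave_primitive {b b' : ℝ → ℂ} (hb' : Continuous b') (hd : ∀ s, HasDerivAt b (b' s) s) (h0 : b 0 = 0) {t : ℝ}
    (ht : b t = 0) (hi : ∫ s in (0:ℝ)..t, b s = 1) {ρ : ℝ} (hρ : 0 < ρ) :
    ∫ s in (0:ℝ)..t, ((Real.sin ((t - s) * ρ) / ρ : ℝ) : ℂ) * (Complex.exp (-Complex.I * ρ * s) * (b' s - 2 * Complex.I * ρ * b s)) =
      Complex.exp (-Complex.I * ρ * t) := by
  have hbc : Continuous b := continuous_iff_continuousAt.2 fun s => (hd s).continuousAt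
  have hρ' : (ρ : ℂ) ≠ 0 := by exact_mod_cast hρ.ne'
  have hI : Complex.I ≠ 0 := Complex.I_ne_zero
  set w : ℝ → ℂ := fun s => (Complex.exp (Complex.I * ρ * t - 2 * Complex.I * ρ * s) - Complex.exp (-Complex.I * ρ * t)) / (2 * Complex.I * ρ) with hw
  have hw' : ∀ s : ℝ, HasDerivAt w (-Complex.exp (Complex.I * ρ * t - 2 * Complex.I * ρ * s)) s := by
    intro s
    have h1 : HasDerivAt (fun s : ℝ => Complex.I * ρ * t - 2 * Complex.I * ρ * (s : ℂ)) (-(2 * Complex.I * ρ * 1)) s :=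
      ((Complex.ofRealCLM.hasDerivAt (x := s)).const_mul (2 * Complex.I * (ρ : ℂ))).const_sub _
    have h2 := ((h1.cexp).sub_const (Complex.exp (-Complex.I * ρ * t))).div_const (2 * Complex.I * ρ)
    refine h2.congr_deriv ?_
    field_simp
  have hsin : ∀ s : ℝ, ((Real.sin ((t - s) * ρ) / ρ : ℝ) : ℂ) * Complex.exp (-Complex.I * ρ * s) = w s := by
    intro s
    simp only [hw]
    push_cast
    rw [Complex.sin]
    have e1 : Complex.exp (Complex.I * ρ * t - 2 * Complex.I * ρ * s) = Complex.exp ((t - s) * ρ * Complex.I) * Complex.exp (-Complex.I * ρ * s) := by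
      rw [← Complex.exp_add]; ring_nf
    have e2 : Complex.exp (-Complex.I * ρ * t) = Complex.exp (-((t - s) * ρ) * Complex.I) * Complex.exp (-Complex.I * ρ * s) := by
      rw [← Complex.exp_add]; ring_nf
    rw [e1, e2]
    field_simp
    rw [Complex.I_sq]; ring
  have e : ∀ s : ℝ, ((Real.sin ((t - s) * ρ) / ρ : ℝ) : ℂ) * (Complex.exp (-Complex.I * ρ * s) * (b' s - 2 * Complex.I * ρ * b s))
      = (b' s * w s + b s * (-Complex.exp (Complex.I * ρ * t - 2 * Complex.I * ρ * s))) + Complex.exp (-Complex.I * ρ * t) * b s := by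
    intro s
    rw [← mul_assoc, hsin]
    simp only [hw]
    field_simp
    ring
  simp_rw [e]
  have hwc : Continuous w := by simp only [hw]; fun_prop
  have hbw : ∀ s ∈ uIcc (0:ℝ) t, HasDerivAt (fun s => b s * w s) (b' s * w s + b s * (-Complex.exp (Complex.I * ρ * t - 2 * Complex.I * ρ * s))) s :=
    fun s _ => (hd s).mul (hw' s)
  rw [intervalIntegral.integral_add (by apply Continuous.intervalIntegrable; fun_prop) (by apply Continuous.intervalIntegrable; fun_prop),
    intervalIntegral.integral_eq_sub_of_hasDerivAt hbw (by apply Continuous.intervalIntegrable; fun_prop),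
    intervalIntegral.integral_const_mul, hi, h0, ht]
  simp



lemma Gker_theta {N : ℕ} {A B b b' : ℝ → ℂ} {C : ℝ} (hA : Continuous A) (hB : Continuous B)
    (hAb : ∀ u, ‖A u‖ ≤ C * (1 + |u|) ^ (-(4:ℝ))) (hBb : ∀ u, ‖B u‖ ≤ C * (1 + |u|) ^ (-(4:ℝ)))
    (hAr : ∀ s : ℝ, b' s = ∫ u : ℝ, Complex.exp (-Complex.I * s * u) * A u)
    (hBr : ∀ s : ℝ, b s = ∫ u : ℝ, Complex.exp (-Complex.I * s * u) * B u)
    (hb' : Continuous b') (hd : ∀ s, HasDerivAt b (b' s) s) (h0 : b 0 = 0) {t : ℝ} (ht0 : 0 ≤ t)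
    (ht : b t = 0) (hi : ∫ s in (0:ℝ)..t, b s = 1) (x ξ : EuclideanSpace ℝ (Fin N)) (hξ : ξ ≠ 0) :
    Integrable (fun τ : ℝ => Gker N t x τ ξ * (A (τ - ‖ξ‖) - 2 * Complex.I * ‖ξ‖ * B (τ - ‖ξ‖))) ∧
    ∫ τ : ℝ, Gker N t x τ ξ * (A (τ - ‖ξ‖) - 2 * Complex.I * ‖ξ‖ * B (τ - ‖ξ‖)) =
      Complex.exp (-Complex.I * (sdir ξ (t, x) : ℝ)) := by
  have hρ : 0 < ‖ξ‖ := norm_pos_iff.2 hξ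
  set Θ : ℝ → ℂ := fun τ => A (τ - ‖ξ‖) - 2 * Complex.I * ‖ξ‖ * B (τ - ‖ξ‖) with hΘ
  have hΘc : Continuous Θ := by simp only [hΘ]; fun_prop
  have hΘi : Integrable Θ := by
    have h4 : Integrable (fun u : ℝ => (1 + |u|) ^ (-(4:ℝ))) := by
      simpa using integrable_one_add_norm (E := ℝ) (μ := volume) (r := 4) (by simp)
    have h : Integrable (fun x : ℝ => 2 * C * (1 + ‖ξ‖) * (1 + |x - ‖ξ‖|) ^ (-(4:ℝ))) :=
      (h4.comp_sub_right ‖ξ‖).const_mul _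
    refine h.mono' hΘc.aestronglyMeasurable (Filter.Eventually.of_forall fun τ => ?_)
    exact theta_bound hAb hBb hρ (τ - ‖ξ‖)
  have hne : ∀ a : ℝ, ∀ᵐ τ : ℝ, τ ≠ a := by intro a; simp [ae_iff]
  have hGm : Measurable fun τ : ℝ => Gker N t x τ ξ := by
    unfold Gker; fun_prop
  constructor
  · refine (hΘi.norm.const_mul (t ^ 2 + 2 * t)).mono' (hGm.aestronglyMeasurable.mul hΘc.aestronglyMeasurable) ?_
    filter_upwards [hne (-‖ξ‖), hne ‖ξ‖] with τ h1 h2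
    have := (Gker_bounds ht0 x ξ τ hξ (fun h => h1 (by linarith)) (fun h => h2 (by linarith))).1
    rw [norm_mul]
    gcongr
    refine this.trans (div_le_self (by positivity) (by linarith [abs_nonneg τ]))
  · set S : ℝ → ℂ := fun s => ((Real.sin ((t - s) * ‖ξ‖) / ‖ξ‖ : ℝ) : ℂ) with hS
    have hSc : Continuous S := by simp only [hS]; fun_prop
    have hSi : Integrable S (volume.restrict (Ioc 0 t)) := (hSc.integrableOn_Icc).mono_set Ioc_subset_Icc_self
    have hprod : Integrable (Function.uncurry fun (τ s : ℝ) => Complex.exp (-Complex.I * s * τ) * S s * Θ τ) (volume.prod (volume.restrict (Ioc 0 t))) := by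
      have h := hΘi.mul_prod hSi
      refine h.mono (by apply Continuous.aestronglyMeasurable; simp only [Function.uncurry_def]; fun_prop) (Filter.Eventually.of_forall fun p => ?_)
      simp only [Function.uncurry_def]
      rw [norm_mul, norm_mul, show -Complex.I * p.2 * p.1 = ((-p.2 * p.1 : ℝ) : ℂ) * Complex.I by push_cast; ring,
        Complex.norm_exp_ofReal_mul_I, norm_mul]
      apply le_of_eq; ring
    have hsw := integral_integral_swap hprod
    calc _ = ∫ τ : ℝ, Complex.exp (-Complex.I * ((inner ℝ x ξ : ℝ) : ℂ)) * ∫ s in Ioc 0 t, Complex.exp (-Complex.I * s * τ) * S s * Θ τ := by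
          refine integral_congr_ae ?_
          filter_upwards [hne (-‖ξ‖), hne ‖ξ‖] with τ h1 h2
          rw [Gker_rep t x ξ τ hξ (fun h => h1 (by linarith)) (fun h => h2 (by linarith)), integral_mul_const,
            intervalIntegral.integral_of_le ht0, mul_assoc]
      _ = Complex.exp (-Complex.I * ((inner ℝ x ξ : ℝ) : ℂ)) * ∫ s in Ioc 0 t, ∫ τ : ℝ, Complex.exp (-Complex.I * s * τ) * S s * Θ τ := by
          rw [integral_const_mul, hsw]
      _ = Complex.exp (-Complex.I * ((inner ℝ x ξ : ℝ) : ℂ)) * Complex.exp (-Complex.I * ‖ξ‖ * t) := by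
          congr 1
          rw [← wave_primitive hb' hd h0 ht hi hρ, intervalIntegral.integral_of_le ht0]
          congr 1; ext s
          rw [hAr s, hBr s, ← theta_ft hA hB hAb hBb, ← integral_const_mul]
          congr 1; ext τ
          simp only [hS, hΘ]; ring
      _ = _ := by
          rw [← Complex.exp_add]; unfold sdir; congr 1; push_cast; ring


lemma tau_lower (N : ℕ) {H : ℝ} (hH1 : 1 / 2 ≤ H) (hH2 : H < 1) {Ta : ℝ} (hTa : 0 < Ta) :
    ∃ K : ℝ, 0 < K ∧ ∀ (n : ℕ) (z : Fin n → ℝ × EuclideanSpace ℝ (Fin N)), (∀ j, Ta ≤ (z j).1) → ∀ (c : Fin n → ℝ)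
      (ξ : EuclideanSpace ℝ (Fin N)), ξ ≠ 0 →
      ENNReal.ofReal (‖∑ l, (c l : ℂ) * Complex.exp (-Complex.I * (sdir ξ (z l) : ℝ))‖ ^ 2) ≤
      (∫⁻ τ : ℝ, ENNReal.ofReal (‖∑ j, (c j : ℂ) * Gker N (z j).1 (z j).2 τ ξ‖ ^ 2 * |τ| ^ (1 - 2 * H))) *
        ENNReal.ofReal (K * (1 + ‖ξ‖) ^ (2 * H + 1)) := by
  obtain ⟨b, b', A, B, C, hC, hb', hd, hA, hB, hAb, hBb, hAr, hBr, h0, ht⟩ := exists_bump hTa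
  have h4 : Integrable (fun u : ℝ => (1 + |u|) ^ (-(4:ℝ))) := by
    simpa using integrable_one_add_norm (E := ℝ) (μ := volume) (r := 4) (by simp)
  set K4 := ∫ u : ℝ, (1 + |u|) ^ (-(4:ℝ))
  have hK4 : 0 ≤ K4 := integral_nonneg fun u => by positivity
  refine ⟨(2 * C) ^ 2 * (K4 + 1), by positivity, ?_⟩
  intro n z hz c ξ hξ
  have hρ : 0 < ‖ξ‖ := norm_pos_iff.2 hξ
  set Θ : ℝ → ℂ := fun τ => A (τ - ‖ξ‖) - 2 * Complex.I * ‖ξ‖ * B (τ - ‖ξ‖) with hΘ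
  have hΘc : Continuous Θ := by simp only [hΘ]; fun_prop
  have hG : ∀ j, Integrable (fun τ : ℝ => Gker N (z j).1 (z j).2 τ ξ * Θ τ) ∧
      ∫ τ : ℝ, Gker N (z j).1 (z j).2 τ ξ * Θ τ = Complex.exp (-Complex.I * (sdir ξ (z j) : ℝ)) := fun j =>
    Gker_theta hA hB hAb hBb hAr hBr hb' hd h0 (by linarith [hz j]) (ht _ (hz j)).1 (ht _ (hz j)).2 (z j).2 ξ hξ
  set S : ℝ → ℂ := fun τ => ∑ j, (c j : ℂ) * Gker N (z j).1 (z j).2 τ ξ with hS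
  have hSm : Measurable S := by
    refine Finset.measurable_sum _ fun j _ => Measurable.const_mul ?_ _
    unfold Gker; fun_prop
  have e1 : ∑ l, (c l : ℂ) * Complex.exp (-Complex.I * (sdir ξ (z l) : ℝ)) = ∫ τ : ℝ, S τ * Θ τ := by
    simp_rw [← (hG _).2, ← integral_const_mul]
    rw [← integral_finsetSum _ (fun l _ => (hG l).1.const_mul _)]
    congr 1; ext τ
    simp only [hS]
    rw [Finset.sum_mul]
    refine Finset.sum_congr rfl fun l _ => by ring
  have hne : ∀ᵐ τ : ℝ, τ ≠ 0 := by simp [ae_iff]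
  set f : ℝ → ℝ≥0∞ := fun τ => ENNReal.ofReal (‖S τ‖ * |τ| ^ ((1 - 2 * H) / 2)) with hf
  set g : ℝ → ℝ≥0∞ := fun τ => ENNReal.ofReal (‖Θ τ‖ * |τ| ^ ((2 * H - 1) / 2)) with hg
  have hfm : Measurable f := by simp only [hf]; fun_prop
  have hgm : Measurable g := by have := hΘc.measurable; simp only [hg]; fun_prop
  have hsq : ∀ (x y r : ℝ), 0 ≤ x → (ENNReal.ofReal (x * |y| ^ (r / 2))) ^ 2 = ENNReal.ofReal (x ^ 2 * |y| ^ r) := by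
    intro x y r hx
    rw [← ENNReal.ofReal_pow (by positivity), mul_pow, ← Real.rpow_natCast (|y| ^ (r / 2)), ← Real.rpow_mul (abs_nonneg _)]
    norm_num
  have hcs := lintegral_cs volume f g hfm.aemeasurable hgm.aemeasurable
  calc _ = (ENNReal.ofReal ‖∫ τ : ℝ, S τ * Θ τ‖) ^ 2 := by rw [e1, ENNReal.ofReal_pow (norm_nonneg _)]
    _ ≤ (∫⁻ τ, f τ * g τ) ^ 2 := by
        gcongr
        rw [ofReal_norm]
        refine (enorm_integral_le_lintegral_enorm _).trans (lintegral_mono_ae ?_)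
        filter_upwards [hne] with τ hτ
        have : 0 < |τ| := abs_pos.2 hτ
        simp only [hf, hg]
        rw [← ENNReal.ofReal_mul (by positivity), ← ofReal_norm, norm_mul]
        apply ENNReal.ofReal_le_ofReal
        apply le_of_eq
        have : |τ| ^ ((1 - 2 * H) / 2) * |τ| ^ ((2 * H - 1) / 2) = 1 := by
          rw [← Real.rpow_add this]; ring_nf; simp
        linear_combination (-‖S τ‖ * ‖Θ τ‖) * this
    _ ≤ _ := hcs
    _ ≤ _ := by
        refine mul_le_mul' (le_of_eq ?_) ?_
        · refine lintegral_congr fun τ => ?_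
          simp only [hf]; exact hsq _ _ _ (norm_nonneg _)
        · calc _ ≤ ∫⁻ τ, ENNReal.ofReal ((2 * C) ^ 2 * (1 + ‖ξ‖) ^ (2 * H + 1) * (1 + |τ - ‖ξ‖|) ^ (-(4:ℝ))) := by
                refine lintegral_mono fun τ => ?_
                simp only [hg]
                rw [hsq _ _ _ (norm_nonneg _)]
                apply ENNReal.ofReal_le_ofReal
                have hb := theta_bound hAb hBb hρ (τ - ‖ξ‖)
                have hu0 := abs_nonneg (τ - ‖ξ‖)
                have htau : |τ| ≤ (1 + |τ - ‖ξ‖|) * (1 + ‖ξ‖) := by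
                  have : |τ| ≤ |τ - ‖ξ‖| + ‖ξ‖ := by
                    calc |τ| = |(τ - ‖ξ‖) + ‖ξ‖| := by ring_nf
                      _ ≤ _ := (abs_add_le _ _).trans (by rw [abs_of_pos hρ])
                  nlinarith
                set u := |τ - ‖ξ‖|
                have hp : |τ| ^ (2 * H - 1) ≤ (1 + u) * (1 + ‖ξ‖) ^ (2 * H - 1) := by
                  calc _ ≤ ((1 + u) * (1 + ‖ξ‖)) ^ (2 * H - 1) := by
                        gcongr; linarith
                    _ = (1 + u) ^ (2 * H - 1) * (1 + ‖ξ‖) ^ (2 * H - 1) := Real.mul_rpow (by positivity) (by positivity)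
                    _ ≤ _ := by
                        gcongr
                        calc _ ≤ (1 + u) ^ (1:ℝ) := Real.rpow_le_rpow_of_exponent_le (by linarith) (by linarith)
                          _ = _ := Real.rpow_one _
                have e8 : ((1 + u) ^ (-(4:ℝ))) ^ 2 * (1 + u) ≤ (1 + u) ^ (-(4:ℝ)) := by
                  have : (1 + u) ^ (-(4:ℝ)) * (1 + u) ≤ 1 := by
                    calc _ = (1 + u) ^ (-(3:ℝ)) := by
                          rw [← Real.rpow_add_one (by positivity)]; norm_num
                      _ ≤ 1 := Real.rpow_le_one_of_one_le_of_nonpos (by linarith) (by norm_num)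
                  have h5 : 0 ≤ (1 + u) ^ (-(4:ℝ)) := by positivity
                  nlinarith
                calc _ ≤ (2 * C * (1 + ‖ξ‖) * (1 + u) ^ (-(4:ℝ))) ^ 2 * ((1 + u) * (1 + ‖ξ‖) ^ (2 * H - 1)) := by
                      gcongr
                  _ = (2 * C) ^ 2 * ((1 + ‖ξ‖) ^ 2 * (1 + ‖ξ‖) ^ (2 * H - 1)) * (((1 + u) ^ (-(4:ℝ))) ^ 2 * (1 + u)) := by ring
                  _ ≤ (2 * C) ^ 2 * ((1 + ‖ξ‖) ^ 2 * (1 + ‖ξ‖) ^ (2 * H - 1)) * (1 + u) ^ (-(4:ℝ)) := by gcongr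
                  _ = _ := by
                      rw [← Real.rpow_natCast (1 + ‖ξ‖) 2, ← Real.rpow_add (by positivity)]
                      congr 3; push_cast; ring
            _ ≤ _ := by
                have hi : Integrable (fun τ : ℝ => (2 * C) ^ 2 * (1 + ‖ξ‖) ^ (2 * H + 1) * (1 + |τ - ‖ξ‖|) ^ (-(4:ℝ))) :=
                  (h4.comp_sub_right ‖ξ‖).const_mul _
                rw [← ofReal_integral_eq_lintegral_ofReal hi (Filter.Eventually.of_forall fun τ => by simp only [Pi.zero_apply]; positivity),
                  integral_const_mul, integral_sub_right_eq_self (fun u : ℝ => (1 + |u|) ^ (-(4:ℝ))) ‖ξ‖]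
                apply ENNReal.ofReal_le_ofReal
                have : 0 ≤ (2 * C) ^ 2 * (1 + ‖ξ‖) ^ (2 * H + 1) := by positivity
                change (2 * C) ^ 2 * (1 + ‖ξ‖) ^ (2 * H + 1) * K4 ≤ _
                nlinarith

lemma Q_lower {N : ℕ} (hN : 1 ≤ N) {H β : ℝ} (hH1 : 1 / 2 ≤ H) (hH2 : H < 1)
    (hβ0 : 0 < β) (hβN : β < N) (hβlow : (N : ℝ) - 2 * H - 1 < β)
    {hfun : EuclideanSpace ℝ (Fin N) → ℝ} (hmeas : Measurable hfun)
    {c₁ c₂ : ℝ} (hc₁ : 0 < c₁) (hc₁₂ : c₁ ≤ c₂)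
    (hflow : ∀ ξ : EuclideanSpace ℝ (Fin N), ξ ≠ 0 → c₁ * ‖ξ‖ ^ (-β) ≤ hfun ξ)
    (hfup : ∀ ξ : EuclideanSpace ℝ (Fin N), ξ ≠ 0 → hfun ξ ≤ c₂ * ‖ξ‖ ^ (-β))
    {Ta : ℝ} (hTa : 0 < Ta) {ι : ℕ} (p : Fin ι → EuclideanSpace ℝ (Fin N)) {δ : ℝ}
    (hp : ∀ η ∈ Metric.ball (0 : EuclideanSpace ℝ (Fin N)) δ, ∀ i, 1 / 2 ≤ ‖p i + η‖ ∧ ‖p i + η‖ ≤ 2) :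
    ∃ κ : ℝ, 0 < κ ∧ ∀ (n : ℕ) (z : Fin n → ℝ × EuclideanSpace ℝ (Fin N)), (∀ j, Ta ≤ (z j).1) → ∀ (c : Fin n → ℝ) (i : Fin ι),
      ENNReal.ofReal κ * ∫⁻ η in Metric.ball (0 : EuclideanSpace ℝ (Fin N)) δ,
        ENNReal.ofReal (Q1 N (alphaExp N H β) (fun l => sdir (p i + η) (z l)) c) ≤
      ENNReal.ofReal (Qvar N H hfun z c) := by
  have : Nonempty (Fin N) := ⟨⟨0, hN⟩⟩
  have : Nontrivial (EuclideanSpace ℝ (Fin N)) := inferInstance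
  have ha : 0 < alphaExp N H β := by unfold alphaExp; linarith
  obtain ⟨K, hK, hKb⟩ := tau_lower N hH1 hH2 hTa
  have h23 : (0:ℝ) < 2 ^ (-β) * 3 ^ (-(2 * H + 1)) := by positivity
  refine ⟨c₁ / K / 6 * (2 ^ (-β) * 3 ^ (-(2 * H + 1))), by positivity, ?_⟩
  intro n z hz c i
  rw [ENNReal.ofReal_mul (by positivity), mul_assoc]
  refine (mul_le_mul' le_rfl (radial_lower hN (by linarith) hβ0 ha (p i) (fun η hη => hp η hη i) z c)).trans ?_
  rw [← mul_assoc, show (6 : ℝ≥0∞) = ENNReal.ofReal 6 by norm_num, ← ENNReal.ofReal_mul (by positivity),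
    div_mul_cancel₀ _ (by norm_num), Qvar_eq hN hH1 hH2 hβ0 hβN hβlow hmeas hc₁ hc₁₂ hflow hfup z (fun j => by linarith [hz j]) c,
    ← lintegral_const_mul' _ _ ENNReal.ofReal_ne_top]
  have hne : ∀ᵐ ξ : EuclideanSpace ℝ (Fin N), ξ ≠ 0 := by simp [ae_iff]
  refine lintegral_mono_ae ?_
  filter_upwards [hne] with ξ hξ
  have hρ : 0 < ‖ξ‖ := norm_pos_iff.2 hξ
  have h1 := hKb n z hz c ξ hξ
  have hfl := hflow ξ hξ
  have hf0 : 0 ≤ hfun ξ := le_trans (by positivity) hfl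
  calc _ = ENNReal.ofReal (c₁ / K * (‖ξ‖ ^ (-β) * (1 + ‖ξ‖) ^ (-(2 * H + 1)))) * ENNReal.ofReal (‖∑ l, (c l : ℂ) * Complex.exp (-Complex.I * (sdir ξ (z l) : ℝ))‖ ^ 2) := by
        rw [← ENNReal.ofReal_mul (by positivity), ← ENNReal.ofReal_mul (by positivity)]; congr 1; ring
    _ ≤ ENNReal.ofReal (c₁ / K * (‖ξ‖ ^ (-β) * (1 + ‖ξ‖) ^ (-(2 * H + 1)))) * _ := mul_le_mul' le_rfl h1
    _ = (∫⁻ τ : ℝ, ENNReal.ofReal (‖∑ j, (c j : ℂ) * Gker N (z j).1 (z j).2 τ ξ‖ ^ 2 * |τ| ^ (1 - 2 * H))) * ENNReal.ofReal (c₁ * ‖ξ‖ ^ (-β)) := by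
        rw [mul_left_comm, ← ENNReal.ofReal_mul (by positivity)]
        congr 2
        rw [Real.rpow_neg (by positivity : 0 ≤ 1 + ‖ξ‖)]
        field_simp
    _ ≤ (∫⁻ τ : ℝ, ENNReal.ofReal (‖∑ j, (c j : ℂ) * Gker N (z j).1 (z j).2 τ ξ‖ ^ 2 * |τ| ^ (1 - 2 * H))) * ENNReal.ofReal (hfun ξ) := by gcongr
    _ = _ := by
        rw [← lintegral_mul_const' _ _ ENNReal.ofReal_ne_top]
        refine lintegral_congr fun τ => ?_
        rw [← ENNReal.ofReal_mul (by positivity)]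


lemma numeric_final {N : ℕ} {a q d κθ δ0 L r : ℝ} (hq : 0 < q) (hκ : 0 < κθ) (hδ : 0 < δ0)
    (hL : 0 < L) (hr : 0 < r) (n : ℕ) :
    (n * q / κθ) ^ (n * q / 2) * ((1 / δ0) ^ n * (L ^ n * (n.factorial : ℝ) ^ (a * (d / (N + 1 : ℕ)) + a * q / (N + 1 : ℕ)) *
      (4 * (N + 1) * r) ^ (n * (1 - (a * (d / (N + 1 : ℕ)) + a * q / (N + 1 : ℕ))))) ^ (N + 1)) ≤
    (Real.exp (q / 2) * (q / κθ) ^ (q / 2) * (1 / δ0) * L ^ (N + 1) * (4 * (N + 1)) ^ (1 + N - a * (d + q))) ^ n *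
      (n.factorial : ℝ) ^ (a * d + (1 / 2 + a) * q) * r ^ ((n : ℝ) * (1 + N - a * (d + q))) := by
  set F : ℝ := (n.factorial : ℝ) with hF
  have hF0 : 0 < F := by rw [hF]; positivity
  have hN1 : ((N + 1 : ℕ) : ℝ) = N + 1 := by push_cast; ring
  have hN0 : (0:ℝ) < N + 1 := by positivity
  set γ := a * (d / (N + 1 : ℕ)) + a * q / (N + 1 : ℕ) with hγ
  have hγ' : γ * (N + 1) = a * (d + q) := by rw [hγ, hN1]; field_simp
  set e := 1 + N - a * (d + q) with he
  have h1 : (n * q / κθ) ^ (n * q / 2) ≤ (Real.exp (q / 2) * (q / κθ) ^ (q / 2)) ^ n * F ^ (q / 2) := by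
    rw [mul_div_assoc, Real.mul_rpow (by positivity) (by positivity), mul_pow, mul_div_assoc (n : ℝ) q 2]
    have e1 : (q / κθ) ^ (n * (q / 2)) = ((q / κθ) ^ (q / 2)) ^ n := by
      rw [mul_comm, Real.rpow_mul (by positivity), Real.rpow_natCast]
    rw [e1]
    have := nn_le n (g := q / 2) (by positivity)
    calc _ ≤ (Real.exp (q / 2) ^ n * F ^ (q / 2)) * ((q / κθ) ^ (q / 2)) ^ n := by gcongr
      _ = _ := by ring
  have h2 : (F ^ γ) ^ (N + 1) = F ^ (a * (d + q)) := by
    rw [← Real.rpow_natCast, ← Real.rpow_mul hF0.le, hN1, hγ']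
  have h3 : ((4 * (N + 1) * r) ^ (n * (1 - γ))) ^ (N + 1) = ((4 * (N + 1)) ^ e) ^ n * r ^ ((n : ℝ) * e) := by
    rw [← Real.rpow_natCast _ (N + 1), ← Real.rpow_mul (by positivity), hN1, show n * (1 - γ) * ((N : ℝ) + 1) = n * e by
      rw [he, ← hγ']; ring, Real.mul_rpow (by positivity) hr.le]
    congr 1
    rw [mul_comm (n : ℝ) e, Real.rpow_mul (by positivity), Real.rpow_natCast]
  have h4 : F ^ (a * d + (1 / 2 + a) * q) = F ^ (q / 2) * F ^ (a * (d + q)) := by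
    rw [← Real.rpow_add hF0]; congr 1; ring
  rw [h4, mul_pow (L ^ n * F ^ γ), mul_pow (L ^ n), h2, h3]
  calc _ ≤ ((Real.exp (q / 2) * (q / κθ) ^ (q / 2)) ^ n * F ^ (q / 2)) * ((1 / δ0) ^ n * ((L ^ n) ^ (N + 1) * F ^ (a * (d + q)) * (((4 * (N + 1)) ^ e) ^ n * r ^ ((n : ℝ) * e)))) := by
        gcongr
    _ = _ := by
        rw [mul_pow _ ((4 * ((N : ℝ) + 1)) ^ e), mul_pow _ (L ^ (N + 1)), mul_pow _ (1 / δ0), ← pow_mul, ← pow_mul, mul_comm n (N + 1)]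
        ring

lemma fixed_dir (N : ℕ) {a : ℝ} (ha : 0 < a) {κ : ℝ} (hκ : 0 < κ)
    (hS : ∀ (n : ℕ) (s c : Fin n → ℝ) (j : Fin n) (ε : ℝ), 0 < ε → ε ≤ 1 →
      (∀ l, l ≠ j → ε ≤ |s l - s j|) → κ * ε ^ (2 * a) * c j ^ 2 ≤ Q1 N a s c)
    {θ : ℝ} (hθ : 0 < θ) {d : ℕ} (hd : 0 < d) {q : ℝ} (hq : 0 < q)
    (haq : a * (d + 2 * q) < 1 + N) {δ0 : ℝ} (hδ : 0 < δ0) :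
    ∃ C : ℝ, 0 < C ∧ ∀ (m : ℕ) (qm : Fin (m + 1) → Fin d → ℝ), (∀ j k, 0 ≤ qm j k) → (∀ j, ∑ k, qm j k = q) →
      ∀ r : ℝ, 0 < r → r ≤ 1 / (4 * (N + 1)) → ∀ v : Fin (N + 1) → EuclideanSpace ℝ (Fin N), δ0 ≤ |(dmat v).det| →
      ∀ I : Set (ℝ × EuclideanSpace ℝ (Fin N)), MeasurableSet I →
      (∀ z ∈ I, ∀ z' ∈ I, ∀ i, |sdir (v i) z - sdir (v i) z'| ≤ 2 * (N + 1) * r) →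
      ∫⁻ z in univ.pi (fun _ : Fin (m + 1) => I), ∏ k : Fin d, ∫⁻ c : Fin (m + 1) → ℝ,
        ENNReal.ofReal ((∏ j, |c j| ^ qm j k) * Real.exp (-θ * ∑ i, Q1 N a (fun l => sdir (v i) (z l)) c)) ≤
      ENNReal.ofReal (C ^ (m + 1) * ((m + 1).factorial : ℝ) ^ (a * d + (1 / 2 + a) * q) *
        r ^ (((m + 1 : ℕ) : ℝ) * (1 + N - a * (d + q)))) := by
  set γ1 := a * (d / (N + 1 : ℕ) : ℝ) with hγ1
  set γ2 := a * q / (N + 1 : ℕ) with hγ2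
  have hd0 : (0:ℝ) < d := by exact_mod_cast hd
  have hg1 : 0 < γ1 := by positivity
  have hg2 : 0 < γ2 := by positivity
  have hg : γ1 + 2 * γ2 < 1 := by
    have : γ1 + 2 * γ2 = a * (d + 2 * q) / (N + 1 : ℕ) := by rw [hγ1, hγ2]; ring
    rw [this, div_lt_one (by positivity)]; push_cast; linarith
  set G0 := Real.Gamma (1 - γ1) + Real.Gamma (1 - γ1 - 2 * γ2) with hG0
  have hG0p : 0 < G0 := add_pos (Real.Gamma_pos_of_pos (by linarith)) (Real.Gamma_pos_of_pos (by linarith))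
  set B := √(Real.pi / (θ / 2 * κ)) ^ (d / (N + 1 : ℕ) : ℝ) with hB
  have hBp : 0 < B := by have := Real.pi_pos; positivity
  set L := B * Real.exp 1 * (1 + G0) * Real.exp (γ1 + γ2) * 2 with hL
  have hLp : 0 < L := by positivity
  refine ⟨Real.exp (q / 2) * (q / (κ * θ)) ^ (q / 2) * (1 / δ0) * L ^ (N + 1) * (4 * (N + 1)) ^ (1 + N - a * (d + q)), by positivity, ?_⟩
  intro m qm hqm hqs r hr hr1 v hv I hI hdiam
  rcases I.eq_empty_or_nonempty with rfl | ⟨z0, hz0⟩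
  · rw [show (univ.pi fun _ : Fin (m + 1) => (∅ : Set (ℝ × EuclideanSpace ℝ (Fin N)))) = ∅ from univ_pi_empty]
    simp
  set R := 4 * (N + 1) * r with hRdef
  have hR : 0 < R := by positivity
  have hR1 : R ≤ 1 := by
    rw [le_div_iff₀ (by positivity)] at hr1; rw [hRdef]; linarith
  set lam := ((m + 1 : ℕ) : ℝ) / R with hlam
  have hlam1 : 1 ≤ lam := by
    rw [hlam, le_div_iff₀ hR]
    have : (1:ℝ) ≤ ((m + 1 : ℕ) : ℝ) := by push_cast; linarith [(Nat.cast_nonneg m : (0:ℝ) ≤ m)]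
    linarith
  have hlam0 : 0 < lam := by linarith
  set Bm := B ^ (m + 1) * lam ^ ((m + 1 : ℕ) * γ2) * Real.exp (lam * R) with hBm
  have hBm0 : 0 < Bm := by positivity
  set Φ : (Fin (m + 1) → ℝ) → ℝ≥0∞ := fun y => ENNReal.ofReal Bm * ∑ π : Equiv.Perm (Fin (m + 1)), Psi (fker γ1 γ2 lam) (y ∘ π) with hΦ
  have hΦm : Measurable Φ := by
    refine Measurable.const_mul (Finset.measurable_sum _ fun π _ => ?_) _
    refine (Psi_measurable (fker_measurable γ1 γ2 lam) m).comp ?_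
    exact measurable_pi_lambda _ fun j => measurable_pi_apply _
  set A : Fin (N + 1) → Set ℝ := fun i => Icc (sdir (v i) z0 - R / 2) (sdir (v i) z0 + R / 2) with hA
  have hIA : ∀ z ∈ I, ∀ i, sdir (v i) z ∈ A i := by
    intro z hz i
    have := abs_le.1 (hdiam z hz z0 hz0 i)
    simp only [hA, hRdef]
    constructor <;> linarith [this.1, this.2]
  have hAm : ∀ i, MeasurableSet (A i) := fun i => measurableSet_Icc
  have hΦi : ∀ i, ∫⁻ y in univ.pi (fun _ : Fin (m + 1) => A i), Φ y ≤
      ENNReal.ofReal (L ^ (m + 1) * ((m + 1).factorial : ℝ) ^ (γ1 + γ2) * R ^ ((m + 1 : ℕ) * (1 - (γ1 + γ2)))) := by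
    intro i
    simp only [hΦ]
    rw [lintegral_const_mul' _ _ ENNReal.ofReal_ne_top]
    have hvol : volume (A i) = ENNReal.ofReal R := by
      simp only [hA]; rw [Real.volume_Icc]; congr 1; ring
    calc _ ≤ ENNReal.ofReal Bm * ((m + 1).factorial * (volume (A i) * (∫⁻ x, fker γ1 γ2 lam x) ^ m)) := by
          gcongr; exact lintegral_Psisum (fker_measurable _ _ _) _ (hAm i) m
      _ ≤ ENNReal.ofReal Bm * ((m + 1).factorial * (ENNReal.ofReal R * (ENNReal.ofReal (lam ^ (γ1 - 1) * G0)) ^ m)) := by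
          rw [hvol]; gcongr; exact lintegral_fker hlam0 hg2.le hg
      _ = ENNReal.ofReal (Bm * ((m + 1).factorial * (R * (lam ^ (γ1 - 1) * G0) ^ m))) := by
          rw [← ENNReal.ofReal_natCast, ← ENNReal.ofReal_pow (by positivity), ← ENNReal.ofReal_mul hR.le, ← ENNReal.ofReal_mul (by positivity), ← ENNReal.ofReal_mul hBm0.le]
      _ ≤ _ := ENNReal.ofReal_le_ofReal (numeric_dir hBp.le hG0p.le hg1 hg2.le hR hR1 m)
  calc _ ≤ ∫⁻ z in univ.pi (fun _ : Fin (m + 1) => I), ENNReal.ofReal (((m + 1 : ℕ) * q / (κ * θ)) ^ ((m + 1 : ℕ) * q / 2)) *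
        ∏ i, Φ (fun l => sdir (v i) (z l)) := by
        refine setLIntegral_mono' (MeasurableSet.univ_pi fun _ => hI) fun z hz => ?_
        refine pointwise_bound N ha hκ hS hθ (Nat.succ_pos N) hd hq hlam1 hR1 qm hqm hqs (fun i l => sdir (v i) (z l)) ?_
        intro i j l
        have := hdiam (z j) (hz j trivial) (z l) (hz l trivial) i
        refine this.trans ?_
        rw [hRdef]; nlinarith
    _ = ENNReal.ofReal (((m + 1 : ℕ) * q / (κ * θ)) ^ ((m + 1 : ℕ) * q / 2)) * ∫⁻ z in univ.pi (fun _ : Fin (m + 1) => I), ∏ i, Φ (fun l => sdir (v i) (z l)) :=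
        lintegral_const_mul' _ _ ENNReal.ofReal_ne_top
    _ ≤ ENNReal.ofReal (((m + 1 : ℕ) * q / (κ * θ)) ^ ((m + 1 : ℕ) * q / 2)) * (ENNReal.ofReal (1 / δ0) ^ (m + 1) * ∏ i, ∫⁻ y in univ.pi (fun _ : Fin (m + 1) => A i), Φ y) := by
        gcongr
        exact change_var v hδ hv I hI A hAm hIA (fun _ => Φ) (fun _ => hΦm)
    _ ≤ ENNReal.ofReal (((m + 1 : ℕ) * q / (κ * θ)) ^ ((m + 1 : ℕ) * q / 2)) * (ENNReal.ofReal (1 / δ0) ^ (m + 1) * ∏ i : Fin (N + 1), 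
          ENNReal.ofReal (L ^ (m + 1) * ((m + 1).factorial : ℝ) ^ (γ1 + γ2) * R ^ ((m + 1 : ℕ) * (1 - (γ1 + γ2))))) := by
        gcongr with i
        exact hΦi i
    _ ≤ _ := by
        rw [Finset.prod_const, Finset.card_univ, Fintype.card_fin, ← ENNReal.ofReal_pow (by positivity), ← ENNReal.ofReal_pow (by positivity),
          ← ENNReal.ofReal_mul (by positivity), ← ENNReal.ofReal_mul (by positivity)]
        exact ENNReal.ofReal_le_ofReal (numeric_final hq (by positivity) hδ hLp hr (m + 1))


lemma Qvar_nonneg {N : ℕ} (hN : 1 ≤ N) {H β : ℝ}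
    {hfun : EuclideanSpace ℝ (Fin N) → ℝ} {c₁ : ℝ} (hc₁ : 0 < c₁)
    (hflow : ∀ ξ : EuclideanSpace ℝ (Fin N), ξ ≠ 0 → c₁ * ‖ξ‖ ^ (-β) ≤ hfun ξ)
    {n : ℕ} (z : Fin n → ℝ × EuclideanSpace ℝ (Fin N)) (c : Fin n → ℝ) :
    0 ≤ Qvar N H hfun z c := by
  have : Nonempty (Fin N) := ⟨⟨0, hN⟩⟩
  have : Nontrivial (EuclideanSpace ℝ (Fin N)) := inferInstance
  unfold Qvar
  refine integral_nonneg fun τ => integral_nonneg_of_ae ?_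
  have h0 : ∀ᵐ ξ : EuclideanSpace ℝ (Fin N), ξ ≠ 0 := by
    simp [ae_iff]
  filter_upwards [h0] with ξ hξ
  have : 0 ≤ hfun ξ := le_trans (by positivity) (hflow ξ hξ)
  simp only [Pi.zero_apply]
  positivity

lemma Q1_measurable (N : ℕ) (a : ℝ) (n : ℕ) :
    Measurable (fun x : (Fin n → ℝ) × (Fin n → ℝ) => Q1 N a x.1 x.2) := by
  unfold Q1
  have hw := w1_measurable N a
  have : Measurable (fun y : ((Fin n → ℝ) × (Fin n → ℝ)) × ℝ =>
      w1 N a y.2 * ‖∑ j, (y.1.2 j : ℂ) * Complex.exp (-Complex.I * y.2 * y.1.1 j)‖ ^ 2) := by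
    refine (hw.comp measurable_snd).mul ?_
    fun_prop
  exact (StronglyMeasurable.integral_prod_right' (ν := (volume : Measure ℝ)) this.stronglyMeasurable).measurable

/-- Jensen inequality for a product of exponential integrals -/
lemma jensen_prod {E : Type*} [MeasurableSpace E] (P : Measure E) [IsProbabilityMeasure P] {n d : ℕ}
    (G : E → (Fin n → ℝ) → ℝ) (hG : Measurable (fun x : E × (Fin n → ℝ) => G x.1 x.2))
    (hG0 : ∀ η c, 0 ≤ G η c) (Q : (Fin n → ℝ) → ℝ) (hQ : ∀ c, 0 ≤ Q c)
    (hGQ : ∀ c, ∫⁻ η, ENNReal.ofReal (G η c) ∂P ≤ ENNReal.ofReal (Q c))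
    (F : Fin d → (Fin n → ℝ) → ℝ) (hF : ∀ k, Measurable (F k)) (hF0 : ∀ k c, 0 ≤ F k c) :
    ∏ k, ∫⁻ c, ENNReal.ofReal (F k c * Real.exp (-Q c)) ≤
      ∫⁻ η, (∏ k, ∫⁻ c, ENNReal.ofReal (F k c * Real.exp (-G η c))) ∂P := by
  have hGc : ∀ c, Measurable (fun η => G η c) := fun c => hG.comp (measurable_id.prodMk measurable_const)
  have hGη : ∀ η, Measurable (fun c => G η c) := fun η => hG.comp (measurable_const.prodMk measurable_id)
  have hintg : ∀ c, Integrable (fun η => G η c) P := by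
    intro c
    refine ⟨(hGc c).aestronglyMeasurable, ?_⟩
    rw [hasFiniteIntegral_iff_ofReal (Filter.Eventually.of_forall fun η => hG0 η c)]
    exact (hGQ c).trans_lt ENNReal.ofReal_lt_top
  set m : (Fin n → ℝ) → ℝ := fun c => ∫ η, G η c ∂P with hm
  have hmm : Measurable m :=
    (StronglyMeasurable.integral_prod_left' (μ := P) hG.stronglyMeasurable).measurable
  have hmQ : ∀ c, m c ≤ Q c := by
    intro c
    rw [← ENNReal.ofReal_le_ofReal_iff (hQ c), hm,
      ofReal_integral_eq_lintegral_ofReal (hintg c) (Filter.Eventually.of_forall fun η => hG0 η c)]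
    exact hGQ c
  have hcol : ∀ k : Fin d, Measurable (fun (x : Fin n → Fin d → ℝ) (l : Fin n) => x l k) := by
    intro k; fun_prop
  calc ∏ k, ∫⁻ c, ENNReal.ofReal (F k c * Real.exp (-Q c))
      ≤ ∏ k, ∫⁻ c, ENNReal.ofReal (F k c * Real.exp (-m c)) := by
        refine Finset.prod_le_prod' fun k _ => lintegral_mono fun c => ENNReal.ofReal_le_ofReal ?_
        exact mul_le_mul_of_nonneg_left (Real.exp_le_exp.2 (neg_le_neg (hmQ c))) (hF0 k c)
    _ = ∫⁻ x : Fin n → Fin d → ℝ, ∏ k, ENNReal.ofReal (F k (fun l => x l k) * Real.exp (-m (fun l => x l k))) :=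
        (lintegral_swap_prod d (fun k c => ENNReal.ofReal (F k c * Real.exp (-m c)))
          (fun k => ((hF k).mul (Real.measurable_exp.comp hmm.neg)).ennreal_ofReal)).symm
    _ ≤ ∫⁻ x : Fin n → Fin d → ℝ, ∫⁻ η, ∏ k, ENNReal.ofReal (F k (fun l => x l k) * Real.exp (-G η (fun l => x l k))) ∂P := by
        refine lintegral_mono fun x => ?_
        have hsplit : ∀ g : Fin d → ℝ, ∏ k, ENNReal.ofReal (F k (fun l => x l k) * Real.exp (-g k)) =
            ENNReal.ofReal (∏ k, F k (fun l => x l k)) * ENNReal.ofReal (Real.exp (-∑ k, g k)) := by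
          intro g
          rw [← ENNReal.ofReal_prod_of_nonneg (fun k _ => mul_nonneg (hF0 _ _) (Real.exp_nonneg _)),
            Finset.prod_mul_distrib, ← Real.exp_sum, Finset.sum_neg_distrib,
            ENNReal.ofReal_mul (Finset.prod_nonneg fun k _ => hF0 _ _)]
        simp only [hsplit]
        have hsm : Measurable (fun η => ∑ k, G η (fun l => x l k)) :=
          Finset.measurable_sum _ (fun k _ => hGc _)
        have hem : Measurable (fun η => Real.exp (-∑ k, G η (fun l => x l k))) := Real.measurable_exp.comp hsm.neg
        rw [lintegral_const_mul _ hem.ennreal_ofReal]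
        refine mul_le_mul' le_rfl ?_
        have hsi : Integrable (fun η => -∑ k, G η (fun l => x l k)) P :=
          (integrable_finsetSum _ (fun k _ => hintg _)).neg
        have hei : Integrable (fun η => Real.exp (-∑ k, G η (fun l => x l k))) P := by
          refine Integrable.of_bound hem.aestronglyMeasurable 1 (Filter.Eventually.of_forall fun η => ?_)
          rw [Real.norm_eq_abs, abs_of_pos (Real.exp_pos _), Real.exp_le_one_iff, neg_nonpos]
          exact Finset.sum_nonneg fun k _ => hG0 _ _
        rw [← ofReal_integral_eq_lintegral_ofReal hei (Filter.Eventually.of_forall fun η => Real.exp_nonneg _)]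
        refine ENNReal.ofReal_le_ofReal ?_
        have hj := ConvexOn.map_integral_le (μ := P) convexOn_exp Real.continuous_exp.continuousOn isClosed_univ
          (Filter.Eventually.of_forall fun η => mem_univ _) hsi hei
        refine le_trans (le_of_eq ?_) hj
        rw [integral_neg, integral_finsetSum _ (fun k _ => hintg _)]
    _ = ∫⁻ η, (∫⁻ x : Fin n → Fin d → ℝ, ∏ k, ENNReal.ofReal (F k (fun l => x l k) * Real.exp (-G η (fun l => x l k)))) ∂P := by
        refine lintegral_lintegral_swap ?_
        refine Measurable.aemeasurable ?_
        refine Finset.measurable_prod _ fun k _ => Measurable.ennreal_ofReal ?_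
        refine ((hF k).comp ((hcol k).comp measurable_fst)).mul (Real.measurable_exp.comp (Measurable.neg ?_))
        exact hG.comp (measurable_snd.prodMk ((hcol k).comp measurable_fst))
    _ = _ := by
        refine lintegral_congr fun η => ?_
        exact (lintegral_swap_prod d (fun k c => ENNReal.ofReal (F k c * Real.exp (-G η c)))
          (fun k => ((hF k).mul (Real.measurable_exp.comp (hGη η).neg)).ennreal_ofReal))

lemma sdir_diam {N : ℕ} (v : EuclideanSpace ℝ (Fin N)) (hv : ‖v‖ ≤ 2) {r : ℝ} (hr : 0 < r)
    {ia ib : ℝ} {ja jb : Fin N → ℝ} (h1 : ib - ia ≤ r) (h2 : ∀ i, jb i - ja i ≤ r)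
    (z z' : ℝ × EuclideanSpace ℝ (Fin N))
    (hz : z.1 ∈ Icc ia ib ∧ ∀ i, z.2 i ∈ Icc (ja i) (jb i))
    (hz' : z'.1 ∈ Icc ia ib ∧ ∀ i, z'.2 i ∈ Icc (ja i) (jb i)) :
    |sdir v z - sdir v z'| ≤ 2 * (N + 1) * r := by
  have e : sdir v z - sdir v z' = (z.1 - z'.1) * ‖v‖ + inner ℝ (z.2 - z'.2) v := by
    unfold sdir; rw [inner_sub_left]; ring
  have ht : |z.1 - z'.1| ≤ r := by
    rw [abs_le]; constructor <;> linarith [hz.1.1, hz.1.2, hz'.1.1, hz'.1.2]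
  have hx : ‖z.2 - z'.2‖ ≤ N * r := by
    rw [EuclideanSpace.norm_eq]
    refine Real.sqrt_le_iff.2 ⟨by positivity, ?_⟩
    have : ∀ i ∈ (Finset.univ : Finset (Fin N)), ‖(z.2 - z'.2) i‖ ^ 2 ≤ r ^ 2 := by
      intro i _
      refine pow_le_pow_left₀ (norm_nonneg _) ?_ 2
      rw [Real.norm_eq_abs, PiLp.sub_apply, abs_le]
      constructor <;> linarith [(hz.2 i).1, (hz.2 i).2, (hz'.2 i).1, (hz'.2 i).2, h2 i]
    refine (Finset.sum_le_sum this).trans ?_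
    rw [Finset.sum_const, Finset.card_univ, Fintype.card_fin, nsmul_eq_mul, mul_pow]
    have : (N : ℝ) ≤ (N : ℝ) ^ 2 := by exact_mod_cast Nat.le_self_pow (by norm_num) N
    exact mul_le_mul_of_nonneg_right this (by positivity)
  rw [e]
  refine (abs_add_le _ _).trans ?_
  rw [abs_mul, abs_norm]
  have h3 := abs_real_inner_le_norm (z.2 - z'.2) v
  have h4 : |z.1 - z'.1| * ‖v‖ ≤ r * 2 := mul_le_mul ht hv (norm_nonneg _) hr.le
  have h5 : ‖z.2 - z'.2‖ * ‖v‖ ≤ N * r * 2 := mul_le_mul hx hv (norm_nonneg _) (by positivity)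
  linarith


lemma sdir_joint_measurable {N n : ℕ} (p : EuclideanSpace ℝ (Fin N)) :
    Measurable (fun y : (Fin n → ℝ × EuclideanSpace ℝ (Fin N)) × EuclideanSpace ℝ (Fin N) =>
      (fun l => sdir (p + y.2) (y.1 l))) := by
  unfold sdir
  refine measurable_pi_lambda _ fun l => ?_
  have h1 : Measurable (fun y : (Fin n → ℝ × EuclideanSpace ℝ (Fin N)) × EuclideanSpace ℝ (Fin N) => y.1 l) :=
    (measurable_pi_apply l).comp measurable_fst
  have h2 : Measurable (fun y : (Fin n → ℝ × EuclideanSpace ℝ (Fin N)) × EuclideanSpace ℝ (Fin N) => p + y.2) :=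
    measurable_snd.const_add _
  exact (h1.fst.mul h2.norm).add (h1.snd.inner h2)

lemma Q1_measurable_comp {X : Type*} [MeasurableSpace X] (N : ℕ) (a : ℝ) {n : ℕ} {f g : X → Fin n → ℝ}
    (hf : Measurable f) (hg : Measurable g) : Measurable (fun x => Q1 N a (f x) (g x)) := by
  have h1 : Measurable (fun x => (f x, g x)) := hf.prodMk hg
  have h2 := Q1_measurable N a n
  generalize hΦ : (fun x : (Fin n → ℝ) × (Fin n → ℝ) => Q1 N a x.1 x.2) = Φ at h2
  have h3 : (fun x => Q1 N a (f x) (g x)) = fun x => Φ (f x, g x) := by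
    rw [← hΦ]
  rw [h3]
  exact h2.comp h1

lemma sdir_measurable_comp {X : Type*} [MeasurableSpace X] {N n : ℕ} (p : EuclideanSpace ℝ (Fin N))
    {f : X → Fin n → ℝ × EuclideanSpace ℝ (Fin N)} {g : X → EuclideanSpace ℝ (Fin N)}
    (hf : Measurable f) (hg : Measurable g) :
    Measurable (fun x => (fun l => sdir (p + g x) (f x l))) :=
  (sdir_joint_measurable p).comp (hf.prodMk hg)

lemma Gsum_measurable {X : Type*} [MeasurableSpace X] {N n ι : ℕ} (a θ : ℝ) (p : Fin ι → EuclideanSpace ℝ (Fin N))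
    {f : X → Fin n → ℝ × EuclideanSpace ℝ (Fin N)} {g : X → EuclideanSpace ℝ (Fin N)} {h : X → Fin n → ℝ}
    (hf : Measurable f) (hg : Measurable g) (hh : Measurable h) :
    Measurable (fun x => θ * ∑ i, Q1 N a (fun l => sdir (p i + g x) (f x l)) (h x)) := by
  have h1 : ∀ i, Measurable (fun x => Q1 N a (fun l => sdir (p i + g x) (f x l)) (h x)) := fun i =>
    Q1_measurable_comp N a (sdir_measurable_comp (p i) hf hg) hh
  have h2 : Measurable (fun x => ∑ i, Q1 N a (fun l => sdir (p i + g x) (f x l)) (h x)) :=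
    Finset.measurable_sum _ fun i _ => h1 i
  exact h2.const_mul _

/-- the integrand for a fixed perturbation of the directions -/
noncomputable def Jdir {N n ι d : ℕ} (a θ : ℝ) (p : Fin ι → EuclideanSpace ℝ (Fin N)) (qm : Fin n → Fin d → ℝ)
    (z : Fin n → ℝ × EuclideanSpace ℝ (Fin N)) (η : EuclideanSpace ℝ (Fin N)) : ℝ≥0∞ :=
  ∏ k, ∫⁻ c : Fin n → ℝ, ENNReal.ofReal ((∏ j, |c j| ^ qm j k) *
      Real.exp (-(θ * ∑ i, Q1 N a (fun l => sdir (p i + η) (z l)) c)))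

lemma Fprod_measurable {n d : ℕ} (qm : Fin n → Fin d → ℝ) (k : Fin d) :
    Measurable (fun c : Fin n → ℝ => ∏ j, |c j| ^ qm j k) := by
  refine Finset.measurable_prod _ fun j _ => ?_
  have : Measurable (fun c : Fin n → ℝ => |c j|) := (measurable_pi_apply j).abs
  exact this.pow_const _

lemma Jdir_measurable {N n ι d : ℕ} (a θ : ℝ) (p : Fin ι → EuclideanSpace ℝ (Fin N)) (qm : Fin n → Fin d → ℝ) :
    Measurable (Function.uncurry (Jdir a θ p qm)) := by
  have : Function.uncurry (Jdir a θ p qm) = fun y : (Fin n → ℝ × EuclideanSpace ℝ (Fin N)) × EuclideanSpace ℝ (Fin N) =>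
      ∏ k, ∫⁻ c : Fin n → ℝ, ENNReal.ofReal ((∏ j, |c j| ^ qm j k) *
      Real.exp (-(θ * ∑ i, Q1 N a (fun l => sdir (p i + y.2) (y.1 l)) c))) := rfl
  rw [this]
  refine Finset.measurable_prod _ fun k _ => ?_
  refine Measurable.lintegral_prod_right' (f := fun y : ((Fin n → ℝ × EuclideanSpace ℝ (Fin N)) × EuclideanSpace ℝ (Fin N)) × (Fin n → ℝ) =>
      ENNReal.ofReal ((∏ j, |y.2 j| ^ qm j k) *
      Real.exp (-(θ * ∑ i, Q1 N a (fun l => sdir (p i + y.1.2) (y.1.1 l)) y.2)))) ?_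
  exact (((Fprod_measurable qm k).comp measurable_snd).mul
    (Real.measurable_exp.comp (Gsum_measurable a θ p measurable_fst.fst measurable_fst.snd measurable_snd).neg)).ennreal_ofReal

lemma box_measurable {N : ℕ} (ia ib : ℝ) (ja jb : Fin N → ℝ) :
    MeasurableSet {p : ℝ × EuclideanSpace ℝ (Fin N) | p.1 ∈ Icc ia ib ∧ ∀ i, p.2 i ∈ Icc (ja i) (jb i)} := by
  refine (measurable_fst measurableSet_Icc).inter ?_
  have : {p : ℝ × EuclideanSpace ℝ (Fin N) | ∀ i, p.2 i ∈ Icc (ja i) (jb i)} =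
      ⋂ i, (fun p : ℝ × EuclideanSpace ℝ (Fin N) => p.2 i) ⁻¹' Icc (ja i) (jb i) := by
    ext p; simp only [mem_ofPred_eq, mem_iInter, mem_preimage]
  have h2 : MeasurableSet {p : ℝ × EuclideanSpace ℝ (Fin N) | ∀ i, p.2 i ∈ Icc (ja i) (jb i)} := by
    rw [this]
    refine MeasurableSet.iInter fun i => ?_
    have hc : Measurable (fun p : ℝ × EuclideanSpace ℝ (Fin N) => p.2 i) := by fun_prop
    exact hc measurableSet_Icc
  exact h2

lemma jensen_step {N n d : ℕ} {a θ κ V : ℝ} (hθ : 0 < θ) (hV : 0 < V)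
    (hκ : 0 ≤ κ) (hθdef : θ = κ * V / (2 * (N + 1)))
    (P : Measure (EuclideanSpace ℝ (Fin N))) [IsProbabilityMeasure P] (B : Set (EuclideanSpace ℝ (Fin N)))
    (hP : P = ENNReal.ofReal V⁻¹ • volume.restrict B)
    (p : Fin (N + 1) → EuclideanSpace ℝ (Fin N)) (qm : Fin n → Fin d → ℝ)
    (z : Fin n → ℝ × EuclideanSpace ℝ (Fin N)) (Q : (Fin n → ℝ) → ℝ) (hQ0 : ∀ c, 0 ≤ Q c)
    (hQ : ∀ c i, ENNReal.ofReal κ * ∫⁻ η in B, ENNReal.ofReal (Q1 N a (fun l => sdir (p i + η) (z l)) c) ≤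
      ENNReal.ofReal (Q c)) :
    ∏ k : Fin d, ∫⁻ c : Fin n → ℝ,
      ENNReal.ofReal ((∏ j, |c j| ^ (qm j k)) * Real.exp (-(1 / 2) * Q c)) ≤
      ∫⁻ η, Jdir a θ p qm z η ∂P := by
  have key := jensen_prod P (fun η c => θ * ∑ i, Q1 N a (fun l => sdir (p i + η) (z l)) c)
    (Gsum_measurable a θ p measurable_const measurable_fst measurable_snd)
    (fun η c => mul_nonneg hθ.le (Finset.sum_nonneg fun i _ => Q1_nonneg N a _ _))
    (fun c => 1 / 2 * Q c)
    (fun c => mul_nonneg (by norm_num) (hQ0 c)) ?_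
    (fun k c => ∏ j, |c j| ^ qm j k) (Fprod_measurable qm)
    (fun k c => Finset.prod_nonneg fun j _ => Real.rpow_nonneg (abs_nonneg _) _)
  · have key' := key
    simpa only [neg_mul, Jdir] using key'
  · intro c
    have hqm1 : ∀ i, Measurable (fun η => ENNReal.ofReal (Q1 N a (fun l => sdir (p i + η) (z l)) c)) := by
      intro i
      refine Measurable.ennreal_ofReal ?_
      exact Q1_measurable_comp N a (sdir_measurable_comp (p i) measurable_const measurable_id) measurable_const
    have e1 : ∀ η, ENNReal.ofReal (θ * ∑ i, Q1 N a (fun l => sdir (p i + η) (z l)) c) =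
        ENNReal.ofReal θ * ∑ i, ENNReal.ofReal (Q1 N a (fun l => sdir (p i + η) (z l)) c) := by
      intro η
      rw [ENNReal.ofReal_mul hθ.le, ENNReal.ofReal_sum_of_nonneg fun i _ => Q1_nonneg N a _ _]
    simp only [e1]
    rw [lintegral_const_mul _ (Finset.measurable_sum _ fun i _ => hqm1 i),
      lintegral_finsetSum _ (fun i _ => hqm1 i), hP]
    simp only [lintegral_smul_measure, smul_eq_mul]
    rw [← Finset.mul_sum, ← mul_assoc, ← ENNReal.ofReal_mul hθ.le]
    have e2 : θ * V⁻¹ = 1 / (2 * (N + 1)) * κ := by rw [hθdef]; field_simp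
    rw [e2, ENNReal.ofReal_mul (by positivity), mul_assoc, Finset.mul_sum]
    refine (mul_le_mul' le_rfl (Finset.sum_le_sum fun i _ => hQ c i)).trans (le_of_eq ?_)
    rw [Finset.sum_const, Finset.card_univ, Fintype.card_fin, nsmul_eq_mul, ← mul_assoc,
      ← ENNReal.ofReal_natCast, ← ENNReal.ofReal_mul (by positivity), ← ENNReal.ofReal_mul (by positivity)]
    congr 1
    push_cast
    field_simp

/-- Lemma 4.8(ii): the moment bound
`∫_{Iⁿ} J(z̄) dz̄ ≤ Cⁿ (n!)^{αd + (1/2 + α)q} r^{n(1 + N − α(d + q))}`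
for subintervals `I ⊆ T` with side lengths at most `r ≤ r₀`, where `J(z̄)` is written via
the Gaussian integrals `∫_{ℝⁿ} (∏_j |c_j|^{q_{j,k}}) exp(−(1/2) Q(c; z̄)) dc`. -/
theorem moment_estimate_J_ii
    (N : ℕ) (hN : 1 ≤ N) (H β : ℝ) (hH1 : 1 / 2 ≤ H) (hH2 : H < 1)
    (hβ0 : 0 < β) (hβN : β < N)
    (hβlow : (N : ℝ) - 2 * H - 1 < β) (hβup : β < (N : ℝ) - 2 * H + 1)
    (hfun : EuclideanSpace ℝ (Fin N) → ℝ) (hmeas : Measurable hfun)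
    (c₁ c₂ : ℝ) (hc₁ : 0 < c₁) (hc₁₂ : c₁ ≤ c₂)
    (hflow : ∀ ξ : EuclideanSpace ℝ (Fin N), ξ ≠ 0 → c₁ * ‖ξ‖ ^ (-β) ≤ hfun ξ)
    (hfup : ∀ ξ : EuclideanSpace ℝ (Fin N), ξ ≠ 0 → hfun ξ ≤ c₂ * ‖ξ‖ ^ (-β))
    (d : ℕ) (hd : 1 ≤ d) (q : ℝ) (hq : 0 < q)
    (hαq : alphaExp N H β * (d + 2 * q) < 1 + N)
    (Ta Tb : ℝ) (hTa : 0 < Ta) (Xa Xb : Fin N → ℝ) :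
    ∃ C r₀ : ℝ, 0 < C ∧ 0 < r₀ ∧
      ∀ n : ℕ, 2 ≤ n →
        ∀ qm : Fin n → Fin d → ℝ,
          (∀ j k, 0 ≤ qm j k) → (∀ j, ∑ k, qm j k = q) →
          ∀ r : ℝ, 0 < r → r ≤ r₀ →
          ∀ (ia ib : ℝ) (ja jb : Fin N → ℝ),
            {p : ℝ × EuclideanSpace ℝ (Fin N) |
                p.1 ∈ Icc ia ib ∧ ∀ i, p.2 i ∈ Icc (ja i) (jb i)} ⊆
              {p : ℝ × EuclideanSpace ℝ (Fin N) |
                p.1 ∈ Icc Ta Tb ∧ ∀ i, p.2 i ∈ Icc (Xa i) (Xb i)} →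
            ib - ia ≤ r → (∀ i, jb i - ja i ≤ r) →
            (∫⁻ z in Set.univ.pi (fun _ : Fin n =>
                {p : ℝ × EuclideanSpace ℝ (Fin N) |
                  p.1 ∈ Icc ia ib ∧ ∀ i, p.2 i ∈ Icc (ja i) (jb i)}),
              ∏ k : Fin d, ∫⁻ c : Fin n → ℝ,
                ENNReal.ofReal ((∏ j, |c j| ^ (qm j k)) *
                  Real.exp (-(1 / 2) * Qvar N H hfun z c))) ≤
              ENNReal.ofReal (C ^ n *
                  (n.factorial : ℝ) ^ (alphaExp N H β * d + (1 / 2 + alphaExp N H β) * q) *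
                  r ^ ((n : ℝ) * (1 + N - alphaExp N H β * (d + q)))) := by
  have ha : 0 < alphaExp N H β := by unfold alphaExp; linarith
  have ha1 : alphaExp N H β < 1 := by unfold alphaExp; linarith
  obtain ⟨κ₁, hκ₁, hS⟩ := SLND1 N ha ha1
  obtain ⟨p, δ, δ0, hδ, hδ0, hp⟩ := exists_dirs N hN
  obtain ⟨κ₂, hκ₂, hQ⟩ := Q_lower hN hH1 hH2 hβ0 hβN hβlow hmeas hc₁ hc₁₂ hflow hfup hTa p
    (fun η hη => (hp η hη).1)
  set a := alphaExp N H β with hadef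
  set B : Set (EuclideanSpace ℝ (Fin N)) := Metric.ball 0 δ with hB
  have hV0 : volume B ≠ 0 := (Metric.measure_ball_pos volume _ hδ).ne'
  have hVt : volume B ≠ ⊤ := measure_ball_lt_top.ne
  set V : ℝ := (volume B).toReal with hV
  have hVpos : 0 < V := ENNReal.toReal_pos hV0 hVt
  have hVe : volume B = ENNReal.ofReal V := (ENNReal.ofReal_toReal hVt).symm
  set P : Measure (EuclideanSpace ℝ (Fin N)) := (volume B)⁻¹ • volume.restrict B with hP
  have hPp : IsProbabilityMeasure P := by
    constructor
    rw [hP, Measure.smul_apply, Measure.restrict_apply_univ, smul_eq_mul, ENNReal.inv_mul_cancel hV0 hVt]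
  have hPae : ∀ᵐ η ∂P, η ∈ B :=
    Measure.ae_smul_measure (ae_restrict_mem measurableSet_ball) _
  set θ : ℝ := κ₂ * V / (2 * (N + 1)) with hθdef
  have hθ : 0 < θ := by positivity
  obtain ⟨C, hC, hfix⟩ := fixed_dir N ha hκ₁ hS hθ (d := d) (by omega) hq hαq hδ0
  refine ⟨C, 1 / (4 * (N + 1)), hC, by positivity, ?_⟩
  intro n hn qm hqm hqs r hr hr0 ia ib ja jb hsub hib hjb
  obtain ⟨m, rfl⟩ : ∃ m, n = m + 1 := ⟨n - 1, by omega⟩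
  set I : Set (ℝ × EuclideanSpace ℝ (Fin N)) :=
    {p | p.1 ∈ Icc ia ib ∧ ∀ i, p.2 i ∈ Icc (ja i) (jb i)} with hI
  have hIm : MeasurableSet I := box_measurable ia ib ja jb
  have hpim : MeasurableSet (univ.pi (fun _ : Fin (m + 1) => I)) :=
    MeasurableSet.univ_pi fun _ => hIm
  have hP' : P = ENNReal.ofReal V⁻¹ • volume.restrict B := by
    rw [hP, hVe, ENNReal.ofReal_inv_of_pos hVpos]
  have hstep : ∀ z ∈ univ.pi (fun _ : Fin (m + 1) => I), ∏ k : Fin d, ∫⁻ c : Fin (m + 1) → ℝ,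
      ENNReal.ofReal ((∏ j, |c j| ^ (qm j k)) * Real.exp (-(1 / 2) * Qvar N H hfun z c)) ≤
      ∫⁻ η, Jdir a θ p qm z η ∂P := by
    intro z hz
    have hzT : ∀ j, Ta ≤ (z j).1 := fun j => (hsub (hz j (mem_univ j))).1.1
    exact jensen_step hθ hVpos hκ₂.le hθdef P B hP' p qm z _
      (fun c => Qvar_nonneg hN hc₁ hflow z c) (fun c i => hQ (m + 1) z hzT c i)
  calc _ ≤ ∫⁻ z in univ.pi (fun _ : Fin (m + 1) => I), ∫⁻ η, Jdir a θ p qm z η ∂P := setLIntegral_mono' hpim hstep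
    _ = ∫⁻ η, (∫⁻ z in univ.pi (fun _ : Fin (m + 1) => I), Jdir a θ p qm z η) ∂P :=
        lintegral_lintegral_swap (Jdir_measurable a θ p qm).aemeasurable
    _ ≤ ∫⁻ _, ENNReal.ofReal (C ^ (m + 1) * ((m + 1).factorial : ℝ) ^ (a * d + (1 / 2 + a) * q) *
        r ^ (((m + 1 : ℕ) : ℝ) * (1 + N - a * (d + q)))) ∂P := by
        refine lintegral_mono_ae ?_
        filter_upwards [hPae] with η hη
        have h := hfix m qm hqm hqs r hr hr0 (fun i => p i + η) (hp η hη).2 I hIm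
          (fun z hz z' hz' i => sdir_diam (p i + η) ((hp η hη).1 i).2 hr hib hjb z z' hz hz')
        simpa only [Jdir, neg_mul] using h
    _ = _ := by rw [lintegral_const, measure_univ, mul_one]
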